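/- Let A be a basic indecomposable artin algebra. Then, for all but finitely many isomorphism classes of nonprojective cycle-finite modules M in ind A, one has α(M) ≤ 2. -/

import Mathlib

/-!
Common framework: finite length modules over a ring, the radical of the module
category, cycles of indecomposable modules, Auslander-Reiten quivers,
translation quivers notions, and classes of artin algebras.
Right `A`-modules are formalized as left `Aᵐᵒᵖ`-modules.
-/

universe u

/-- A bundled object of `mod R`: a finite length `R`-module. -/
structure ModA (R : Type u) [Ring R] : Type (u + 1) where
  M : Type u
  [acg : AddCommGroup M]
  [mod : Module R M]
  finLen : IsFiniteLength R M

attribute [instance] ModA.acg ModA.mod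

/-- A bundled (not necessarily finite length) `R`-module. -/
structure RawMod (R : Type u) [Ring R] : Type (u + 1) where
  M : Type u
  [acg : AddCommGroup M]
  [mod : Module R M]

attribute [instance] RawMod.acg RawMod.mod

/-- A module is indecomposable iff it is nonzero and its endomorphism ring has no
nontrivial idempotents. -/
def IsIndecMod (R : Type u) [Ring R] (M : Type u) [AddCommGroup M] [Module R M] : Prop :=
  Nontrivial M ∧ ∀ f : Module.End R M, f * f = f → f = 0 ∨ f = 1

namespace ModA

variable {R : Type u} [Ring R]

/-- Indecomposability of an object of `mod R`. -/
def IsIndec (X : ModA R) : Prop := IsIndecMod R X.M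

/-- Isomorphism of objects of `mod R`. -/
def Iso (X Y : ModA R) : Prop := Nonempty (X.M ≃ₗ[R] Y.M)

end ModA

/-- Membership in the radical `rad(X, Y)` of the category `mod R`: a map `f : X → Y`
belongs to the radical iff for every indecomposable `Z` and all `g : Z → X`, `h : Y → Z`
the composite `h ∘ f ∘ g` is not an isomorphism. -/
def InRad {R : Type u} [Ring R] {X Y : ModA R} (f : X.M →ₗ[R] Y.M) : Prop :=
  ∀ Z : ModA R, Z.IsIndec → ∀ (g : Z.M →ₗ[R] X.M) (h : Y.M →ₗ[R] Z.M),
    ¬Function.Bijective (h.comp (f.comp g))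

/-- The powers `rad^n` of the radical of `mod R`. -/
def radPow (R : Type u) [Ring R] : ℕ → ∀ X Y : ModA R, AddSubgroup (X.M →ₗ[R] Y.M)
  | 0, _, _ => ⊤
  | n + 1, X, Y => AddSubgroup.closure
      {f | ∃ (Z : ModA R) (g : X.M →ₗ[R] Z.M) (h : Z.M →ₗ[R] Y.M),
        InRad g ∧ h ∈ radPow R n Z Y ∧ f = h.comp g}

/-- Membership in the infinite radical `rad^∞ = ⋂ₙ radⁿ` of `mod R`. -/
def InRadInf {R : Type u} [Ring R] {X Y : ModA R} (f : X.M →ₗ[R] Y.M) : Prop :=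
  ∀ n : ℕ, f ∈ radPow R n X Y

/-- A cycle in `ind R`: a sequence of nonzero nonisomorphisms
`M₀ → M₁ → ⋯ → M_{r-1} → M_r = M₀` between indecomposable modules. -/
structure ModCycle (R : Type u) [Ring R] : Type (u + 1) where
  len : ℕ
  len_pos : 0 < len
  obj : Fin (len + 1) → ModA R
  obj_indec : ∀ i, (obj i).IsIndec
  closed : obj (Fin.last len) = obj 0
  hom : ∀ i : Fin len, (obj i.castSucc).M →ₗ[R] (obj i.succ).M
  hom_ne_zero : ∀ i, hom i ≠ 0
  hom_not_iso : ∀ i, ¬Function.Bijective (hom i)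

/-- A cycle is finite if none of its homomorphisms lies in the infinite radical. -/
def ModCycle.IsFiniteCycle {R : Type u} [Ring R] (c : ModCycle R) : Prop :=
  ∀ i, ¬InRadInf (c.hom i)

/-- The cycle passes through the module `M`. -/
def ModCycle.Passes {R : Type u} [Ring R] (c : ModCycle R) (M : ModA R) : Prop :=
  ∃ i, (c.obj i).Iso M

/-- A module is cycle-finite if it lies on a cycle and every cycle through it is finite. -/
def IsCycleFiniteModule {R : Type u} [Ring R] (M : ModA R) : Prop :=
  (∃ c : ModCycle R, c.Passes M) ∧ ∀ c : ModCycle R, c.Passes M → c.IsFiniteCycle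

/-- A module is directing if it lies on no cycle. -/
def IsDirectingModule {R : Type u} [Ring R] (M : ModA R) : Prop :=
  ¬∃ c : ModCycle R, c.Passes M

section Irreducible

variable {R : Type u} [Ring R]

/-- `f` is a split monomorphism (a section). -/
def SplitMonoMap {X Y : ModA R} (f : X.M →ₗ[R] Y.M) : Prop :=
  ∃ r : Y.M →ₗ[R] X.M, r.comp f = LinearMap.id

/-- `f` is a split epimorphism (a retraction). -/
def SplitEpiMap {X Y : ModA R} (f : X.M →ₗ[R] Y.M) : Prop :=
  ∃ s : Y.M →ₗ[R] X.M, f.comp s = LinearMap.id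

/-- `f` is an irreducible homomorphism. -/
def IsIrred {X Y : ModA R} (f : X.M →ₗ[R] Y.M) : Prop :=
  ¬SplitMonoMap f ∧ ¬SplitEpiMap f ∧
    ∀ (Z : ModA R) (g : X.M →ₗ[R] Z.M) (h : Z.M →ₗ[R] Y.M), h.comp g = f →
      SplitMonoMap g ∨ SplitEpiMap h

end Irreducible

/-- An almost split (Auslander-Reiten) sequence `0 → l → m → r → 0` in `mod R`. -/
structure AlmostSplitSeq (R : Type u) [Ring R] : Type (u + 1) where
  l : ModA R
  m : ModA R
  r : ModA R
  f : l.M →ₗ[R] m.M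
  g : m.M →ₗ[R] r.M
  inj : Function.Injective f
  surj : Function.Surjective g
  exact : LinearMap.range f = LinearMap.ker g
  not_split : ¬SplitEpiMap g
  l_indec : l.IsIndec
  r_indec : r.IsIndec
  right_almost : ∀ (Z : ModA R) (h : Z.M →ₗ[R] r.M), ¬SplitEpiMap h →
      ∃ h' : Z.M →ₗ[R] m.M, g.comp h' = h
  left_almost : ∀ (Z : ModA R) (h : l.M →ₗ[R] Z.M), ¬SplitMonoMap h →
      ∃ h' : m.M →ₗ[R] Z.M, h'.comp f = h

/-- `N ≅ τ M` for the Auslander-Reiten translation `τ = DTr`. -/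
def IsTauOf {R : Type u} [Ring R] (N M : ModA R) : Prop :=
  ∃ s : AlmostSplitSeq R, s.l.Iso N ∧ s.r.Iso M

/-- The indecomposable objects of `mod R`. -/
def IndecModA (R : Type u) [Ring R] := {X : ModA R // X.IsIndec}

/-- Isomorphism is an equivalence relation on indecomposable modules. -/
def isoSetoid (R : Type u) [Ring R] : Setoid (IndecModA R) where
  r X Y := X.1.Iso Y.1
  iseqv :=
    { refl := fun X => ⟨LinearEquiv.refl R X.1.M⟩
      symm := fun h => h.elim fun e => ⟨e.symm⟩
      trans := fun h h' => h.elim fun e => h'.elim fun e' => ⟨e.trans e'⟩ }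

/-- The vertices of the Auslander-Reiten quiver `Γ_R`: isomorphism classes of
indecomposable modules in `mod R`. -/
def ARVertex (R : Type u) [Ring R] := Quotient (isoSetoid R)

/-- The vertex of `Γ_R` given by an indecomposable module. -/
def ARVertex.mk {R : Type u} [Ring R] (X : IndecModA R) : ARVertex R :=
  Quotient.mk (isoSetoid R) X

section ARQuiver

variable {R : Type u} [Ring R]

/-- The arrows of the Auslander-Reiten quiver: `x → y` iff there is an irreducible
homomorphism between representatives. -/
def ARArrow (x y : ARVertex R) : Prop :=
  ∃ (X Y : IndecModA R) (f : X.1.M →ₗ[R] Y.1.M),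
    IsIrred f ∧ ARVertex.mk X = x ∧ ARVertex.mk Y = y

/-- `TauRel x y` iff `x = τ y` in the Auslander-Reiten quiver. -/
def TauRel (x y : ARVertex R) : Prop :=
  ∃ X Y : IndecModA R, ARVertex.mk X = x ∧ ARVertex.mk Y = y ∧ IsTauOf X.1 Y.1

/-- A vertex given by an (indecomposable) projective module. -/
def IsProjVertex (x : ARVertex R) : Prop :=
  ∃ X : IndecModA R, ARVertex.mk X = x ∧ Module.Projective R X.1.M

/-- A vertex given by an (indecomposable) injective module. -/
def IsInjVertex (x : ARVertex R) : Prop :=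
  ∃ X : IndecModA R, ARVertex.mk X = x ∧ Module.Injective R X.1.M

/-- The vertex lies on an oriented cycle of `Γ_R`. -/
def OnARCycle (x : ARVertex R) : Prop := Relation.TransGen ARArrow x x

/-- An edge (arrow in either direction) of the underlying graph of `Γ_R`. -/
def ARStep (x y : ARVertex R) : Prop := ARArrow x y ∨ ARArrow y x

/-- `D` is a connected component of the full subquiver of `Γ_R` on the vertex set `S`. -/
def IsComponentOf (S D : Set (ARVertex R)) : Prop :=
  D ⊆ S ∧ D.Nonempty ∧
    (∀ x ∈ D, ∀ y ∈ S, ARStep x y → y ∈ D) ∧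
    ∀ x ∈ D, ∀ y ∈ D, Relation.ReflTransGen (fun a b => a ∈ S ∧ b ∈ S ∧ ARStep a b) x y

/-- `C` is a connected component of `Γ_R`. -/
def IsARComponent (C : Set (ARVertex R)) : Prop := IsComponentOf Set.univ C

/-- The vertex lies on an oriented cycle all of whose vertices belong to `S`. -/
def OnCycleIn (S : Set (ARVertex R)) (x : ARVertex R) : Prop :=
  Relation.TransGen (fun a b => a ∈ S ∧ b ∈ S ∧ ARArrow a b) x x

/-- `Γ` is a connected component of the cyclic quiver `_cΓ_R` (a cyclic component). -/
def IsCyclicComponent (Γ : Set (ARVertex R)) : Prop :=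
  IsComponentOf {x | OnARCycle x} Γ

/-- A vertex represented by a cycle-finite module. -/
def IsCycleFiniteVertex (x : ARVertex R) : Prop :=
  ∃ X : IndecModA R, ARVertex.mk X = x ∧ IsCycleFiniteModule X.1

/-- A vertex represented by a directing module. -/
def IsDirectingVertex (x : ARVertex R) : Prop :=
  ∃ X : IndecModA R, ARVertex.mk X = x ∧ IsDirectingModule X.1

/-- A cycle-finite cyclic component: a cyclic component containing a cycle-finite module. -/
def IsCycleFiniteCyclicComponent (Γ : Set (ARVertex R)) : Prop :=
  IsCyclicComponent Γ ∧ ∃ x ∈ Γ, IsCycleFiniteVertex x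

/-- A full translation subquiver is cyclic if each of its vertices lies on an oriented
cycle inside it. -/
def IsCyclicSub (S : Set (ARVertex R)) : Prop := ∀ x ∈ S, OnCycleIn S x

/-- A full translation subquiver is coherent: every projective vertex is the start of an
infinite sectional path inside it, and every injective vertex is the end of an infinite
sectional path inside it. -/
def IsCoherentSub (S : Set (ARVertex R)) : Prop :=
  (∀ x ∈ S, IsProjVertex x → ∃ c : ℕ → ARVertex R, c 0 = x ∧ (∀ n, c n ∈ S) ∧
      (∀ n, ARArrow (c n) (c (n + 1))) ∧ ∀ n, ¬TauRel (c n) (c (n + 2))) ∧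
  (∀ x ∈ S, IsInjVertex x → ∃ c : ℕ → ARVertex R, c 0 = x ∧ (∀ n, c n ∈ S) ∧
      (∀ n, ARArrow (c (n + 1)) (c n)) ∧ ∀ n, ¬TauRel (c (n + 2)) (c n))

/-- `S` is a convex subquiver of (the full subquiver on) `C`: every path in `C` with
source and target in `S` has all its vertices in `S`. -/
def ConvexIn (C S : Set (ARVertex R)) : Prop :=
  ∀ (n : ℕ) (c : ℕ → ARVertex R), (∀ k ≤ n, c k ∈ C) →
    (∀ k < n, ARArrow (c k) (c (k + 1))) → c 0 ∈ S → c n ∈ S → ∀ k ≤ n, c k ∈ S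

/-- `S` is the core of the almost acyclic component `C`: the finite convex subquiver of
`C` containing all vertices lying on oriented cycles in `C`. -/
def IsCoreOf (C S : Set (ARVertex R)) : Prop :=
  S ⊆ C ∧ S.Finite ∧ ConvexIn C S ∧ ∀ x ∈ C, OnCycleIn C x → x ∈ S

/-- A component is almost acyclic if all but finitely many of its vertices do not lie on
oriented cycles. -/
def IsAlmostAcyclicComp (C : Set (ARVertex R)) : Prop := {x ∈ C | OnCycleIn C x}.Finite

/-- A component is almost cyclic if its cyclic part is cofinite. -/
def IsAlmostCyclicComp (C : Set (ARVertex R)) : Prop := {x ∈ C | ¬OnCycleIn C x}.Finite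

/-- Two vertices lie in the same `τ`-orbit. -/
def TauConn (x y : ARVertex R) : Prop :=
  Relation.ReflTransGen (fun a b => TauRel a b ∨ TauRel b a) x y

/-- The left stable part of `C`: remove the `τ`-orbits of projective vertices. -/
def leftStable (C : Set (ARVertex R)) : Set (ARVertex R) :=
  {x | x ∈ C ∧ ¬∃ y, TauConn x y ∧ IsProjVertex y}

/-- The right stable part of `C`: remove the `τ`-orbits of injective vertices. -/
def rightStable (C : Set (ARVertex R)) : Set (ARVertex R) :=
  {x | x ∈ C ∧ ¬∃ y, TauConn x y ∧ IsInjVertex y}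

/-- The stable part of `C`. -/
def stablePart (C : Set (ARVertex R)) : Set (ARVertex R) := leftStable C ∩ rightStable C

end ARQuiver

/-- The arrows of the translation quiver `ℤA∞/(τ^r)`, with vertices indexed by the
`τ`-orbit coordinate in `ZMod r` and the quasi-length (minus one) in `ℕ`. -/
def TubeArrow {r : ℕ} : ZMod r × ℕ → ZMod r × ℕ → Prop := fun u v =>
  (v.1 = u.1 ∧ v.2 = u.2 + 1) ∨ (v.1 = u.1 + 1 ∧ u.2 = v.2 + 1)

section Tube

variable {R : Type u} [Ring R]

/-- `T` is a stable tube of rank `r`, parametrized by `φ : ℤA∞/(τ^r) → Γ_R`. -/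
def IsStableTubeVia (T : Set (ARVertex R)) (r : ℕ) (φ : ZMod r × ℕ → ARVertex R) : Prop :=
  0 < r ∧ Function.Injective φ ∧ Set.range φ = T ∧
    (∀ u v, TubeArrow u v → ARArrow (φ u) (φ v)) ∧
    (∀ u v, ARArrow (φ u) (φ v) → TubeArrow u v) ∧
    ∀ (i : ZMod r) (n : ℕ), TauRel (φ (i - 1, n)) (φ (i, n))

/-- `T` is a stable tube. -/
def IsStableTube (T : Set (ARVertex R)) : Prop := ∃ r φ, IsStableTubeVia T r φ

end Tube

section Separating

variable {R : Type u} [Ring R]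

/-- A family of vertices is generalized standard if `rad^∞` vanishes between its modules. -/
def GeneralizedStandardSet (U : Set (ARVertex R)) : Prop :=
  ∀ X Y : IndecModA R, ARVertex.mk X ∈ U → ARVertex.mk Y ∈ U →
    ∀ f : X.1.M →ₗ[R] Y.1.M, InRadInf f → f = 0

/-- `S` is (isomorphic to) a composition factor (a subquotient) of `M`. -/
def IsCompFactorMod (R : Type u) [Ring R] (S : Type u) [AddCommGroup S] [Module R S]
    (M : Type u) [AddCommGroup M] [Module R M] : Prop :=
  ∃ N' N : Submodule R M, N' ≤ N ∧
    Nonempty ((↥N ⧸ N'.comap N.subtype) ≃ₗ[R] S)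

/-- A family of vertices is sincere if every simple module is a composition factor of one
of its modules. -/
def SincereSet (U : Set (ARVertex R)) : Prop :=
  ∀ (S : Type u) [AddCommGroup S] [Module R S], IsSimpleModule R S →
    ∃ x ∈ U, ∃ X : IndecModA R, ARVertex.mk X = x ∧ IsCompFactorMod R S X.1.M

/-- All homomorphisms from modules with vertex in `U` to modules with vertex in `V` vanish. -/
def HomVanish (U V : Set (ARVertex R)) : Prop :=
  ∀ X Y : IndecModA R, ARVertex.mk X ∈ U → ARVertex.mk Y ∈ V →
    ∀ f : X.1.M →ₗ[R] Y.1.M, f = 0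

/-- Every homomorphism from a module in `U` to a module in `V` factors through the
additive closure of the modules in `W`. -/
def FactorsThrough (U W V : Set (ARVertex R)) : Prop :=
  ∀ X Y : IndecModA R, ARVertex.mk X ∈ U → ARVertex.mk Y ∈ V →
    ∀ f : X.1.M →ₗ[R] Y.1.M, ∃ (k : ℕ) (Z : Fin k → IndecModA R)
      (g : ∀ i, X.1.M →ₗ[R] (Z i).1.M) (h : ∀ i, (Z i).1.M →ₗ[R] Y.1.M),
      (∀ i, ARVertex.mk (Z i) ∈ W) ∧ f = ∑ i, (h i).comp (g i)

/-- `cs` is a separating family of components of `Γ_R`. -/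
def IsSeparatingFamily (cs : Set (Set (ARVertex R))) : Prop :=
  ∃ ps qs : Set (Set (ARVertex R)),
    (∀ C ∈ ps, IsARComponent C) ∧ (∀ C ∈ cs, IsARComponent C) ∧ (∀ C ∈ qs, IsARComponent C) ∧
    (∀ C, IsARComponent C → C ∈ ps ∨ C ∈ cs ∨ C ∈ qs) ∧
    (∀ C ∈ ps, C ∉ cs ∧ C ∉ qs) ∧ (∀ C ∈ cs, C ∉ qs) ∧
    SincereSet (⋃₀ cs) ∧ GeneralizedStandardSet (⋃₀ cs) ∧
    HomVanish (⋃₀ qs) (⋃₀ ps) ∧ HomVanish (⋃₀ qs) (⋃₀ cs) ∧ HomVanish (⋃₀ cs) (⋃₀ ps) ∧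
    FactorsThrough (⋃₀ ps) (⋃₀ cs) (⋃₀ qs)

end Separating

/-! ### Classes of algebras via their Auslander-Reiten quivers.
For a ring `B`, the category `mod B` of finitely generated right `B`-modules is
realized as the category of finite length left `Bᵐᵒᵖ`-modules. -/

/-- An algebra is of finite representation type if it has only finitely many isomorphism
classes of indecomposable finitely generated (right) modules. -/
def IsFiniteRepTypeAlg (B : Type u) [Ring B] : Prop :=
  (Set.univ : Set (ARVertex Bᵐᵒᵖ)).Finite

/-- An algebra is cycle-finite if all cycles in `ind B` are finite. -/
def IsCycleFiniteAlg (B : Type u) [Ring B] : Prop :=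
  ∀ c : ModCycle Bᵐᵒᵖ, c.IsFiniteCycle

/-- A generalized multicoil algebra: an algebra whose Auslander-Reiten quiver admits a
separating family of almost cyclic coherent components. -/
def IsGeneralizedMulticoilAlgebra (B : Type u) [Ring B] : Prop :=
  ∃ cs : Set (Set (ARVertex Bᵐᵒᵖ)),
    (∀ C ∈ cs, IsARComponent C ∧ IsAlmostCyclicComp C ∧ IsCoherentSub C) ∧
    IsSeparatingFamily cs

/-- A generalized double tilted algebra: an algebra whose Auslander-Reiten quiver admits
a separating almost acyclic component (a connecting component). -/
def IsGeneralizedDoubleTiltedAlgebra (B : Type u) [Ring B] : Prop :=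
  ∃ C : Set (ARVertex Bᵐᵒᵖ),
    IsARComponent C ∧ IsAlmostAcyclicComp C ∧ IsSeparatingFamily {C}

/-- A concealed canonical algebra: an algebra whose Auslander-Reiten quiver admits a
separating family of stable tubes. -/
def IsConcealedCanonicalAlgebra (B : Type u) [Ring B] : Prop :=
  ∃ ts : Set (Set (ARVertex Bᵐᵒᵖ)), (∀ T ∈ ts, IsStableTube T) ∧ IsSeparatingFamily ts

/-- A generic module: an indecomposable module of infinite length with finite endolength. -/
def IsGenericModule (R : Type u) [Ring R] (N : RawMod R) : Prop :=
  IsIndecMod R N.M ∧ ¬IsFiniteLength R N.M ∧ IsFiniteLength (Module.End R N.M) N.M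

/-- The endolength of a module: its length over its endomorphism ring. -/
noncomputable def endolength (R : Type u) [Ring R] (N : RawMod R) : WithBot ℕ∞ :=
  Order.krullDim (Submodule (Module.End R N.M) N.M)

/-- Generic tameness in the sense of Crawley-Boevey: for each `d` there are only finitely
many isomorphism classes of generic (right) modules of endolength `d`. -/
def IsGenericallyTameAlg (B : Type u) [Ring B] : Prop :=
  ∀ d : ℕ, ∃ (k : ℕ) (T : Fin k → RawMod Bᵐᵒᵖ),
    ∀ N : RawMod Bᵐᵒᵖ, IsGenericModule Bᵐᵒᵖ N → endolength Bᵐᵒᵖ N = (d : ℕ∞) →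
      ∃ i, Nonempty (N.M ≃ₗ[Bᵐᵒᵖ] (T i).M)

/-- A tame generalized multicoil algebra. -/
def IsTameGeneralizedMulticoilAlgebra (B : Type u) [Ring B] : Prop :=
  IsGeneralizedMulticoilAlgebra B ∧ IsGenericallyTameAlg B

/-- A tame generalized double tilted algebra. -/
def IsTameGeneralizedDoubleTiltedAlgebra (B : Type u) [Ring B] : Prop :=
  IsGeneralizedDoubleTiltedAlgebra B ∧ IsGenericallyTameAlg B

/-! ### The quiver of an algebra, convex idempotents, basic and connected algebras -/

section AlgebraSide

variable (A : Type u) [Ring A]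

/-- The Jacobson radical of `A` (as a left ideal; it is in fact two-sided). -/
def jacobsonRad : Ideal A := (⊥ : Ideal A).jacobson

/-- The square of the Jacobson radical of `A`. -/
def jacobsonRadSq : Ideal A :=
  Ideal.span {x | ∃ a ∈ jacobsonRad A, ∃ b ∈ jacobsonRad A, x = a * b}

/-- A primitive idempotent of `A`. -/
def IsPrimitiveIdempotent (e : A) : Prop :=
  IsIdempotentElem e ∧ e ≠ 0 ∧
    ∀ f g : A, IsIdempotentElem f → IsIdempotentElem g → f * g = 0 → g * f = 0 →
      e = f + g → f = 0 ∨ g = 0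

/-- A complete family of pairwise orthogonal primitive idempotents of `A`; its indices
are the vertices of the quiver `Q_A` of `A`. -/
structure CompleteIdemFamily (A : Type u) [Ring A] where
  n : ℕ
  e : Fin n → A
  prim : ∀ i, IsPrimitiveIdempotent A (e i)
  orth : ∀ i j, i ≠ j → e i * e j = 0
  total : ∑ i, e i = 1

/-- There is an arrow `i → j` in the quiver `Q_A` iff `e_i (rad A) e_j ⊄ (rad A)²`. -/
def QAarrow (E : CompleteIdemFamily A) (i j : Fin E.n) : Prop :=
  ∃ y ∈ jacobsonRad A, E.e i * y * E.e j ∉ jacobsonRadSq A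

/-- A set of vertices of `Q_A` is convex if every path of `Q_A` with source and target in
it has all its vertices in it. -/
def ConvexVertexSet (E : CompleteIdemFamily A) (S : Set (Fin E.n)) : Prop :=
  ∀ (n : ℕ) (c : ℕ → Fin E.n), (∀ k < n, QAarrow A E (c k) (c (k + 1))) →
    c 0 ∈ S → c n ∈ S → ∀ k ≤ n, c k ∈ S

/-- A convex idempotent of `A`: a sum of pairwise orthogonal primitive idempotents
corresponding to the vertices of a convex subquiver of `Q_A`. -/
def IsConvexIdempotent (e : A) : Prop :=
  ∃ (E : CompleteIdemFamily A) (S : Finset (Fin E.n)),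
    ConvexVertexSet A E ↑S ∧ e = ∑ i ∈ S, E.e i

/-- The corner `eAe` of `A` at an idempotent `e`, as a nonunital subring (it is a unital
ring with unit `e`). -/
def cornerRing (e : A) : NonUnitalSubring A where
  carrier := {x | e * x = x ∧ x * e = x}
  zero_mem' := by simp
  add_mem' := by
    rintro a b ⟨ha1, ha2⟩ ⟨hb1, hb2⟩
    constructor
    · rw [mul_add, ha1, hb1]
    · rw [add_mul, ha2, hb2]
  neg_mem' := by
    rintro a ⟨ha1, ha2⟩
    constructor
    · rw [mul_neg, ha1]
    · rw [neg_mul, ha2]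
  mul_mem' := by
    rintro a b ⟨ha1, ha2⟩ ⟨hb1, hb2⟩
    constructor
    · rw [← mul_assoc, ha1]
    · rw [mul_assoc, hb2]

/-- An (indecomposable =) connected algebra: no nontrivial central idempotents. -/
def IsConnectedAlgebra : Prop :=
  Nontrivial A ∧ ∀ e : A, IsIdempotentElem e → e ∈ Set.center A → e = 0 ∨ e = 1

/-- A basic algebra: distinct orthogonal primitive idempotents have nonisomorphic
associated indecomposable projective right modules. -/
def IsBasicAlgebra : Prop :=
  ¬∃ e f : A, IsPrimitiveIdempotent A e ∧ IsPrimitiveIdempotent A f ∧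
    e * f = 0 ∧ f * e = 0 ∧
    Nonempty ((Submodule.span Aᵐᵒᵖ {e} : Submodule Aᵐᵒᵖ A) ≃ₗ[Aᵐᵒᵖ]
      (Submodule.span Aᵐᵒᵖ {f} : Submodule Aᵐᵒᵖ A))

end AlgebraSide

/-! ### Support algebras and faithful algebras of families of vertices -/

section Support

variable (A : Type u) [Ring A]

/-- The radical of a module: the intersection of its maximal submodules. -/
def modRadical (R : Type u) [Ring R] (M : Type u) [AddCommGroup M] [Module R M] :
    Submodule R M :=
  sInf {N | IsCoatom N}

/-- The intersection `ann_A(Γ)` of the annihilators of all right `A`-modules whose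
vertices belong to `Γ`, as a two-sided ideal of `A`. -/
def annTwoSidedIdeal (Γ : Set (ARVertex Aᵐᵒᵖ)) : TwoSidedIdeal A :=
  TwoSidedIdeal.mk'
    {a | ∀ x ∈ Γ, ∀ X : IndecModA Aᵐᵒᵖ, ARVertex.mk X = x →
      ∀ m : X.1.M, MulOpposite.op a • m = 0}
    (by intro x _ X _ m; simp)
    (by
      intro a b ha hb x hx X hX m
      have : MulOpposite.op (a + b) • m = MulOpposite.op a • m + MulOpposite.op b • m := by
        rw [← add_smul]; rfl
      rw [this, ha x hx X hX m, hb x hx X hX m, add_zero])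
    (by
      intro a ha x hx X hX m
      have : MulOpposite.op (-a) • m = -(MulOpposite.op a • m) := by
        rw [← neg_smul]; rfl
      rw [this, ha x hx X hX m, neg_zero])
    (by
      intro a b hb x hx X hX m
      have : MulOpposite.op (a * b) • m = MulOpposite.op b • (MulOpposite.op a • m) := by
        rw [← mul_smul]; rfl
      rw [this, hb x hx X hX _])
    (by
      intro a b ha x hx X hX m
      have : MulOpposite.op (a * b) • m = MulOpposite.op b • (MulOpposite.op a • m) := by
        rw [← mul_smul]; rfl
      rw [this, ha x hx X hX m, smul_zero])

/-- The faithful algebra `B(Γ) = A / ann_A(Γ)` of a family `Γ` of vertices of `Γ_A`. -/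
abbrev faithfulAlg (Γ : Set (ARVertex Aᵐᵒᵖ)) : Type u :=
  (annTwoSidedIdeal A Γ).ringCon.Quotient

/-- The canonical projection `A → B(Γ)`. -/
def faithfulProj (Γ : Set (ARVertex Aᵐᵒᵖ)) : A →+* faithfulAlg A Γ :=
  RingCon.mk' (annTwoSidedIdeal A Γ).ringCon

/-- The trace ideal `t_A(Γ)`: the two-sided ideal of `A` generated by the images of all
homomorphisms of right `A`-modules from `Q` to `A`. -/
def traceIdeal (Q : Submodule Aᵐᵒᵖ A) : TwoSidedIdeal A :=
  TwoSidedIdeal.span (⋃ f : ↥Q →ₗ[Aᵐᵒᵖ] A, Set.range f)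

/-- A decomposition `A = P_Γ ⊕ Q_Γ` of `A` in `mod A` such that the simple summands of
`P_Γ / rad P_Γ` are exactly the simple composition factors of the modules in `Γ`. -/
structure GammaDecomp (A : Type u) [Ring A] (Γ : Set (ARVertex Aᵐᵒᵖ)) where
  P : Submodule Aᵐᵒᵖ A
  Q : Submodule Aᵐᵒᵖ A
  compl : IsCompl P Q
  top_factors : ∀ (S : Type u) [AddCommGroup S] [Module Aᵐᵒᵖ S], IsSimpleModule Aᵐᵒᵖ S →
    (IsCompFactorMod Aᵐᵒᵖ S (↥P ⧸ modRadical Aᵐᵒᵖ ↥P) ↔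
      ∃ x ∈ Γ, ∃ X : IndecModA Aᵐᵒᵖ, ARVertex.mk X = x ∧ IsCompFactorMod Aᵐᵒᵖ S X.1.M)

end Support

/-- Restriction of scalars along a surjective ring homomorphism `π : A → B` identifies a
vertex `y` of `Γ_B` with a vertex `x` of `Γ_A`: representatives have the same underlying
group, with the `A`-action obtained from the `B`-action through `π`. -/
def VertexRestrictsTo {A B : Type u} [Ring A] [Ring B] (π : A →+* B)
    (y : ARVertex Bᵐᵒᵖ) (x : ARVertex Aᵐᵒᵖ) : Prop :=
  ∃ (N : IndecModA Bᵐᵒᵖ) (X : IndecModA Aᵐᵒᵖ), ARVertex.mk N = y ∧ ARVertex.mk X = x ∧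
    ∃ e : X.1.M ≃+ N.1.M, ∀ (a : A) (m : X.1.M),
      e (MulOpposite.op a • m) = MulOpposite.op (π a) • e m

/-! ### `K`-module structures on Hom-groups, lengths, and Ext -/

section KLength

variable (K B : Type u) [CommRing K] [Ring B] [Algebra K B]
variable (X N : Type u) [AddCommGroup X] [Module B X] [AddCommGroup N] [Module B N]

/-- The action of `K` on `B`-linear maps, through `algebraMap K B`. -/
def homKSMul (k : K) (f : X →ₗ[B] N) : X →ₗ[B] N where
  toFun x := algebraMap K B k • f x
  map_add' x y := by show algebraMap K B k • f (x + y) = _; rw [map_add, smul_add]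
  map_smul' b x := by
    simp only [map_smul, RingHom.id_apply, smul_smul]
    rw [Algebra.commutes]

/-- The `K`-module structure on the group of `B`-linear maps. -/
def homKModule : Module K (X →ₗ[B] N) where
  smul := homKSMul K B X N
  one_smul f := LinearMap.ext fun x => by
    show algebraMap K B 1 • f x = f x
    rw [map_one, one_smul]
  mul_smul k l f := LinearMap.ext fun x => by
    show algebraMap K B (k * l) • f x = algebraMap K B k • algebraMap K B l • f x
    rw [map_mul, mul_smul]
  smul_zero k := LinearMap.ext fun x => by
    show algebraMap K B k • (0 : X →ₗ[B] N) x = 0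
    simp
  smul_add k f g := LinearMap.ext fun x => by
    show algebraMap K B k • (f + g) x = algebraMap K B k • f x + algebraMap K B k • g x
    simp [smul_add]
  add_smul k l f := LinearMap.ext fun x => by
    show algebraMap K B (k + l) • f x = algebraMap K B k • f x + algebraMap K B l • f x
    rw [map_add, add_smul]
  zero_smul f := LinearMap.ext fun x => by
    show algebraMap K B 0 • f x = 0
    rw [map_zero, zero_smul]

/-- The length `|Hom_B(X, N)|` of the group of `B`-linear maps `X → N` as a `K`-module. -/
noncomputable def homKLength : WithBot ℕ∞ :=
  letI : Module K (X →ₗ[B] N) := homKModule K B X N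
  Order.krullDim (Submodule K (X →ₗ[B] N))

/-- The canonical surjection from the free module on (the underlying set of) `X` to `X`. -/
noncomputable def freeCover : (X →₀ B) →ₗ[B] X :=
  Finsupp.linearCombination B id

/-- The length `|Ext¹_B(X, N)|` of `Ext¹` as a `K`-module, computed as the cokernel of
`Hom_B(F, N) → Hom_B(Ω X, N)` for the canonical free cover `F → X` with kernel `Ω X`. -/
noncomputable def ext1KLength : WithBot ℕ∞ :=
  letI : Module K (↥(LinearMap.ker (freeCover B X)) →ₗ[B] N) :=
    homKModule K B (↥(LinearMap.ker (freeCover B X))) N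
  let D : Submodule K (↥(LinearMap.ker (freeCover B X)) →ₗ[B] N) :=
    { carrier := {f | ∃ g : (X →₀ B) →ₗ[B] N,
        f = g.comp (LinearMap.ker (freeCover B X)).subtype}
      add_mem' := by
        rintro f₁ f₂ ⟨g₁, rfl⟩ ⟨g₂, rfl⟩
        exact ⟨g₁ + g₂, rfl⟩
      zero_mem' := ⟨0, rfl⟩
      smul_mem' := by
        rintro k f ⟨g, rfl⟩
        exact ⟨homKSMul K B _ N k g, rfl⟩ }
  Order.krullDim (Submodule K ((↥(LinearMap.ker (freeCover B X)) →ₗ[B] N) ⧸ D))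

end KLength

/-- Vanishing of `Ext¹_B(X, N)`: every short exact sequence `0 → N → E → X → 0` splits. -/
def Ext1IsZero (B : Type u) [Ring B] (X : Type u) [AddCommGroup X] [Module B X]
    (N : Type u) [AddCommGroup N] [Module B N] : Prop :=
  ∀ (E : Type u) [AddCommGroup E] [Module B E], ∀ (f : N →ₗ[B] E) (g : E →ₗ[B] X),
    Function.Injective f → Function.Surjective g → LinearMap.range f = LinearMap.ker g →
    ∃ s : X →ₗ[B] E, g.comp s = LinearMap.id

/-- The syzygy `Ω X`: the kernel of the canonical free cover of `X`. -/
noncomputable def syzygyRaw (B : Type u) [Ring B] (X : RawMod B) : RawMod B :=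
  ⟨↥(LinearMap.ker (freeCover B X.M))⟩

/-- Iterated syzygies. -/
noncomputable def syzygyIter (B : Type u) [Ring B] : ℕ → RawMod B → RawMod B
  | 0, X => X
  | n + 1, X => syzygyRaw B (syzygyIter B n X)

/-- Vanishing of `Ext^r_B(X, N)` for `r ≥ 1`, via `Ext^r(X, N) ≅ Ext¹(Ω^{r-1} X, N)`. -/
noncomputable def ExtIsZero (B : Type u) [Ring B] (X N : RawMod B) (r : ℕ) : Prop :=
  Ext1IsZero B (syzygyIter B (r - 1) X).M N.M

/-- `[X] = [M]` in the Grothendieck group `K₀`: the modules `X` and `M` have the same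
composition factors including multiplicities. -/
def SameCompFactors {B : Type u} [Ring B] (X M : ModA B) : Prop :=
  ∃ (n : ℕ) (s : Fin (n + 1) → Submodule B X.M) (t : Fin (n + 1) → Submodule B M.M)
    (σ : Equiv.Perm (Fin n)),
    s 0 = ⊥ ∧ s (Fin.last n) = ⊤ ∧ t 0 = ⊥ ∧ t (Fin.last n) = ⊤ ∧
    (∀ i : Fin n, s i.castSucc ≤ s i.succ) ∧ (∀ i : Fin n, t i.castSucc ≤ t i.succ) ∧
    ∀ i : Fin n,
      IsSimpleModule B (↥(s i.succ) ⧸ (s i.castSucc).comap (s i.succ).subtype) ∧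
      Nonempty ((↥(s i.succ) ⧸ (s i.castSucc).comap (s i.succ).subtype) ≃ₗ[B]
        (↥(t (σ i).succ) ⧸ (t (σ i).castSucc).comap (t (σ i).succ).subtype))

/-- A torsion class in `mod B`: a class of modules closed under factor modules and
extensions. -/
def IsTorsionClass (B : Type u) [Ring B] (T : Set (ModA B)) : Prop :=
  (∀ M ∈ T, ∀ (N : ModA B) (g : M.M →ₗ[B] N.M), Function.Surjective g → N ∈ T) ∧
  ∀ (X E M : ModA B) (f : X.M →ₗ[B] E.M) (g : E.M →ₗ[B] M.M),
    Function.Injective f → Function.Surjective g → LinearMap.range f = LinearMap.ker g →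
    X ∈ T → M ∈ T → E ∈ T

/-- A torsion class is functorially finite iff it is of the form `Fac(M)`. -/
def IsFunctoriallyFinite (B : Type u) [Ring B] (T : Set (ModA B)) : Prop :=
  ∃ M : ModA B,
    T = {N | ∃ (k : ℕ) (g : (Fin k → M.M) →ₗ[B] N.M), Function.Surjective g}

/-- A module `M` is `τ`-rigid if `Hom(M, τM) = 0`. -/
def IsTauRigid {B : Type u} [Ring B] (M : ModA B) : Prop :=
  ∀ N : ModA B, IsTauOf N M → ∀ f : M.M →ₗ[B] N.M, f = 0

/-- A module `M` is rigid if `Ext¹(M, M) = 0`. -/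
def IsRigid {B : Type u} [Ring B] (M : ModA B) : Prop := Ext1IsZero B M.M M.M

/-- `α(M) ≤ 2`: the middle term of any almost split sequence ending at `M` has at most
two indecomposable direct summands. -/
def AlphaLe2 {B : Type u} [Ring B] (M : ModA B) : Prop :=
  ∀ s : AlmostSplitSeq B, s.r.Iso M →
    ∀ (k : ℕ) (N : Fin k → Submodule B s.m.M),
      (∀ i, IsIndecMod B ↥(N i)) → iSupIndep N → (⨆ i, N i) = ⊤ → k ≤ 2

section
namespace CF

/-! ### Numeric lemma -/
section Numeric
variable (f : ℕ → ℕ → ℤ) (s t : ℕ)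

theorem num_g_iter (hm : ∀ i k, f i k + f (i+2) (k+1) ≤ f (i+1) k + f (i+1) (k+1)) (m j k : ℕ) :
    f (j+m+1) (k+m) - f (j+m) (k+m) ≤ f (j+1) k - f j k := by
  induction m with
  | zero => simp
  | succ m ih =>
    have := hm (j+m) (k+m)
    have e1 : j + (m+1) + 1 = j + m + 2 := by ring
    have e2 : j + (m+1) = j + m + 1 := by ring
    have e3 : k + (m+1) = k + m + 1 := by ring
    rw [e1, e2, e3]
    linarith

theorem num_g_iter_eq (hm : ∀ i k, f i k + f (i+2) (k+1) ≤ f (i+1) k + f (i+1) (k+1)) (m j k : ℕ)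
    (h0 : 0 < m)
    (h : f (j+m+1) (k+m) - f (j+m) (k+m) = f (j+1) k - f j k) :
    f j k + f (j+2) (k+1) = f (j+1) k + f (j+1) (k+1) := by
  obtain ⟨m, rfl⟩ : ∃ m', m = m' + 1 := ⟨m-1, by omega⟩
  have h1 := num_g_iter f hm m (j+1) (k+1)
  have e1 : j + 1 + m + 1 = j + (m+1) + 1 := by ring
  have e2 : j + 1 + m = j + (m+1) := by ring
  have e3 : k + 1 + m = k + (m+1) := by ring
  rw [e1, e2, e3, h] at h1
  have h2 := hm j k
  have e4 : j + 1 + 1 = j + 2 := by ring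
  rw [e4] at h1
  linarith

theorem num_tel (hp : ∀ i k, f (i+s) k = f i (k+t)) (N k : ℕ) :
    f 0 (k + t*N) - f 0 k =
      ∑ m ∈ Finset.range N, ∑ j ∈ Finset.range s, (f (j+1) (k+m*t) - f j (k+m*t)) := by
  induction N with
  | zero => simp
  | succ N ih =>
    rw [Finset.sum_range_succ, ← ih, Finset.sum_range_sub (fun j => f j (k+N*t))]
    have := hp 0 (k + N*t)
    rw [zero_add] at this
    rw [this]
    have e1 : k + t*(N+1) = k + N*t+t := by ring
    have e2 : k + t*N = k + N*t := by ring
    rw [e1, e2]; ring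

theorem num_dec (hp : ∀ i k, f (i+s) k = f i (k+t))
    (hm : ∀ i k, f i k + f (i+2) (k+1) ≤ f (i+1) k + f (i+1) (k+1)) (N : ℕ) (hN : N = s + t) (k : ℕ) :
    f 0 (k + N + t*N) - f 0 (k + N) ≤ f 0 (k + t*N) - f 0 k := by
  rw [num_tel f s t hp, num_tel f s t hp]
  refine Finset.sum_le_sum fun m _ => Finset.sum_le_sum fun j _ => ?_
  have := num_g_iter f hm s j (k+m*t)
  have h1 := hp (j+1) (k+m*t+s)
  have h2 := hp j (k+m*t+s)
  have e : j + s + 1 = j + 1 + s := by ring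
  rw [e, h1, h2] at this
  have e2 : k + N + m*t = k+m*t+s+t := by rw [hN]; ring
  rw [e2]; exact this

theorem num_eq (hp : ∀ i k, f (i+s) k = f i (k+t))
    (hm : ∀ i k, f i k + f (i+2) (k+1) ≤ f (i+1) k + f (i+1) (k+1)) (hs : 0 < s)
    (N : ℕ) (hN : N = s + t) (k : ℕ)
    (he : f 0 (k + N + t*N) - f 0 (k + N) = f 0 (k + t*N) - f 0 k) (j : ℕ) (hj : j < s) :
    f j k + f (j+2) (k+1) = f (j+1) k + f (j+1) (k+1) := by
  rw [num_tel f s t hp, num_tel f s t hp] at he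
  have key : ∀ m j, f (j+1) (k+N+m*t) - f j (k+N+m*t) ≤ f (j+1) (k+m*t) - f j (k+m*t) := by
    intro m j
    have := num_g_iter f hm s j (k+m*t)
    have h1 := hp (j+1) (k+m*t+s)
    have h2 := hp j (k+m*t+s)
    have e : j + s + 1 = j + 1 + s := by ring
    rw [e, h1, h2] at this
    have e2 : k + N + m*t = k+m*t+s+t := by rw [hN]; ring
    rw [e2]; exact this
  have h1 := (Finset.sum_eq_sum_iff_of_le (fun m _ => Finset.sum_le_sum fun j _ => key m j)).1 he 0
    (Finset.mem_range.2 (by omega))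
  have h2 := (Finset.sum_eq_sum_iff_of_le (fun j _ => key 0 j)).1 h1 j (Finset.mem_range.2 hj)
  simp only [zero_mul, add_zero] at h2
  apply num_g_iter_eq f hm s j k hs
  rw [← h2]
  have h1 := hp (j+1) (k+s)
  have h2 := hp j (k+s)
  have e : j + s + 1 = j + 1 + s := by ring
  rw [e, h1, h2]
  have e2 : k + N = k+s+t := by rw [hN]; ring
  rw [e2]

theorem num_dec_mul (hp : ∀ i k, f (i+s) k = f i (k+t))
    (hm : ∀ i k, f i k + f (i+2) (k+1) ≤ f (i+1) k + f (i+1) (k+1)) (N : ℕ) (hN : N = s + t) (k q : ℕ) :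
    f 0 (k + q*N + t*N) - f 0 (k + q*N) ≤ f 0 (k + t*N) - f 0 k := by
  induction q with
  | zero => simp
  | succ q ih =>
    have := num_dec f s t hp hm N hN (k+q*N)
    have e : k + (q+1)*N = k + q*N+N := by ring
    rw [e]; linarith

theorem num_nonneg (hp : ∀ i k, f (i+s) k = f i (k+t)) (h0 : ∀ i k, 0 ≤ f i k)
    (hm : ∀ i k, f i k + f (i+2) (k+1) ≤ f (i+1) k + f (i+1) (k+1)) (N : ℕ) (hN : N = s + t) (k : ℕ) :
    0 ≤ f 0 (k + t*N) - f 0 k := by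
  by_contra hneg
  have hstep : ∀ q : ℕ, f 0 (k + q*(t*N)) ≤ f 0 k - q := by
    intro q
    induction q with
    | zero => simp
    | succ q ih =>
      have := num_dec_mul f s t hp hm N hN k (q*t)
      have e : k + (q+1)*(t*N) = k + q*t*N + t*N := by ring
      have e2 : k + q*(t*N) = k + q*t*N := by ring
      rw [e2] at ih
      rw [e]; push_cast; linarith
  have := hstep ((f 0 k).toNat + 1)
  have h1 := h0 0 (k + ((f 0 k).toNat + 1)*(t*N))
  have h2 := Int.toNat_of_nonneg (h0 0 k)
  push_cast at this
  linarith

theorem num_stab (hp : ∀ i k, f (i+s) k = f i (k+t)) (h0 : ∀ i k, 0 ≤ f i k)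
    (hm : ∀ i k, f i k + f (i+2) (k+1) ≤ f (i+1) k + f (i+1) (k+1)) (hs : 0 < s) :
    ∃ k0, ∀ k, k0 ≤ k → ∀ i, f i k + f (i+2) (k+1) = f (i+1) k + f (i+1) (k+1) := by
  obtain ⟨N, hN⟩ : ∃ N, N = s + t := ⟨_, rfl⟩
  have hNpos : 0 < N := by omega
  -- for every residue stabilisation
  have hr : ∀ r, ∃ q0, ∀ q, q0 ≤ q →
      f 0 (r + q*N + N + t*N) - f 0 (r + q*N + N) = f 0 (r + q*N + t*N) - f 0 (r + q*N) := by
    intro r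
    let a : ℕ → ℕ := fun q => (f 0 (r + q*N + t*N) - f 0 (r + q*N)).toNat
    have ha : Antitone a := by
      apply antitone_nat_of_succ_le
      intro q
      have := num_dec f s t hp hm N hN (r+q*N)
      have e : r + (q+1)*N = r + q*N+N := by ring
      simp only [a]
      rw [e]; exact Int.toNat_le_toNat this
    obtain ⟨q0, hq0⟩ : ∃ q0, ∀ q, q0 ≤ q → a q0 = a q := by
      have hne : (Set.range a).Nonempty := ⟨_, 0, rfl⟩
      obtain ⟨q0, hq0⟩ := Nat.sInf_mem hne
      refine ⟨q0, fun q hq => le_antisymm ?_ (ha hq)⟩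
      rw [hq0]; exact Nat.sInf_le ⟨q, rfl⟩
    refine ⟨q0, fun q hq => ?_⟩
    have h1 := hq0 q hq
    have h2 := hq0 (q+1) (by omega)
    have h3 : a q = a (q+1) := h1.symm.trans h2
    simp only [a] at h3
    have e : r + (q+1)*N = r + q*N+N := by ring
    rw [e] at h3
    have n1 := num_nonneg f s t hp h0 hm N hN (r+q*N)
    have n2 := num_nonneg f s t hp h0 hm N hN (r+q*N+N)
    omega
  choose q0 hq0 using hr
  refine ⟨(Finset.range N).sup (fun r => (q0 r + 1) * N), fun k hk => ?_⟩
  have hbase : ∀ k, (Finset.range N).sup (fun r => (q0 r + 1) * N) ≤ k → ∀ j, j < s →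
      f j k + f (j+2) (k+1) = f (j+1) k + f (j+1) (k+1) := by
    intro k hk j hj
    apply num_eq f s t hp hm hs N hN k _ j hj
    have hmod := Nat.mod_lt k hNpos
    have h1 : (q0 (k % N) + 1) * N ≤ k := le_trans (Finset.le_sup (f := fun r => (q0 r + 1) * N)
      (Finset.mem_range.2 hmod)) hk
    have h2 : q0 (k % N) ≤ k / N := by
      have := (Nat.le_div_iff_mul_le hNpos).2 h1
      omega
    have h3 := hq0 (k % N) (k / N) h2
    have e : k % N + k / N * N = k := by rw [mul_comm]; exact Nat.mod_add_div k N
    rw [e] at h3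
    exact h3
  have hgen : ∀ q j k, f (j + q * s) k = f j (k + q*t) := by
    intro q
    induction q with
    | zero => simp
    | succ q ih =>
      intro j k
      have e : j + (q+1)*s = j + q*s+s := by ring
      rw [e, hp, ih]
      congr 1; ring
  intro i
  have hmod := Nat.mod_lt i hs
  have e : i % s + i / s * s = i := by rw [mul_comm]; exact Nat.mod_add_div i s
  have := hbase (k + (i/s)*t) (by omega) (i % s) hmod
  rw [← hgen, show k + i/s*t + 1 = (k+1) + i/s*t by ring, ← hgen, ← hgen, ← hgen] at this
  rw [show i % s + 2 + i/s*s = i + 2 by omega, show i % s + 1 + i/s*s = i + 1 by omega, e] at this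
  exact this

/-- two-sided version: if arbitrarily far backwards extensions exist then equality everywhere -/
theorem num_two_sided (hp : ∀ i k, f (i+s) k = f i (k+t)) (h0 : ∀ i k, 0 ≤ f i k)
    (hm : ∀ i k, f i k + f (i+2) (k+1) ≤ f (i+1) k + f (i+1) (k+1)) (hs : 0 < s)
    (hext : ∀ m, ∃ f' : ℕ → ℕ → ℤ, (∀ i k, f' (i+s) k = f' i (k+t)) ∧ (∀ i k, 0 ≤ f' i k) ∧
      (∀ i k, f' i k + f' (i+2) (k+1) ≤ f' (i+1) k + f' (i+1) (k+1)) ∧ ∀ i k, f' i (k+m) = f i k)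
    (k i : ℕ) :
    f i k + f (i+2) (k+1) = f (i+1) k + f (i+1) (k+1) := by
  obtain ⟨N, hN⟩ : ∃ N, N = s + t := ⟨_, rfl⟩
  have hH : ∀ k, f 0 (k + t*N) - f 0 k = 0 := by
    intro k
    have hge := num_nonneg f s t hp h0 hm N hN k
    by_contra hne
    have hpos : 1 ≤ f 0 (k + t*N) - f 0 k := by omega
    set j := (f 0 k).toNat + 1 with hj
    obtain ⟨f', hp', h0', hm', he'⟩ := hext (j * (t*N))
    -- claim: f' 0 (k + q*(t*N)) ≥ q for q ≤ j
    have hst : ∀ q ≤ j, (q:ℤ) ≤ f' 0 (k + q*(t*N)) := by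
      intro q
      induction q with
      | zero => intro _; simpa using h0' 0 _
      | succ q ih =>
        intro hq
        have h1 := ih (by omega)
        have h2 := num_dec_mul f' s t hp' hm' N hN (k + q*(t*N)) ((j-q)*t)
        have e : k + q*(t*N) + (j-q)*t*N = k + j*(t*N) := by
          have : j = q + (j - q) := by omega
          conv_rhs => rw [this]
          ring
        rw [e, he', show k + j*(t*N) + t*N = k + t*N + j*(t*N) by ring, he'] at h2
        rw [show k + (q+1)*(t*N) = k + q*(t*N) + t*N by ring]
        push_cast; linarith
    have h3 := hst j le_rfl
    rw [he', hj] at h3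
    have h2 := Int.toNat_of_nonneg (h0 0 k)
    push_cast at h3
    linarith
  have hbase : ∀ k j, j < s →
      f j k + f (j+2) (k+1) = f (j+1) k + f (j+1) (k+1) := by
    intro k j hj
    apply num_eq f s t hp hm hs N hN k _ j hj
    rw [hH, hH]
  have hgen : ∀ q j k, f (j + q * s) k = f j (k + q*t) := by
    intro q
    induction q with
    | zero => simp
    | succ q ih =>
      intro j k
      have e : j + (q+1)*s = j + q*s+s := by ring
      rw [e, hp, ih]
      congr 1; ring
  have hmod := Nat.mod_lt i hs
  have e : i % s + i / s * s = i := by rw [mul_comm]; exact Nat.mod_add_div i s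
  have := hbase (k + (i/s)*t) (i % s) hmod
  rw [← hgen, show k + i/s*t + 1 = (k+1) + i/s*t by ring, ← hgen, ← hgen, ← hgen] at this
  rw [show i % s + 2 + i/s*s = i + 2 by omega, show i % s + 1 + i/s*s = i + 1 by omega, e] at this
  exact this

end Numeric
end CF
end

section
namespace CF

/-- combinatorial data of a (finite-boundary) translation quiver with meshes -/
structure TQ (V : Type*) where
  L : Set V
  R : Set V
  hL : L.Finite
  hR : R.Finite
  t : V → V
  s : V → V
  t_mem : ∀ x, x ∉ L → t x ∉ R
  s_t : ∀ x, x ∉ L → s (t x) = x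
  s_mem : ∀ x, x ∉ R → s x ∉ L
  t_s : ∀ x, x ∉ R → t (s x) = x
  mesh : V → Multiset V
  arr : V → V → Prop
  len : V → ℕ
  len_pos : ∀ x, 0 < len x
  arr_mesh : ∀ x, x ∉ L → ∀ e, arr e x ↔ e ∈ mesh x
  arr_mesh' : ∀ x, x ∉ L → ∀ e, arr (t x) e ↔ e ∈ mesh x
  len_mesh : ∀ x, x ∉ L → len x + len (t x) = ((mesh x).map len).sum
  pred_fin : ∀ x, {e | arr e x}.Finite
  succ_fin : ∀ x, {e | arr x e}.Finite
  conn : ∀ x y, Relation.TransGen arr x y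

namespace TQ
variable {V : Type*} (Q : TQ V)

/-- the opposite data -/
def op : TQ V where
  L := Q.R
  R := Q.L
  hL := Q.hR
  hR := Q.hL
  t := Q.s
  s := Q.t
  t_mem := Q.s_mem
  s_t := Q.t_s
  s_mem := Q.t_mem
  t_s := Q.s_t
  mesh x := Q.mesh (Q.s x)
  arr x y := Q.arr y x
  len := Q.len
  len_pos := Q.len_pos
  arr_mesh x hx e := by
    have := Q.arr_mesh' (Q.s x) (Q.s_mem x hx) e
    rwa [Q.t_s x hx] at this
  arr_mesh' x hx e := Q.arr_mesh (Q.s x) (Q.s_mem x hx) e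
  len_mesh x hx := by
    have := Q.len_mesh (Q.s x) (Q.s_mem x hx)
    rw [Q.t_s x hx] at this
    rw [← this]; ring
  pred_fin := Q.succ_fin
  succ_fin := Q.pred_fin
  conn x y := by
    have := (Relation.transGen_swap (r := Q.arr) (a := x) (b := y)).2 (Q.conn y x)
    exact this

def bad (x : V) : Prop := x ∉ Q.L ∧ 3 ≤ (Q.mesh x).card

def Sl : Set V := {x | ∀ k, Q.t^[k] x ∉ Q.L}

variable {Q}

theorem sl_not_mem {x : V} (h : x ∈ Q.Sl) : x ∉ Q.L := h 0

theorem sl_iter {x : V} (h : x ∈ Q.Sl) (k : ℕ) : Q.t^[k] x ∈ Q.Sl := by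
  intro j; rw [← Function.iterate_add_apply]; exact h _

theorem sl_t {x : V} (h : x ∈ Q.Sl) : Q.t x ∈ Q.Sl := sl_iter h 1

theorem sl_of_t {x : V} (h0 : x ∉ Q.L) (h : Q.t x ∈ Q.Sl) : x ∈ Q.Sl := by
  intro k
  cases k with
  | zero => exact h0
  | succ k => exact h k

theorem t_inj {x y : V} (hx : x ∉ Q.L) (hy : y ∉ Q.L) (h : Q.t x = Q.t y) : x = y := by
  rw [← Q.s_t x hx, h, Q.s_t y hy]

theorem iter_inj {x y : V} (hx : x ∈ Q.Sl) (hy : y ∈ Q.Sl) (k : ℕ) (h : Q.t^[k] x = Q.t^[k] y) :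
    x = y := by
  induction k with
  | zero => exact h
  | succ k ih =>
    rw [Function.iterate_succ_apply', Function.iterate_succ_apply'] at h
    exact ih (t_inj (hx k) (hy k) h)

theorem s_iter_t_iter {x : V} (hx : x ∈ Q.Sl) (k : ℕ) : Q.s^[k] (Q.t^[k] x) = x := by
  induction k with
  | zero => rfl
  | succ k ih =>
    rw [Function.iterate_succ_apply, Function.iterate_succ_apply', Q.s_t _ (hx k), ih]

theorem arr_t {x y : V} (hy : y ∉ Q.L) (h : Q.arr x y) : Q.arr (Q.t y) x :=
  (Q.arr_mesh' y hy x).2 ((Q.arr_mesh y hy x).1 h)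

theorem arr_of_t {x y : V} (hy : y ∉ Q.L) (h : Q.arr (Q.t y) x) : Q.arr x y :=
  (Q.arr_mesh y hy x).2 ((Q.arr_mesh' y hy x).1 h)

theorem arr_tt {x y : V} (hx : x ∉ Q.L) (hy : y ∉ Q.L) (h : Q.arr x y) : Q.arr (Q.t x) (Q.t y) :=
  arr_t hx (arr_t hy h)

theorem arr_iter {x y : V} (hx : x ∈ Q.Sl) (hy : y ∈ Q.Sl) (h : Q.arr x y) (k : ℕ) :
    Q.arr (Q.t^[k] x) (Q.t^[k] y) := by
  induction k with
  | zero => exact h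
  | succ k ih =>
    rw [Function.iterate_succ_apply', Function.iterate_succ_apply']
    exact arr_tt (hx k) (hy k) ih

theorem two_le {α : Type*} {a b : α} {m : Multiset α} (hab : a ≠ b) (ha : a ∈ m) (hb : b ∈ m) :
    ({a, b} : Multiset α) ≤ m := by
  rw [Multiset.le_iff_subset]
  · intro x hx
    simp only [Multiset.insert_eq_cons, Multiset.mem_cons, Multiset.mem_singleton] at hx
    rcases hx with rfl | rfl <;> assumption
  · simpa using hab

theorem sum_map_eq_imp {α : Type*} {l : α → ℕ} (hl : ∀ x, 0 < l x) {m n : Multiset α} (h : n ≤ m)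
    (he : (n.map l).sum = (m.map l).sum) : n = m := by
  obtain ⟨u, rfl⟩ := Multiset.le_iff_exists_add.1 h
  rw [Multiset.map_add, Multiset.sum_add] at he
  have : (u.map l).sum = 0 := by omega
  rw [Multiset.sum_eq_zero_iff] at this
  have hu : u = 0 := by
    by_contra hne
    obtain ⟨a, ha⟩ := Multiset.exists_mem_of_ne_zero hne
    have := this (l a) (Multiset.mem_map_of_mem l ha)
    have := hl a
    omega
  simp [hu]

theorem len_le_of_le {α : Type*} (l : α → ℕ) {m n : Multiset α} (h : n ≤ m) :
    (n.map l).sum ≤ (m.map l).sum := by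
  obtain ⟨u, rfl⟩ := Multiset.le_iff_exists_add.1 h
  rw [Multiset.map_add, Multiset.sum_add]; omega

/-- sectional infinite path, quasi-periodic -/
structure Sect (Q : TQ V) (Y : ℕ → V) (s t : ℕ) : Prop where
  mem : ∀ i, Y i ∈ Q.Sl
  arr : ∀ i, Q.arr (Y i) (Y (i+1))
  per : ∀ i, Y (i+s) = Q.t^[t] (Y i)
  spos : 0 < s
  sec : ∀ i, Y i ≠ Q.t (Y (i+2))

namespace Sect
variable {Y : ℕ → V} {s t : ℕ}

theorem pair_le (h : Sect Q Y s t) (i k : ℕ) :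
    ({Q.t^[k] (Y i), Q.t^[k+1] (Y (i+2))} : Multiset V) ≤ Q.mesh (Q.t^[k] (Y (i+1))) := by
  have hx : Q.t^[k] (Y (i+1)) ∉ Q.L := h.mem (i+1) k
  apply two_le
  · rw [Function.iterate_succ_apply]
    intro he
    exact h.sec i (iter_inj (h.mem i) (sl_t (h.mem (i+2))) k he)
  · exact (Q.arr_mesh _ hx _).1 (arr_iter (h.mem i) (h.mem _) (h.arr i) k)
  · refine (Q.arr_mesh _ hx _).1 ?_
    rw [Function.iterate_succ_apply']
    exact arr_t (h.mem (i+2) k) (arr_iter (h.mem _) (h.mem _) (h.arr (i+1)) k)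

theorem num_hm (h : Sect Q Y s t) (i k : ℕ) :
    (Q.len (Q.t^[k] (Y i)) : ℤ) + Q.len (Q.t^[k+1] (Y (i+2))) ≤
      Q.len (Q.t^[k] (Y (i+1))) + Q.len (Q.t^[k+1] (Y (i+1))) := by
  have h1 := len_le_of_le Q.len (h.pair_le i k)
  rw [← Q.len_mesh _ (h.mem (i+1) k), ← Function.iterate_succ_apply' Q.t] at h1
  simp only [Multiset.insert_eq_cons, Multiset.map_cons, Multiset.map_singleton, Multiset.sum_cons,
    Multiset.sum_singleton] at h1
  exact_mod_cast h1

theorem num_hp (h : Sect Q Y s t) (i k : ℕ) :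
    (Q.len (Q.t^[k] (Y (i+s))) : ℤ) = Q.len (Q.t^[k+t] (Y i)) := by
  rw [h.per, ← Function.iterate_add_apply]

theorem mesh_eq (h : Sect Q Y s t) (i k : ℕ)
    (he : (Q.len (Q.t^[k] (Y i)) : ℤ) + Q.len (Q.t^[k+1] (Y (i+2))) =
      Q.len (Q.t^[k] (Y (i+1))) + Q.len (Q.t^[k+1] (Y (i+1)))) :
    Q.mesh (Q.t^[k] (Y (i+1))) = {Q.t^[k] (Y i), Q.t^[k+1] (Y (i+2))} := by
  symm
  apply sum_map_eq_imp Q.len_pos (h.pair_le i k)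
  rw [← Q.len_mesh _ (h.mem (i+1) k), ← Function.iterate_succ_apply' Q.t]
  simp only [Multiset.insert_eq_cons, Multiset.map_cons, Multiset.map_singleton, Multiset.sum_cons,
    Multiset.sum_singleton]
  exact_mod_cast he

theorem stab (h : Sect Q Y s t) : ∃ k0, ∀ k, k0 ≤ k → ∀ i,
    Q.mesh (Q.t^[k] (Y (i+1))) = {Q.t^[k] (Y i), Q.t^[k+1] (Y (i+2))} := by
  obtain ⟨k0, hk0⟩ := num_stab (fun i k => (Q.len (Q.t^[k] (Y i)) : ℤ)) s t h.num_hp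
    (fun _ _ => by positivity) h.num_hm h.spos
  exact ⟨k0, fun k hk i => h.mesh_eq i k (hk0 k hk i)⟩

theorem shift_s (hLR : Q.L = ∅) (hRR : Q.R = ∅) (h : Sect Q Y s t) (m : ℕ) :
    Sect Q (fun i => Q.s^[m] (Y i)) s t := by
  have hL : ∀ x, x ∉ Q.L := by simp [hLR]
  have hR : ∀ x, x ∉ Q.R := by simp [hRR]
  have hcom : ∀ x, Q.t (Q.s x) = Q.s (Q.t x) := fun x => by rw [Q.t_s x (hR x), Q.s_t x (hL x)]
  have hcomm : Function.Commute Q.t Q.s := hcom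
  have hts : ∀ x, Q.t^[m] (Q.s^[m] x) = x := by
    intro x
    exact (Function.RightInverse.iterate (f := Q.t) (g := Q.s) (fun x => Q.t_s x (hR x)) m) x
  refine ⟨fun i k => hL _, fun i => ?_, fun i => ?_, h.spos, fun i he => ?_⟩
  · clear hts
    induction m with
    | zero => exact h.arr i
    | succ m ih =>
      simp only [Function.iterate_succ_apply']
      have h1 := arr_of_t (Q := Q) (hL (Q.s (Q.s^[m] (Y i)))) (x := (Q.s^[m] (Y (i+1))))
        (by rw [Q.t_s _ (hR _)]; exact ih)
      exact arr_of_t (hL _) (by rw [Q.t_s _ (hR _)]; exact h1)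
  · simp only [h.per]
    exact ((hcomm.iterate_iterate t m) (Y i)).symm
  · have h2 := congrArg (Q.t^[m]) he
    rw [hts, (hcomm.iterate_right m) (Y (i+2)), hts] at h2
    exact h.sec i h2

theorem stab_two (hLR : Q.L = ∅) (hRR : Q.R = ∅) (h : Sect Q Y s t) (k i : ℕ) :
    Q.mesh (Q.t^[k] (Y (i+1))) = {Q.t^[k] (Y i), Q.t^[k+1] (Y (i+2))} := by
  apply h.mesh_eq
  refine num_two_sided (fun i k => (Q.len (Q.t^[k] (Y i)) : ℤ)) s t h.num_hp
    (fun _ _ => by positivity) h.num_hm h.spos (fun m => ?_) k i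
  have h' := h.shift_s hLR hRR m
  refine ⟨fun i k => Q.len (Q.t^[k] (Q.s^[m] (Y i))), h'.num_hp, fun _ _ => by positivity, h'.num_hm, fun i k => ?_⟩
  have hts : Q.t^[m] (Q.s^[m] (Y i)) = Y i :=
    (Function.RightInverse.iterate (f := Q.t) (g := Q.s) (fun x => Q.t_s x (by simp [hRR])) m) (Y i)
  simp only [Function.iterate_add_apply, hts]

end Sect
end TQ
end CF
end

section
namespace CF
namespace TQ
variable {V : Type*} {Q : TQ V}

variable (Q) in
/-- paths of length `n` inside the left stable part -/
def Pt : ℕ → V → V → Prop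
  | 0, x, y => x = y ∧ x ∈ Q.Sl
  | n+1, x, y => x ∈ Q.Sl ∧ ∃ z, Q.arr x z ∧ Pt n z y

theorem Pt.left {n : ℕ} {x y : V} (h : Q.Pt n x y) : x ∈ Q.Sl := by
  cases n with
  | zero => exact h.2
  | succ n => exact h.1

theorem Pt.right {n : ℕ} {x y : V} (h : Q.Pt n x y) : y ∈ Q.Sl := by
  induction n generalizing x with
  | zero => exact h.1 ▸ h.2
  | succ n ih => obtain ⟨_, z, _, h2⟩ := h; exact ih h2

theorem Pt.snoc {n : ℕ} {x y z : V} (h : Q.Pt n x y) (ha : Q.arr y z) (hz : z ∈ Q.Sl) :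
    Q.Pt (n+1) x z := by
  induction n generalizing x with
  | zero =>
    obtain ⟨rfl, h1⟩ := h
    exact ⟨h1, z, ha, rfl, hz⟩
  | succ n ih => obtain ⟨h1, w, h3, h2⟩ := h; exact ⟨h1, w, h3, ih h2⟩

theorem Pt.trans {n m : ℕ} {x y z : V} (h : Q.Pt n x y) (h' : Q.Pt m y z) : Q.Pt (n+m) x z := by
  induction n generalizing x with
  | zero =>
    obtain ⟨rfl, h1⟩ := h
    simpa using h'
  | succ n ih =>
    obtain ⟨h1, w, h3, h2⟩ := h
    rw [show n + 1 + m = (n+m)+1 by ring]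
    exact ⟨h1, w, h3, ih h2⟩

theorem Pt.iter {n : ℕ} {x y : V} (h : Q.Pt n x y) (k : ℕ) : Q.Pt n (Q.t^[k] x) (Q.t^[k] y) := by
  induction n generalizing x with
  | zero =>
    obtain ⟨rfl, h1⟩ := h
    exact ⟨rfl, sl_iter h1 k⟩
  | succ n ih =>
    obtain ⟨h1, w, h3, h2⟩ := h
    exact ⟨sl_iter h1 k, _, arr_iter h1 h2.left h3 k, ih h2⟩

theorem Pt.rev {n : ℕ} {x y : V} (h : Q.Pt n x y) : Q.Pt n (Q.t^[n] y) x := by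
  induction n generalizing x with
  | zero =>
    obtain ⟨rfl, h1⟩ := h
    exact ⟨rfl, h1⟩
  | succ n ih =>
    obtain ⟨h1, w, h3, h2⟩ := h
    have h4 := (ih h2).iter 1
    rw [← Function.iterate_add_apply, show 1 + n = n + 1 by ring] at h4
    exact h4.snoc (arr_t (sl_not_mem h2.left) h3) h1

theorem Pt.fn {n : ℕ} {x y : V} (h : Q.Pt n x y) : ∃ p : ℕ → V, p 0 = x ∧ p n = y ∧
    (∀ i, i ≤ n → p i ∈ Q.Sl) ∧ ∀ i, i < n → Q.arr (p i) (p (i+1)) := by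
  induction n generalizing x with
  | zero =>
    obtain ⟨rfl, h1⟩ := h
    exact ⟨fun _ => x, rfl, rfl, fun _ _ => h1, fun i hi => by omega⟩
  | succ n ih =>
    obtain ⟨h1, w, h3, h2⟩ := h
    obtain ⟨p, p0, pn, hp, hp'⟩ := ih h2
    refine ⟨fun i => if i = 0 then x else p (i-1), by simp, by simp [pn], ?_, ?_⟩
    · intro i hi
      by_cases h0 : i = 0
      · simp [h0, h1]
      · simp only [h0, if_false]; exact hp _ (by omega)
    · intro i hi
      by_cases h0 : i = 0
      · subst h0; simp [p0, h3]
      · simp only [h0, if_false, Nat.add_eq_zero_iff, one_ne_zero, and_false, Nat.add_sub_cancel]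
        have := hp' (i-1) (by omega)
        rwa [show i - 1 + 1 = i by omega] at this

variable (Q) in
def Conn : V → V → Prop :=
  Relation.EqvGen (fun x y => x ∈ Q.Sl ∧ y ∈ Q.Sl ∧ (Q.arr x y ∨ y = Q.t x))

theorem Conn.arr {x y : V} (hx : x ∈ Q.Sl) (hy : y ∈ Q.Sl) (h : Q.arr x y) : Q.Conn x y :=
  Relation.EqvGen.rel _ _ ⟨hx, hy, Or.inl h⟩

theorem Conn.iter {x : V} (hx : x ∈ Q.Sl) (k : ℕ) : Q.Conn x (Q.t^[k] x) := by
  induction k with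
  | zero => exact Relation.EqvGen.refl _
  | succ k ih =>
    refine ih.trans _ _ _ (Relation.EqvGen.rel _ _ ⟨sl_iter hx k, sl_iter hx (k+1), Or.inr ?_⟩)
    rw [Function.iterate_succ_apply']

theorem Pt.conn {n : ℕ} {x y : V} (h : Q.Pt n x y) : Q.Conn x y := by
  induction n generalizing x with
  | zero => obtain ⟨rfl, h1⟩ := h; exact Relation.EqvGen.refl _
  | succ n ih =>
    obtain ⟨h1, w, h3, h2⟩ := h
    exact (Conn.arr h1 h2.left h3).trans _ _ _ (ih h2)

/-- a class of vertices closed under neighbours and translation is closed under `Conn` -/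
theorem Conn.closed {P : V → Prop}
    (h1 : ∀ x y, x ∈ Q.Sl → y ∈ Q.Sl → Q.arr x y → (P x ↔ P y))
    (h2 : ∀ x, x ∈ Q.Sl → (P x ↔ P (Q.t x))) {x y : V} (h : Q.Conn x y) : P x ↔ P y := by
  induction h with
  | rel x y h =>
    obtain ⟨hx, hy, h | h⟩ := h
    · exact h1 x y hx hy h
    · rw [h]; exact h2 x hx
  | refl => exact Iff.rfl
  | symm _ _ _ ih => exact ih.symm
  | trans _ _ _ _ _ i1 i2 => exact i1.trans i2

variable (Q) in
def Per (x : V) : Prop := x ∈ Q.Sl ∧ ∃ P, 0 < P ∧ Q.t^[P] x = x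

theorem iter_mul_fix {x : V} {P : ℕ} (h : Q.t^[P] x = x) (m : ℕ) : Q.t^[m*P] x = x := by
  rw [mul_comm, Function.iterate_mul]
  exact Function.iterate_fixed h m

theorem per_of_finite {e : V} (he : e ∈ Q.Sl) {P : ℕ} (hP : 0 < P) {S : Set V} (hS : S.Finite)
    (h : ∀ k, Q.t^[k*P] e ∈ S) : Q.Per e := by
  refine ⟨he, ?_⟩
  have : ¬ Function.Injective (fun k : ℕ => (⟨Q.t^[k*P] e, h k⟩ : S)) := by
    intro hinj
    have := hS.to_subtype
    exact not_injective_infinite_finite _ hinj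
  simp only [Function.Injective, not_forall] at this
  obtain ⟨a, b, hab, hne⟩ := this
  have hab : Q.t^[a*P] e = Q.t^[b*P] e := by simpa using hab
  have key : ∀ a b : ℕ, a < b → Q.t^[a*P] e = Q.t^[b*P] e → ∃ P, 0 < P ∧ Q.t^[P] e = e := by
    intro a b hlt hab
    refine ⟨(b-a)*P, Nat.mul_pos (by omega) hP, ?_⟩
    apply iter_inj (sl_iter he _) he (a*P)
    rw [← Function.iterate_add_apply, ← add_mul, show a + (b - a) = b by omega, hab]
  rcases lt_or_gt_of_ne hne with h | h
  · exact key a b h hab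
  · exact key b a h hab.symm

theorem per_arr_iff {x y : V} (hx : x ∈ Q.Sl) (hy : y ∈ Q.Sl) (h : Q.arr x y) : Q.Per x ↔ Q.Per y := by
  constructor
  · rintro ⟨_, P, hP, he⟩
    refine per_of_finite hy hP (Q.succ_fin x) (fun k => ?_)
    have := arr_iter hx hy h (k*P)
    rwa [iter_mul_fix he] at this
  · rintro ⟨_, P, hP, he⟩
    refine per_of_finite hx hP (Q.pred_fin y) (fun k => ?_)
    have := arr_iter hx hy h (k*P)
    rwa [iter_mul_fix he] at this

theorem per_t_iff {x : V} (hx : x ∈ Q.Sl) : Q.Per x ↔ Q.Per (Q.t x) := by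
  constructor
  · rintro ⟨_, P, hP, he⟩
    refine ⟨sl_t hx, P, hP, ?_⟩
    rw [← Function.iterate_succ_apply, Function.iterate_succ_apply', he]
  · rintro ⟨_, P, hP, he⟩
    refine ⟨hx, P, hP, ?_⟩
    rw [← Function.iterate_succ_apply, Function.iterate_succ_apply'] at he
    exact t_inj (hx P) (hx 0) he

theorem per_iter_iff {x : V} (hx : x ∈ Q.Sl) (k : ℕ) : Q.Per x ↔ Q.Per (Q.t^[k] x) := by
  induction k with
  | zero => exact Iff.rfl
  | succ k ih => rw [ih, Function.iterate_succ_apply', per_t_iff (sl_iter hx k)]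

theorem per_conn_iff {x y : V} (h : Q.Conn x y) : Q.Per x ↔ Q.Per y :=
  Conn.closed (fun _ _ hx hy h => per_arr_iff hx hy h) (fun _ hx => per_t_iff hx) h

/-- reduction of a quasi-cyclic path to a sectional one or a periodic vertex -/
theorem reduction (s : ℕ) : ∀ (t : ℕ) (p : ℕ → V), (∀ i, i ≤ s → p i ∈ Q.Sl) →
    (∀ i, i < s → Q.arr (p i) (p (i+1))) → p s = Q.t^[t] (p 0) → 0 < s + t →
    ∃ y, Q.Conn (p 0) y ∧ (Q.Per y ∨ ∃ Y s' t', Q.Sect Y s' t' ∧ Y 0 = y) := by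
  induction s using Nat.strong_induction_on with
  | _ s ih =>
  intro t p hp ha he hst
  by_cases hs0 : s = 0
  · subst hs0
    exact ⟨p 0, Relation.EqvGen.refl _, Or.inl ⟨hp 0 le_rfl, t, by omega, he.symm⟩⟩
  have hs : 0 < s := by omega
  let Y : ℕ → V := fun n => Q.t^[t*(n/s)] (p (n%s))
  have hYmem : ∀ i, Y i ∈ Q.Sl := fun i => sl_iter (hp _ (Nat.mod_lt i hs).le) _
  have hYarr : ∀ i, Q.arr (Y i) (Y (i+1)) := by
    intro i
    have hm := Nat.mod_lt i hs
    have h1 : Q.arr (Q.t^[t*(i/s)] (p (i%s))) (Q.t^[t*(i/s)] (p (i%s+1))) :=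
      arr_iter (hp _ hm.le) (hp _ hm) (ha _ hm) (t*(i/s))
    by_cases hlt : i % s + 1 < s
    · have e1 : (i+1) % s = i % s + 1 := by
        rw [Nat.add_mod, Nat.mod_eq_of_lt (show 1 < s by omega), Nat.mod_eq_of_lt hlt]
      have e2 : (i+1)/s = i/s := by
        rw [Nat.add_div hs, Nat.div_eq_of_lt (show 1 < s by omega), Nat.mod_eq_of_lt (show 1 < s by omega)]
        simp [hlt]
      simp only [Y, e1, e2]; exact h1
    · have e0 : i % s + 1 = s := by omega
      have hdvd : i + 1 = s * (i/s + 1) := by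
        have := Nat.mod_add_div i s
        rw [mul_add]; omega
      have e1 : (i+1) % s = 0 := by rw [hdvd]; simp
      have e2 : (i+1)/s = i/s + 1 := by rw [hdvd]; simp [hs]
      simp only [Y, e1, e2]
      rw [e0, he, ← Function.iterate_add_apply] at h1
      rw [mul_add, mul_one]; exact h1
  have hYper : ∀ i, Y (i+s) = Q.t^[t] (Y i) := by
    intro i
    simp only [Y, Nat.add_mod_right, Nat.add_div_right _ hs]
    rw [← Function.iterate_add_apply]
    congr 1
    ring_nf
  have hY0 : Y 0 = p 0 := by simp [Y]
  have hYconn : ∀ i, Q.Conn (Y 0) (Y i) := by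
    intro i
    induction i with
    | zero => exact Relation.EqvGen.refl _
    | succ i ih => exact ih.trans _ _ _ (Conn.arr (hYmem i) (hYmem _) (hYarr i))
  by_cases hsec : ∀ i, Y i ≠ Q.t (Y (i+2))
  · exact ⟨p 0, Relation.EqvGen.refl _, Or.inr ⟨Y, s, t, ⟨hYmem, hYarr, hYper, hs, hsec⟩, hY0⟩⟩
  · push Not at hsec
    obtain ⟨i, hi⟩ := hsec
    by_cases hs1 : s = 1
    · subst hs1
      refine ⟨Y i, hY0 ▸ hYconn i, Or.inl ⟨hYmem i, 2*t+1, by omega, ?_⟩⟩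
      have h2 : Y (i+2) = Q.t^[2*t] (Y i) := by
        rw [show i + 2 = i + 1 + 1 by ring, hYper, hYper, ← Function.iterate_add_apply, two_mul]
      rw [h2, ← Function.iterate_succ_apply' Q.t] at hi
      exact hi.symm
    · obtain ⟨y, h1, h2⟩ := ih (s-2) (by omega) (t+1) (fun j => Y (i+2+j)) (fun j _ => hYmem _)
        (fun j _ => hYarr _) (by
          simp only [add_zero]
          rw [show i + 2 + (s-2) = i + s by omega, hYper, hi, Function.iterate_succ_apply]) (by omega)
      simp only [add_zero] at h1
      exact ⟨y, hY0 ▸ (hYconn (i+2)).trans _ _ _ h1, h2⟩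

variable (Q) in
def Bset : Set V := {b | b ∈ Q.Sl ∧ ∃ l ∈ Q.L, Q.arr l b}

theorem Bset_finite : Q.Bset.Finite := by
  refine Set.Finite.subset (Q.hL.biUnion (fun l _ => Q.succ_fin l)) ?_
  rintro b ⟨_, l, hl, h⟩
  simp only [Set.mem_iUnion]
  exact ⟨l, hl, h⟩

/-- an arrow from outside `Sl` into `Sl` is, after shift, an arrow out of `L` -/
theorem shift_to_L {z y : V} (hz : z ∉ Q.Sl) (hy : y ∈ Q.Sl) (h : Q.arr z y) :
    ∃ k, Q.t^[k] y ∈ Q.Bset := by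
  have hz' : ∃ k, Q.t^[k] z ∈ Q.L := by
    by_contra hc; push Not at hc; exact hz hc
  classical
  refine ⟨Nat.find hz', sl_iter hy _, _, Nat.find_spec hz', ?_⟩
  have hmin : ∀ i, i < Nat.find hz' → Q.t^[i] z ∉ Q.L := fun i hi => Nat.find_min hz' hi
  have : ∀ k, k ≤ Nat.find hz' → Q.arr (Q.t^[k] z) (Q.t^[k] y) := by
    intro k
    induction k with
    | zero => intro _; exact h
    | succ k ih =>
      intro hk
      rw [Function.iterate_succ_apply', Function.iterate_succ_apply']
      exact arr_tt (hmin k (by omega)) (hy k) (ih (by omega))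
  exact this _ le_rfl

theorem exists_from_B {q y : V} (hq : q ∉ Q.Sl) (h : Relation.ReflTransGen Q.arr q y)
    (hy : y ∈ Q.Sl) : ∃ b ∈ Q.Bset, ∃ j n, Q.Pt n b (Q.t^[j] y) := by
  induction h with
  | refl => exact absurd hy hq
  | @tail z y _ hzy ih =>
    by_cases hz : z ∈ Q.Sl
    · obtain ⟨b, hb, j, n, hn⟩ := ih hz
      exact ⟨b, hb, j, n+1, hn.snoc (arr_iter hz hy hzy j) (sl_iter hy j)⟩
    · obtain ⟨k, hk⟩ := shift_to_L hz hy hzy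
      exact ⟨_, hk, k, 0, rfl, hk.1⟩

theorem exists_quasi {M : V} (hM : M ∈ Q.Sl) : ∃ c s t, 0 < s + t ∧
    Q.Pt s (Q.t^[c] M) (Q.t^[t] (Q.t^[c] M)) := by
  by_cases hL : Q.L = ∅
  · have hall : ∀ x, x ∈ Q.Sl := fun x k => by simp [hL]
    have : ∀ y, Relation.TransGen Q.arr M y → ∃ n, 0 < n ∧ Q.Pt n M y := by
      intro y hy
      induction hy with
      | single h => exact ⟨1, one_pos, hall _, _, h, rfl, hall _⟩
      | tail _ h ih =>
        obtain ⟨n, hn, hp⟩ := ih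
        exact ⟨n+1, by omega, hp.snoc h (hall _)⟩
    obtain ⟨n, hn, hp⟩ := this M (Q.conn M M)
    exact ⟨0, n, 0, by omega, hp⟩
  · obtain ⟨q, hq⟩ := Set.nonempty_iff_ne_empty.2 hL
    have hqS : q ∉ Q.Sl := fun h => h 0 hq
    have h1 : ∀ k, ∃ b ∈ Q.Bset, ∃ k', k ≤ k' ∧ ∃ n, Q.Pt n b (Q.t^[k'] M) := by
      intro k
      obtain ⟨b, hb, j, n, hn⟩ := exists_from_B hqS (Q.conn q (Q.t^[k] M)).to_reflTransGen (sl_iter hM k)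
      rw [← Function.iterate_add_apply] at hn
      exact ⟨b, hb, j + k, by omega, n, hn⟩
    have h2 : ∃ b ∈ Q.Bset, ∀ k, ∃ k', k ≤ k' ∧ ∃ n, Q.Pt n b (Q.t^[k'] M) := by
      by_contra hc
      push Not at hc
      choose! K hK using hc
      obtain ⟨b, hb, k', hk', n, hn⟩ := h1 (Bset_finite.toFinset.sup K)
      exact hK b hb k' (le_trans (Finset.le_sup (f := K) (by simpa using hb)) hk') n hn
    obtain ⟨b, hb, h3⟩ := h2
    obtain ⟨k1, _, n1, hn1⟩ := h3 0
    obtain ⟨k2, hk2, n2, hn2⟩ := h3 (k1+n1+1)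
    have h4 := hn1.rev.trans hn2
    rw [← Function.iterate_add_apply] at h4
    refine ⟨n1+k1, n1+n2, k2-(n1+k1), by omega, ?_⟩
    rwa [← Function.iterate_add_apply, show k2 - (n1+k1) + (n1+k1) = k2 by omega]

variable (Q) in
theorem exists_reps : ∃ B : Set V, B.Finite ∧ (∀ b ∈ B, b ∈ Q.Sl) ∧ ∀ M ∈ Q.Sl, ∃ b ∈ B, Q.Conn b M := by
  by_cases hL : Q.L = ∅
  · have hall : ∀ x, x ∈ Q.Sl := fun x k => by simp [hL]
    rcases isEmpty_or_nonempty V with hV | ⟨⟨v⟩⟩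
    · exact ⟨∅, Set.finite_empty, by simp, fun M => (hV.false M).elim⟩
    · refine ⟨{v}, Set.finite_singleton v, fun b _ => hall b, fun M _ => ⟨v, rfl, ?_⟩⟩
      have := Q.conn v M
      clear * - this hall
      induction this with
      | single h => exact Conn.arr (hall _) (hall _) h
      | tail _ h ih => exact ih.trans _ _ _ (Conn.arr (hall _) (hall _) h)
  · obtain ⟨q, hq⟩ := Set.nonempty_iff_ne_empty.2 hL
    refine ⟨Q.Bset, Bset_finite, fun b hb => hb.1, fun M hM => ?_⟩
    obtain ⟨b, hb, j, n, hn⟩ := exists_from_B (fun h : q ∈ Q.Sl => h 0 hq) (Q.conn q M).to_reflTransGen hM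
    exact ⟨b, hb, hn.conn.trans _ _ _ ((Conn.iter hM j).symm _ _)⟩

theorem exists_sect {M : V} (hM : M ∈ Q.Sl) (hper : ¬ Q.Per M) :
    ∃ Y s t, Q.Sect Y s t ∧ Q.Conn M (Y 0) := by
  obtain ⟨c, s, t, hst, hp⟩ := exists_quasi hM
  obtain ⟨p, p0, ps, hp1, hp2⟩ := hp.fn
  obtain ⟨y, hy, h⟩ := reduction s t p hp1 hp2 (by rw [ps, p0]) hst
  have hc : Q.Conn M y := (Conn.iter hM c).trans _ _ _ (p0 ▸ hy)
  rcases h with h | ⟨Y, s', t', h1, rfl⟩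
  · exact absurd ((per_conn_iff hc).2 h) hper
  · exact ⟨Y, s', t', h1, hc⟩

theorem Sect.per_q {Y : ℕ → V} {s t : ℕ} (h : Q.Sect Y s t) (i q : ℕ) :
    Y (i + q*s) = Q.t^[q*t] (Y i) := by
  induction q with
  | zero => simp
  | succ q ih =>
    rw [show i + (q+1)*s = i + q*s + s by ring, h.per, ih, ← Function.iterate_add_apply]
    congr 1; ring_nf

theorem Sect.covers {Y : ℕ → V} {s t : ℕ} (h : Q.Sect Y s t) {M : V} (hM : M ∈ Q.Sl)
    (hc : Q.Conn (Y 0) M) : ∃ a b i, Q.t^[a] M = Q.t^[b] (Y i) := by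
  obtain ⟨k0, hk0⟩ := h.stab
  have norm : ∀ x a b i, Q.t^[a] x = Q.t^[b] (Y i) → ∃ a b i, k0 ≤ b ∧ Q.t^[a] x = Q.t^[b] (Y (i+1)) := by
    intro x a b i he
    refine ⟨k0 + t + a, b + k0, i + s - 1 , by omega, ?_⟩
    have hs := h.spos
    rw [show i + s - 1 + 1 = i + s by omega, h.per, Function.iterate_add_apply, he,
      ← Function.iterate_add_apply, ← Function.iterate_add_apply]
    congr 1; ring_nf
  have hpred : ∀ x y, x ∈ Q.Sl → y ∈ Q.Sl → Q.arr x y → (∃ a b i, Q.t^[a] y = Q.t^[b] (Y i)) →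
      ∃ a b i, Q.t^[a] x = Q.t^[b] (Y i) := by
    rintro x y hx hy ha ⟨a, b, i, he⟩
    obtain ⟨a, b, i, hb, he⟩ := norm y a b i he
    have h1 := arr_iter hx hy ha a
    rw [he] at h1
    have h2 := (Q.arr_mesh _ (h.mem (i+1) b) _).1 h1
    rw [hk0 b hb] at h2
    simp only [Multiset.insert_eq_cons, Multiset.mem_cons, Multiset.mem_singleton] at h2
    rcases h2 with h2 | h2
    · exact ⟨_, _, _, h2⟩
    · exact ⟨_, _, _, h2⟩
  refine (Conn.closed (P := fun x => ∃ a b i, Q.t^[a] x = Q.t^[b] (Y i)) ?_ ?_ hc).1 ⟨0, 0, 0, rfl⟩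
  · intro x y hx hy ha
    refine ⟨fun hP => ?_, hpred x y hx hy ha⟩
    obtain ⟨a, b, i, he⟩ := hpred _ _ (sl_t hy) hx (arr_t (sl_not_mem hy) ha) hP
    exact ⟨a+1, b, i, he⟩
  · intro x hx
    constructor
    · rintro ⟨a, b, i, he⟩
      refine ⟨a, b+1, i, ?_⟩
      rw [← Function.iterate_succ_apply, Function.iterate_succ_apply', he, Function.iterate_succ_apply']
    · rintro ⟨a, b, i, he⟩
      exact ⟨a+1, b, i, he⟩

/-- nonperiodic left stable vertices are eventually not bad -/
theorem eventually_not_bad {M : V} (hM : M ∈ Q.Sl) (hper : ¬ Q.Per M) :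
    ∃ k0, ∀ k, k0 ≤ k → ¬ Q.bad (Q.t^[k] M) := by
  obtain ⟨Y, s, t, h, hc⟩ := exists_sect hM hper
  obtain ⟨a, b, i, he⟩ := h.covers hM (hc.symm _ _)
  obtain ⟨k0, hk0⟩ := h.stab
  refine ⟨k0 + t + a, fun k hk hbad => ?_⟩
  have hs := h.spos
  have e1 : Q.t^[k] M = Q.t^[k - a - t + b] (Y (i + s - 1 + 1)) := by
    rw [show i + s - 1 + 1 = i + s by omega, h.per, ← Function.iterate_add_apply,
      show k - a - t + b + t = (k - a) + b by omega, Function.iterate_add_apply, ← he,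
      ← Function.iterate_add_apply]
    congr 1; omega
  have := hbad.2
  rw [e1, hk0 _ (by omega)] at this
  simp at this

variable (Q) in
/-- finitely many orbits of nonperiodic left stable vertices -/
theorem finite_orbits : ∃ Z : Set V, Z.Finite ∧ ∀ M ∈ Q.Sl, ¬ Q.Per M →
    ∃ z ∈ Z, z ∈ Q.Sl ∧ ∃ a b, Q.t^[a] M = Q.t^[b] z := by
  obtain ⟨B, hB, hBS, hB2⟩ := Q.exists_reps
  have : ∀ b ∈ B, ∃ Z : Set V, Z.Finite ∧ ∀ M ∈ Q.Sl, ¬ Q.Per M → Q.Conn b M →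
    ∃ z ∈ Z, z ∈ Q.Sl ∧ ∃ a b, Q.t^[a] M = Q.t^[b] z := by
    intro b hb
    by_cases hper : Q.Per b
    · exact ⟨∅, Set.finite_empty, fun M _ h h' => absurd ((per_conn_iff h').1 hper) h⟩
    · obtain ⟨Y, s, t, h, hc⟩ := exists_sect (hBS b hb) hper
      refine ⟨Y '' (Set.Iio s), (Set.finite_Iio s).image _, fun M hM _ hbM => ?_⟩
      obtain ⟨a, b', i, he⟩ := h.covers hM ((hc.symm _ _).trans _ _ _ hbM)
      refine ⟨_, ⟨i % s, Nat.mod_lt _ h.spos, rfl⟩, h.mem _, a, b' + (i/s)*t, ?_⟩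
      rw [he, Function.iterate_add_apply, ← h.per_q, mul_comm, Nat.mod_add_div]
  choose! Z hZ hZ2 using this
  refine ⟨⋃ b ∈ B, Z b, hB.biUnion hZ, fun M hM hp => ?_⟩
  obtain ⟨b, hb, hc⟩ := hB2 M hM
  obtain ⟨z, hz, h⟩ := hZ2 b hb M hM hp hc
  exact ⟨z, by simp only [Set.mem_iUnion]; exact ⟨b, hb, hz⟩, h⟩

end TQ
end CF
end

section
namespace CF
namespace TQ
variable {V : Type*} {Q : TQ V}

theorem notSr_chain {x : V} (hx : x ∉ Q.op.Sl) :
    ∃ r ∈ Q.R, ∃ j, Q.t^[j] r = x ∧ ∀ i, i < j → Q.t^[i] r ∉ Q.L := by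
  have hz' : ∃ k, Q.s^[k] x ∈ Q.R := by
    by_contra hc; push Not at hc; exact hx hc
  classical
  have hmin : ∀ i, i < Nat.find hz' → Q.s^[i] x ∉ Q.R := fun i hi => Nat.find_min hz' hi
  have key : ∀ i, i ≤ Nat.find hz' → Q.t^[i] (Q.s^[Nat.find hz'] x) = Q.s^[Nat.find hz' - i] x := by
    intro i
    induction i with
    | zero => intro _; rfl
    | succ i ih =>
      intro hi
      rw [Function.iterate_succ_apply', ih (by omega),
        show Nat.find hz' - i = (Nat.find hz' - (i+1)) + 1 by omega, Function.iterate_succ_apply',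
        Q.t_s _ (hmin _ (by omega))]
  refine ⟨_, Nat.find_spec hz', Nat.find hz', ?_, fun i hi => ?_⟩
  · rw [key _ le_rfl]; simp
  · rw [key i hi.le, show Nat.find hz' - i = (Nat.find hz' - (i+1)) + 1 by omega,
      Function.iterate_succ_apply']
    exact Q.s_mem _ (hmin _ (by omega))

theorem bad_notSr_finite : {x | Q.bad x ∧ x ∉ Q.op.Sl}.Finite := by
  have : ∀ r ∈ Q.R, {j | (∀ i, i < j → Q.t^[i] r ∉ Q.L) ∧ Q.bad (Q.t^[j] r)}.Finite := by
    intro r hr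
    by_cases hrS : r ∈ Q.Sl
    · have hper : ¬ Q.Per r := by
        rintro ⟨_, P, hP, he⟩
        obtain ⟨P, rfl⟩ : ∃ P', P = P' + 1 := ⟨P-1, by omega⟩
        rw [Function.iterate_succ_apply'] at he
        have := Q.t_mem _ (hrS P)
        rw [he] at this; exact this hr
      obtain ⟨k0, hk0⟩ := eventually_not_bad hrS hper
      refine (Set.finite_Iio k0).subset ?_
      rintro j ⟨_, hj⟩
      by_contra hc
      exact hk0 j (by simpa using hc) hj
    · obtain ⟨k, hk⟩ : ∃ k, Q.t^[k] r ∈ Q.L := by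
        by_contra hc; push Not at hc; exact hrS hc
      refine (Set.finite_Iic k).subset ?_
      rintro j ⟨hj, _⟩
      by_contra hc
      exact hj k (by simpa using hc) hk
  refine (Q.hR.biUnion (fun r hr => (this r hr).image (fun j => Q.t^[j] r))).subset ?_
  rintro x ⟨hb, hx⟩
  obtain ⟨r, hr, j, rfl, hj⟩ := notSr_chain hx
  simp only [Set.mem_iUnion]
  exact ⟨r, hr, j, ⟨hj, hb⟩, rfl⟩

theorem bad_op {x : V} (h : Q.bad x) : Q.op.bad (Q.t x) := by
  refine ⟨Q.t_mem x h.1, ?_⟩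
  show 3 ≤ (Q.mesh (Q.s (Q.t x))).card
  rw [Q.s_t x h.1]; exact h.2

theorem bad_notSl_finite : {x | Q.bad x ∧ x ∉ Q.Sl}.Finite := by
  refine ((bad_notSr_finite (Q := Q.op)).image Q.s).subset ?_
  rintro x ⟨hb, hx⟩
  exact ⟨Q.t x, ⟨bad_op hb, fun h => hx (sl_of_t hb.1 h)⟩, Q.s_t x hb.1⟩

theorem op_per {x : V} (hx : x ∈ Q.Sl) (h : Q.op.Per x) : Q.Per x := by
  obtain ⟨hr, P, hP, he⟩ := h
  refine ⟨hx, P, hP, ?_⟩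
  have h1 : Q.t^[P] (Q.s^[P] x) = x := s_iter_t_iter (Q := Q.op) hr P
  have h2 : Q.s^[P] x = x := he
  rwa [h2] at h1

theorem bad_nonper_finite : {x | Q.bad x ∧ x ∈ Q.Sl ∧ x ∈ Q.op.Sl ∧ ¬ Q.Per x}.Finite := by
  obtain ⟨Z, hZ, hZ2⟩ := Q.finite_orbits
  have : ∀ z ∈ Z, {x | (Q.bad x ∧ x ∈ Q.Sl ∧ x ∈ Q.op.Sl ∧ ¬ Q.Per x) ∧ z ∈ Q.Sl ∧
      ∃ a b, Q.t^[a] x = Q.t^[b] z}.Finite := by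
    intro z _
    by_cases hne : ∃ x0, (x0 ∈ Q.Sl ∧ x0 ∈ Q.op.Sl ∧ ¬ Q.Per x0) ∧ z ∈ Q.Sl ∧
      ∃ a b, Q.t^[a] x0 = Q.t^[b] z
    · obtain ⟨x0, ⟨h1, h2, h3⟩, hz, a0, b0, he0⟩ := hne
      obtain ⟨k0, hk0⟩ := eventually_not_bad h1 h3
      obtain ⟨k1, hk1⟩ := eventually_not_bad (Q := Q.op) h2 (fun h => h3 (op_per h1 h))
      refine (((Set.finite_Iio k0).image (fun k => Q.t^[k] x0)).union
        ((Set.finite_Iio (k1+1)).image (fun k => Q.s^[k] x0))).subset ?_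
      rintro x ⟨⟨g1, g2, g3, g4⟩, _, a, b, he⟩
      -- t^{b0+a} x = t^{b+a0} x0
      have hxx : Q.t^[b0 + a] x = Q.t^[b + a0] x0 := by
        rw [Function.iterate_add_apply, he, Function.iterate_add_apply, he0,
          ← Function.iterate_add_apply, ← Function.iterate_add_apply, add_comm]
      rcases le_or_gt (b0 + a) (b + a0) with hle | hlt
      · left
        have : x = Q.t^[b+a0-(b0+a)] x0 := by
          apply iter_inj g2 (sl_iter h1 _) (b0+a)
          rw [hxx, ← Function.iterate_add_apply]; congr 1; omega
        refine ⟨b+a0-(b0+a), ?_, this.symm⟩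
        by_contra hc
        apply hk0 _ (by simpa using hc)
        rw [← this]; exact g1
      · right
        obtain ⟨d, hd⟩ : ∃ d, b0 + a - (b + a0) = d + 1 := ⟨b0 + a - (b + a0) - 1, by omega⟩
        have h0 : x0 = Q.t^[d+1] x := by
          apply iter_inj h1 (sl_iter g2 _) (b+a0)
          rw [← hxx, ← Function.iterate_add_apply]; congr 1; omega
        have hx : Q.s^[d+1] x0 = x := by rw [h0]; exact s_iter_t_iter g2 (d+1)
        refine ⟨d+1, ?_, hx⟩
        by_contra hc
        have hd1 : k1 ≤ d := by simpa using hc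
        apply hk1 d hd1
        have : Q.op.t^[d] x0 = Q.t x := by
          show Q.s^[d] x0 = Q.t x
          rw [h0, Function.iterate_succ_apply]
          exact s_iter_t_iter (sl_t g2) d
        rw [this]; exact bad_op g1
    · refine Set.finite_empty.subset ?_
      rintro x ⟨⟨_, g⟩, h⟩
      exact hne ⟨x, g, h⟩
  refine (hZ.biUnion this).subset ?_
  rintro x hx
  obtain ⟨z, hz, h⟩ := hZ2 x hx.2.1 hx.2.2.2
  simp only [Set.mem_iUnion]
  exact ⟨z, hz, hx, h⟩

/-- all nonperiodic bad vertices form a finite set -/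
theorem bad_nonper_finite' : {x | Q.bad x ∧ ¬ Q.Per x}.Finite := by
  refine ((bad_notSr_finite (Q := Q)).union ((bad_notSl_finite (Q := Q)).union
    (bad_nonper_finite (Q := Q)))).subset ?_
  rintro x ⟨h1, h2⟩
  by_cases h3 : x ∈ Q.Sl
  · by_cases h4 : x ∈ Q.op.Sl
    · exact Or.inr (Or.inr ⟨h1, h3, h4, h2⟩)
    · exact Or.inl ⟨h1, h4⟩
  · exact Or.inr (Or.inl ⟨h1, h3⟩)

/-- in the stable case nonperiodic vertices are never bad -/
theorem stable_nonper (hLR : Q.L = ∅) (hRR : Q.R = ∅) {M : V} (hper : ¬ Q.Per M) : ¬ Q.bad M := by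
  have hall : ∀ x, x ∈ Q.Sl := fun x k => by simp [hLR]
  obtain ⟨Y, s, t, h, hc⟩ := exists_sect (hall M) hper
  obtain ⟨a, b, i, he⟩ := h.covers (hall M) (hc.symm _ _)
  have hs := h.spos
  have h' := h.shift_s hLR hRR (a + t)
  have e1 : M = Q.t^[b] (Q.s^[a+t] (Y (i + s - 1 + 1))) := by
    apply iter_inj (hall _) (hall _) (a + t)
    have hts : Q.t^[a+t] (Q.s^[a+t] (Y (i + s - 1 + 1))) = Y (i + s - 1 + 1) :=
      (Function.RightInverse.iterate (f := Q.t) (g := Q.s) (fun x => Q.t_s x (by simp [hRR])) (a+t)) _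
    rw [← Function.iterate_add_apply, show a + t + b = b + (a+t) by ring, Function.iterate_add_apply _ b,
      hts, show i + s - 1 + 1 = i + s by omega, h.per, add_comm a t, Function.iterate_add_apply, he,
      ← Function.iterate_add_apply, ← Function.iterate_add_apply, add_comm]
  intro hbad
  have := hbad.2
  have h2 := h'.stab_two hLR hRR b (i + s - 1)
  rw [e1, h2] at this
  simp at this

end TQ
end CF
end

section
namespace CF
namespace TQ
variable {V : Type*} {Q : TQ V}

theorem sum_periodic (a : ℕ → ℚ) (P : ℕ) (h : ∀ k, a (k+P) = a k) (m : ℕ) :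
    ∑ k ∈ Finset.range (m*P), a k = m * ∑ k ∈ Finset.range P, a k := by
  induction m with
  | zero => simp
  | succ m ih =>
    rw [add_mul, one_mul, Finset.sum_range_add, ih]
    have : ∀ q k, a (q*P+k) = a k := by
      intro q
      induction q with
      | zero => simp
      | succ q ih => intro k; rw [show (q+1)*P + k = q*P+k+P by ring, h, ih]
    simp only [this]; push_cast; ring

variable (Q) in
open Classical in
noncomputable def avg (z : V) : ℚ :=
  if h : ∃ P, 0 < P ∧ Q.t^[P] z = z then
    (∑ k ∈ Finset.range h.choose, (Q.len (Q.t^[k] z) : ℚ)) / h.choose else 0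

theorem avg_eq {z : V} {P : ℕ} (hP : 0 < P) (h : Q.t^[P] z = z) :
    ∑ k ∈ Finset.range P, (Q.len (Q.t^[k] z) : ℚ) = P * Q.avg z := by
  have hex : ∃ P, 0 < P ∧ Q.t^[P] z = z := ⟨P, hP, h⟩
  have hav : Q.avg z = (∑ k ∈ Finset.range hex.choose, (Q.len (Q.t^[k] z) : ℚ)) / hex.choose := by
    unfold avg; rw [dif_pos hex]
  obtain ⟨h1, h2⟩ := hex.choose_spec
  set p := hex.choose
  have hper : ∀ p, Q.t^[p] z = z → ∀ k, (Q.len (Q.t^[k+p] z) : ℚ) = Q.len (Q.t^[k] z) := by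
    intro p hp k
    rw [Function.iterate_add_apply, hp]
  have e1 := sum_periodic (fun k => (Q.len (Q.t^[k] z) : ℚ)) P (hper P h) p
  have e2 := sum_periodic (fun k => (Q.len (Q.t^[k] z) : ℚ)) p (hper p h2) P
  rw [mul_comm p P] at e1
  rw [e2] at e1
  have hp0 : (p : ℚ) ≠ 0 := by positivity
  rw [hav]
  field_simp
  linarith

theorem avg_t {z : V} (h : Q.Per z) : Q.avg (Q.t z) = Q.avg z := by
  obtain ⟨hz, P, hP, he⟩ := h
  have he' : Q.t^[P] (Q.t z) = Q.t z := by
    rw [← Function.iterate_succ_apply, Function.iterate_succ_apply', he]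
  have h1 := avg_eq hP he
  have h2 := avg_eq hP he'
  have h3 : ∑ k ∈ Finset.range P, (Q.len (Q.t^[k] (Q.t z)) : ℚ) =
      ∑ k ∈ Finset.range P, (Q.len (Q.t^[k] z) : ℚ) := by
    have a1 := Finset.sum_range_succ (fun k => (Q.len (Q.t^[k] z) : ℚ)) P
    have a2 := Finset.sum_range_succ' (fun k => (Q.len (Q.t^[k] z) : ℚ)) P
    simp only [he, Function.iterate_succ_apply, Function.iterate_zero_apply] at a1 a2
    rw [a1] at a2
    linarith
  rw [h1] at h3
  rw [h2] at h3
  have : (P : ℚ) ≠ 0 := by positivity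
  exact mul_left_cancel₀ this h3

theorem avg_iter {z : V} (h : Q.Per z) (k : ℕ) : Q.avg (Q.t^[k] z) = Q.avg z := by
  induction k with
  | zero => rfl
  | succ k ih => rw [Function.iterate_succ_apply', avg_t ((per_iter_iff h.1 k).1 h), ih]

theorem avg_pos {z : V} (h : Q.Per z) : 0 < Q.avg z := by
  obtain ⟨hz, P, hP, he⟩ := h
  have h1 := avg_eq hP he
  have : 0 < ∑ k ∈ Finset.range P, (Q.len (Q.t^[k] z) : ℚ) := by
    apply Finset.sum_pos
    · intro i _; exact_mod_cast Q.len_pos _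
    · exact ⟨0, by simpa using hP⟩
  rw [h1] at this
  have hP' : (0:ℚ) < P := by exact_mod_cast hP
  exact (mul_pos_iff_of_pos_left hP').1 this

theorem common_period (m : Multiset V) (h : ∀ e ∈ m, Q.Per e) : ∃ P, 0 < P ∧ ∀ e ∈ m, Q.t^[P] e = e := by
  induction m using Multiset.induction_on with
  | empty => exact ⟨1, one_pos, by simp⟩
  | cons a m ih =>
    obtain ⟨P, hP, h1⟩ := ih (fun e he => h e (Multiset.mem_cons_of_mem he))
    obtain ⟨_, p, hp, h2⟩ := h a (Multiset.mem_cons_self a m)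
    refine ⟨P*p, Nat.mul_pos hP hp, fun e he => ?_⟩
    rcases Multiset.mem_cons.1 he with rfl | he
    · exact iter_mul_fix h2 P
    · rw [mul_comm]; exact iter_mul_fix (h1 e he) p

theorem swap_sum (m : Multiset V) (P : ℕ) (hP : 0 < P) (h : ∀ e ∈ m, Q.t^[P] e = e) :
    ∑ k ∈ Finset.range P, (((m.map (Q.t^[k])).map Q.len).sum : ℚ) = P * (m.map Q.avg).sum := by
  induction m using Multiset.induction_on with
  | empty => simp
  | cons a m ih =>
    have h1 := ih (fun e he => h e (Multiset.mem_cons_of_mem he))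
    have h2 := avg_eq hP (h a (Multiset.mem_cons_self a m))
    simp only [Multiset.map_cons, Multiset.sum_cons, Nat.cast_add]
    rw [Finset.sum_add_distrib, h1, h2]; ring

theorem avg_mesh {y : V} (hy : Q.Per y) (m : Multiset V) (hm : ∀ e ∈ m, Q.Per e)
    (hle : ∀ k, m.map (Q.t^[k]) ≤ Q.mesh (Q.t^[k] y)) :
    (m.map Q.avg).sum ≤ 2 * Q.avg y ∧
      ((m.map Q.avg).sum = 2 * Q.avg y → ∀ k, m.map (Q.t^[k]) = Q.mesh (Q.t^[k] y)) := by
  obtain ⟨P, hP, h⟩ := common_period (Q := Q) (y ::ₘ m) (by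
    intro e he
    rcases Multiset.mem_cons.1 he with rfl | he
    · exact hy
    · exact hm e he)
  have hPy := h y (Multiset.mem_cons_self y m)
  have hPm : ∀ e ∈ m, Q.t^[P] e = e := fun e he => h e (Multiset.mem_cons_of_mem he)
  have hPty : Q.t^[P] (Q.t y) = Q.t y := by
    rw [← Function.iterate_succ_apply, Function.iterate_succ_apply', hPy]
  have hP' : (0:ℚ) < P := by exact_mod_cast hP
  have e1 := swap_sum m P hP hPm
  have e2 : ∑ k ∈ Finset.range P, (((Q.mesh (Q.t^[k] y)).map Q.len).sum : ℚ) = P * (2 * Q.avg y) := by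
    have a1 := avg_eq hP hPy
    have a2 := avg_eq hP hPty
    rw [avg_t hy] at a2
    rw [show (P:ℚ) * (2 * Q.avg y) = P * Q.avg y + P * Q.avg y by ring]
    nth_rewrite 1 [← a1]
    rw [← a2, ← Finset.sum_add_distrib]
    refine Finset.sum_congr rfl fun k _ => ?_
    rw [← Q.len_mesh _ (hy.1 k), ← Function.iterate_succ_apply' Q.t, Function.iterate_succ_apply]
    push_cast; rfl
  have hk : ∀ k ∈ Finset.range P, (((m.map (Q.t^[k])).map Q.len).sum : ℚ) ≤
      (((Q.mesh (Q.t^[k] y)).map Q.len).sum : ℚ) := by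
    intro k _
    exact_mod_cast len_le_of_le Q.len (hle k)
  constructor
  · have := Finset.sum_le_sum hk
    rw [e1, e2] at this
    exact le_of_mul_le_mul_left this hP'
  · intro heq k
    rw [heq, ← e2] at e1
    have h3 := (Finset.sum_eq_sum_iff_of_le hk).1 e1 (k % P) (Finset.mem_range.2 (Nat.mod_lt k hP))
    have h4 : m.map (Q.t^[k%P]) = Q.mesh (Q.t^[k%P] y) :=
      sum_map_eq_imp Q.len_pos (hle _) (by exact_mod_cast h3)
    have hmodk : ∀ e, Q.t^[P] e = e → Q.t^[k] e = Q.t^[k%P] e := by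
      intro e he
      conv_lhs => rw [← Nat.mod_add_div k P, Function.iterate_add_apply, mul_comm, iter_mul_fix he]
    rw [hmodk y hPy, ← h4]
    exact Multiset.map_congr rfl (fun e he => hmodk e (hPm e he))

theorem concave_mono (a : ℕ → ℚ) (hpos : ∀ i, 0 < a i) (hc : ∀ i, a (i+2) + a i ≤ 2 * a (i+1)) (i : ℕ) :
    a i ≤ a (i+1) := by
  by_contra hlt
  push Not at hlt
  have h1 : ∀ n, a (i+n+1) - a (i+n) ≤ a (i+1) - a i := by
    intro n
    induction n with
    | zero => simp
    | succ n ih =>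
      have := hc (i+n)
      rw [show i + (n+1) + 1 = i + n + 2 by ring, show i + (n+1) = i + n + 1 by ring]
      linarith
  have h2 : ∀ n : ℕ, a (i+n) ≤ a i + n * (a (i+1) - a i) := by
    intro n
    induction n with
    | zero => simp
    | succ n ih =>
      have := h1 n
      rw [show i + (n+1) = i + n + 1 by ring]
      push_cast; linarith
  obtain ⟨n, hn⟩ := exists_nat_gt (a i / (a i - a (i+1)))
  have hd : 0 < a i - a (i+1) := by linarith
  rw [div_lt_iff₀ hd] at hn
  have := h2 n
  have := hpos (i+n)
  linarith

/-- extra data used in the periodic part -/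
structure Val (Q : TQ V) where
  μ : V → ℕ
  pos : ∀ x, 0 < μ x
  mono : ∀ x, x ∉ Q.L → μ x ≤ μ (Q.t x)
  cnt : ∀ [DecidableEq V] x e, x ∉ Q.L → e ∉ Q.L →
    (Q.mesh x).count e * μ e = (Q.mesh e).count (Q.t x) * μ (Q.t x)
  unb : Q.L = ∅ → Q.R = ∅ → ∀ N, ∃ x, N < Q.len x

theorem Val.const (v : Val Q) {x : V} (h : Q.Per x) : v.μ (Q.t x) = v.μ x := by
  obtain ⟨hx, P, hP, he⟩ := h
  refine le_antisymm ?_ (v.mono x (hx 0))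
  have h1 : ∀ k, v.μ (Q.t x) ≤ v.μ (Q.t^[k] (Q.t x)) := by
    intro k
    induction k with
    | zero => exact le_rfl
    | succ k ih =>
      rw [Function.iterate_succ_apply']
      exact ih.trans (v.mono _ (by rw [← Function.iterate_succ_apply]; exact hx _))
  obtain ⟨P, rfl⟩ : ∃ P', P = P' + 1 := ⟨P-1, by omega⟩
  have := h1 P
  rwa [← Function.iterate_succ_apply, he] at this

theorem Val.mesh_t (v : Val Q) {y : V} (hy : Q.Per y) (h1 : ∀ e, Q.arr e y → e ∈ Q.Sl)
    (h2 : ∀ e, Q.arr e (Q.t y) → e ∈ Q.Sl) : Q.mesh (Q.t y) = (Q.mesh y).map Q.t := by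
  classical
  have hyt := (per_t_iff hy.1).1 hy
  have key : ∀ e, e ∈ Q.mesh y → (Q.mesh (Q.t y)).count (Q.t e) = (Q.mesh y).count e := by
    intro e he
    have hea := (Q.arr_mesh y (hy.1 0) e).2 he
    have heS := h1 e hea
    have hper := (per_arr_iff heS hy.1 hea).2 hy
    have c1 := v.cnt y e (hy.1 0) (heS 0)
    have c2 := v.cnt e (Q.t y) (heS 0) (hyt.1 0)
    rw [c2, v.const hper] at c1
    exact (Nat.eq_of_mul_eq_mul_right (v.pos e) c1).symm
  ext a
  by_cases ha : a ∈ Q.mesh (Q.t y)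
  · have haa := (Q.arr_mesh _ (hyt.1 0) a).2 ha
    have haS := h2 a haa
    have hap := (per_arr_iff haS hyt.1 haa).2 hyt
    obtain ⟨_, P, hP, he⟩ := hap
    obtain ⟨P, rfl⟩ : ∃ P', P = P' + 1 := ⟨P-1, by omega⟩
    rw [Function.iterate_succ_apply'] at he
    set a' := Q.t^[P] a
    have ha' : a' ∈ Q.Sl := sl_iter haS P
    rw [← he] at haa
    have h3 : Q.arr a' y := arr_of_t (hy.1 0) (arr_of_t (ha' 0) haa)
    have h4 := (Q.arr_mesh y (hy.1 0) a').1 h3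
    rw [← he, key a' h4]
    symm
    apply Multiset.count_map_eq_count
    · intro b hb c hc hbc
      have hb' := h1 b ((Q.arr_mesh y (hy.1 0) b).2 hb)
      have hc' := h1 c ((Q.arr_mesh y (hy.1 0) c).2 hc)
      exact t_inj (hb' 0) (hc' 0) hbc
    · exact h4
  · rw [Multiset.count_eq_zero_of_notMem ha]
    symm
    apply Multiset.count_eq_zero_of_notMem
    intro hm
    obtain ⟨a', ha', rfl⟩ := Multiset.mem_map.1 hm
    have h3 := (Q.arr_mesh y (hy.1 0) a').2 ha'
    have h4 := h1 a' h3
    exact ha ((Q.arr_mesh _ (hyt.1 0) _).1 (arr_tt (h4 0) (hy.1 0) h3))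

theorem Val.mesh_iter (v : Val Q) {y : V} (hy : Q.Per y) (h1 : ∀ k e, Q.arr e (Q.t^[k] y) → e ∈ Q.Sl)
    (k : ℕ) : Q.mesh (Q.t^[k] y) = (Q.mesh y).map (Q.t^[k]) := by
  induction k with
  | zero => simp
  | succ k ih =>
    rw [Function.iterate_succ_apply', v.mesh_t ((per_iter_iff hy.1 k).1 hy) (h1 k)
      (by rw [← Function.iterate_succ_apply' Q.t]; exact h1 (k+1)), ih, Multiset.map_map]
    refine Multiset.map_congr rfl fun e _ => ?_
    simp only [Function.comp]
    rw [← Function.iterate_succ_apply' Q.t]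

end TQ
end CF
end

section
namespace CF

theorem konig {α : Type*} (c : α → α → Prop) (hf : ∀ z, {y | c z y}.Finite) (D : Set α) (hD : D.Finite)
    (hinf : {y | ∃ z ∈ D, Relation.ReflTransGen c z y}.Infinite) :
    ∃ r : ℕ → α, r 0 ∈ D ∧ ∀ i, c (r i) (r (i+1)) := by
  have h0 : ∃ z ∈ D, {y | Relation.ReflTransGen c z y}.Infinite := by
    by_contra hc
    push Not at hc
    apply hinf
    refine (hD.biUnion (fun z hz => Set.not_infinite.1 (by simpa using hc z hz))).subset ?_
    rintro y ⟨z, hz, h⟩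
    simp only [Set.mem_iUnion]
    exact ⟨z, hz, h⟩
  have hs : ∀ z, {y | Relation.ReflTransGen c z y}.Infinite →
      ∃ w, c z w ∧ {y | Relation.ReflTransGen c w y}.Infinite := by
    intro z hz
    by_contra hc
    push Not at hc
    apply hz
    refine (((hf z).biUnion (fun w hw => Set.not_infinite.1 (by simpa using hc w hw))).insert z).subset ?_
    intro y hy
    rcases Relation.ReflTransGen.cases_head hy with rfl | ⟨w, hw, h⟩
    · exact Set.mem_insert _ _
    · right
      simp only [Set.mem_iUnion]
      exact ⟨w, hw, h⟩
  obtain ⟨z0, hz0, hi⟩ := h0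
  choose f hf1 hf2 using hs
  let r : ℕ → {z // {y | Relation.ReflTransGen c z y}.Infinite} :=
    fun n => Nat.rec ⟨z0, hi⟩ (fun _ z => ⟨f z.1 z.2, hf2 z.1 z.2⟩) n
  exact ⟨fun n => (r n).1, hz0, fun i => hf1 _ _⟩

namespace TQ
variable {V : Type*} {Q : TQ V}

variable (Q) in
def lev (x : V) : ℕ → Set V
  | 0 => {y | ∃ k, y = Q.t^[k] x}
  | n+1 => {z | Q.Per z ∧ ∃ w ∈ lev x n, Q.arr z w}

theorem lev_per {x : V} (hx : Q.Per x) {n : ℕ} {y : V} (h : y ∈ Q.lev x n) : Q.Per y := by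
  cases n with
  | zero => obtain ⟨k, rfl⟩ := h; exact (per_iter_iff hx.1 k).1 hx
  | succ n => exact h.1

theorem lev_t {x : V} (hx : Q.Per x) {n : ℕ} {y : V} (h : y ∈ Q.lev x n) : Q.t y ∈ Q.lev x n := by
  induction n generalizing y with
  | zero =>
    obtain ⟨k, rfl⟩ := h
    exact ⟨k+1, by rw [Function.iterate_succ_apply']⟩
  | succ n ih =>
    obtain ⟨h1, w, h2, h3⟩ := h
    exact ⟨(per_t_iff h1.1).1 h1, Q.t w, ih h2, arr_tt (h1.1 0) ((lev_per hx h2).1 0) h3⟩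

theorem lev_iter {x : V} (hx : Q.Per x) {n : ℕ} {y : V} (h : y ∈ Q.lev x n) (k : ℕ) :
    Q.t^[k] y ∈ Q.lev x n := by
  induction k with
  | zero => exact h
  | succ k ih => rw [Function.iterate_succ_apply']; exact lev_t hx ih

theorem lev_of_t {x : V} (hx : Q.Per x) {n : ℕ} {y : V} (hy : y ∈ Q.Sl) (h : Q.t y ∈ Q.lev x n) :
    y ∈ Q.lev x n := by
  obtain ⟨_, P, hP, he⟩ := (per_t_iff hy).2 (lev_per hx h)
  obtain ⟨P, rfl⟩ : ∃ P', P = P' + 1 := ⟨P-1, by omega⟩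
  have := lev_iter hx h P
  rwa [← Function.iterate_succ_apply, he] at this

theorem lev_conn {x y : V} (hx : Q.Per x) (h : Q.Conn x y) : ∃ n, y ∈ Q.lev x n := by
  refine (Conn.closed (P := fun y => ∃ n, y ∈ Q.lev x n) ?_ ?_ h).1 ⟨0, 0, rfl⟩
  · intro a b ha hb hab
    constructor
    · rintro ⟨n, hn⟩
      have hp := lev_per hx hn
      have hpb := (per_arr_iff ha hb hab).1 hp
      exact ⟨n+1, lev_of_t hx hb ⟨(per_t_iff hb).1 hpb, a, hn, arr_t (hb 0) hab⟩⟩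
    · rintro ⟨n, hn⟩
      exact ⟨n+1, (per_arr_iff ha hb hab).2 (lev_per hx hn), b, hn, hab⟩
  · intro a ha
    exact ⟨fun ⟨n, hn⟩ => ⟨n, lev_t hx hn⟩, fun ⟨n, hn⟩ => ⟨n, lev_of_t hx ha hn⟩⟩

theorem orbit_finite {x : V} (hx : Q.Per x) : {y | ∃ k, y = Q.t^[k] x}.Finite := by
  obtain ⟨_, P, hP, he⟩ := hx
  refine ((Finset.range P).finite_toSet.image (fun k => Q.t^[k] x)).subset ?_
  rintro y ⟨k, rfl⟩
  refine ⟨k % P, by simpa using Nat.mod_lt k hP, ?_⟩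
  conv_rhs => rw [← Nat.mod_add_div k P, Function.iterate_add_apply, mul_comm, iter_mul_fix he]

variable (Q) in
noncomputable def dist (x y : V) : ℕ := sInf {n | y ∈ Q.lev x n}

theorem dist_mem {x y : V} (hx : Q.Per x) (h : ∃ n, y ∈ Q.lev x n) : y ∈ Q.lev x (Q.dist x y) :=
  Nat.sInf_mem (s := {n | y ∈ Q.lev x n}) h

theorem dist_le {x y : V} {n : ℕ} (h : y ∈ Q.lev x n) : Q.dist x y ≤ n :=
  Nat.sInf_le (s := {n | y ∈ Q.lev x n}) h

theorem dist_t {x y : V} (hx : Q.Per x) (hy : y ∈ Q.Sl) : Q.dist x (Q.t y) = Q.dist x y := by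
  unfold dist
  congr 1
  ext n
  exact ⟨fun h => lev_of_t hx hy h, fun h => lev_t hx h⟩

theorem exists_ray {x : V} (hx : Q.Per x) (hinf : {y | Q.Conn x y}.Infinite) :
    ∃ r : ℕ → V, (∃ k, r 0 = Q.t^[k] x) ∧ (∀ i, Q.Per (r i)) ∧ (∀ i, Q.arr (r (i+1)) (r i)) ∧
      ∀ i, r (i+2) ≠ Q.t (r i) := by
  have hreach : ∀ n y, y ∈ Q.lev x n → Q.dist x y = n → ∃ z ∈ Q.lev x 0,
      Relation.ReflTransGen (fun a b => Q.arr b a ∧ Q.Per b ∧ Q.dist x b = Q.dist x a + 1) z y := by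
    intro n
    induction n with
    | zero => intro y hy _; exact ⟨y, hy, Relation.ReflTransGen.refl⟩
    | succ n ih =>
      rintro y ⟨hy, w, hw, ha⟩ hd
      have hdw : Q.dist x w = n := by
        have h1 := dist_le hw
        have h2 := dist_mem hx ⟨n, hw⟩
        have h3 : y ∈ Q.lev x (Q.dist x w + 1) := ⟨hy, w, h2, ha⟩
        have := dist_le h3
        omega
      obtain ⟨z, hz, hzw⟩ := ih w hw hdw
      exact ⟨z, hz, hzw.tail ⟨ha, hy, by omega⟩⟩
  obtain ⟨r, hr0, hr⟩ := konig (fun a b => Q.arr b a ∧ Q.Per b ∧ Q.dist x b = Q.dist x a + 1)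
    (fun z => (Q.pred_fin z).subset (fun y h => h.1)) (Q.lev x 0) (orbit_finite hx)
    (hinf.mono (fun y hy => hreach _ y (dist_mem hx (lev_conn hx hy)) rfl))
  have hper : ∀ i, Q.Per (r i) := by
    intro i
    cases i with
    | zero => exact lev_per hx hr0
    | succ i => exact (hr i).2.1
  refine ⟨r, hr0, hper, fun i => (hr i).1, fun i he => ?_⟩
  have h1 := (hr i).2.2
  have h2 := (hr (i+1)).2.2
  rw [he, dist_t hx (hper i).1] at h2
  omega

theorem closed_univ {S : Set V} (h : ∀ x ∈ S, ∀ e, Q.arr e x → e ∈ S) {x : V} (hx : x ∈ S) (y : V) : y ∈ S := by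
  have := Q.conn y x
  induction this using Relation.TransGen.head_induction_on with
  | single h1 => exact h _ hx _ h1
  | head h1 _ ih => exact h _ ih _ h1

theorem all_per_R (h : ∀ x, Q.Per x) : Q.L = ∅ ∧ Q.R = ∅ := by
  constructor
  · ext x; simpa using (h x).1 0
  · ext x
    simp only [Set.mem_empty_iff_false, iff_false]
    obtain ⟨hS, P, hP, he⟩ := h x
    obtain ⟨P, rfl⟩ : ∃ P', P = P' + 1 := ⟨P-1, by omega⟩
    rw [Function.iterate_succ_apply'] at he
    rw [← he]
    exact Q.t_mem _ (hS P)

theorem no_ray (v : Val Q) (r : ℕ → V) (hper : ∀ i, Q.Per (r i)) (harr : ∀ i, Q.arr (r (i+1)) (r i))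
    (hne : ∀ i, r (i+2) ≠ Q.t (r i)) (hbad : 3 ≤ (Q.mesh (r 0)).card)
    (hS : ∀ k e, Q.arr e (Q.t^[k] (r 0)) → e ∈ Q.Sl) : False := by
  classical
  set a : ℕ → ℚ := fun i => Q.avg (r i) with ha
  have hpos : ∀ i, 0 < a i := fun i => avg_pos (hper i)
  have hSl : ∀ i, r i ∈ Q.Sl := fun i => (hper i).1
  have hmesh1 : ∀ i, ∀ k, ({r (i+2), Q.t (r i)} : Multiset V).map (Q.t^[k]) ≤ Q.mesh (Q.t^[k] (r (i+1))) := by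
    intro i k
    have : ({r (i+2), Q.t (r i)} : Multiset V).map (Q.t^[k]) =
      {Q.t^[k] (r (i+2)), Q.t^[k] (Q.t (r i))} := by simp
    rw [this]
    apply two_le
    · intro he
      exact hne i (iter_inj (hSl _) (sl_t (hSl _)) k he)
    · exact (Q.arr_mesh _ (hSl _ k) _).1 (arr_iter (hSl _) (hSl _) (harr _) k)
    · exact (Q.arr_mesh _ (hSl _ k) _).1 (arr_iter (sl_t (hSl _)) (hSl _) (arr_t (hSl i 0) (harr i)) k)
  have hm1 : ∀ i, ∀ e ∈ ({r (i+2), Q.t (r i)} : Multiset V), Q.Per e := by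
    intro i e he
    simp only [Multiset.insert_eq_cons, Multiset.mem_cons, Multiset.mem_singleton] at he
    rcases he with rfl | rfl
    · exact hper _
    · exact (per_t_iff (hSl i)).1 (hper i)
  have hs1 : ∀ i, (({r (i+2), Q.t (r i)} : Multiset V).map Q.avg).sum = a (i+2) + a i := by
    intro i; simp [ha, avg_t (hper i)]
  have hconc : ∀ i, a (i+2) + a i ≤ 2 * a (i+1) := by
    intro i
    have := (avg_mesh (hper (i+1)) _ (hm1 i) (hmesh1 i)).1
    rwa [hs1] at this
  have hmono := concave_mono a hpos hconc
  have hr1 : r 1 ∈ Q.mesh (r 0) := (Q.arr_mesh _ (hSl 0 0) _).1 (harr 0)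
  obtain ⟨m', hm'⟩ := Multiset.exists_cons_of_mem hr1
  have hpm : ∀ e ∈ Q.mesh (r 0), Q.Per e := fun e he =>
    have h := (Q.arr_mesh _ (hSl 0 0) _).2 he
    (per_arr_iff (hS 0 e h) (hSl 0) h).2 (hper 0)
  have hmi := v.mesh_iter (hper 0) hS
  have hsum := (avg_mesh (hper 0) (Q.mesh (r 0)) hpm (fun k => (hmi k).ge)).1
  have hle2 : ∀ e ∈ Q.mesh (r 0), ∀ k, ({Q.t (r 0)} : Multiset V).map (Q.t^[k]) ≤ Q.mesh (Q.t^[k] e) := by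
    intro e he k
    have h := (Q.arr_mesh _ (hSl 0 0) _).2 he
    simp only [Multiset.map_singleton, Multiset.singleton_le]
    exact (Q.arr_mesh _ ((hpm e he).1 k) _).1
      (arr_iter (sl_t (hSl 0)) (hpm e he).1 (arr_t (hSl 0 0) h) k)
  have hone : ∀ e ∈ ({Q.t (r 0)} : Multiset V), Q.Per e := by
    intro e he
    rw [Multiset.mem_singleton] at he
    rw [he]; exact (per_t_iff (hSl 0)).1 (hper 0)
  have hle3 : ∀ e ∈ Q.mesh (r 0), a 0 ≤ 2 * Q.avg e := by
    intro e he
    have := (avg_mesh (hpm e he) _ hone (hle2 e he)).1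
    simpa [ha, avg_t (hper 0)] using this
  rw [hm'] at hsum hbad
  have hm'mem : ∀ e ∈ m', e ∈ Q.mesh (r 0) := fun e he => by rw [hm']; exact Multiset.mem_cons_of_mem he
  simp only [Multiset.map_cons, Multiset.sum_cons, Multiset.card_cons] at hsum hbad
  have hm'pos : ∀ m'' : Multiset V, (∀ e ∈ m'', e ∈ Q.mesh (r 0)) →
      (m''.card : ℚ) * (a 0 / 2) ≤ (m''.map Q.avg).sum := by
    intro m'' h
    have := Multiset.card_nsmul_le_sum (s := m''.map Q.avg) (a := a 0 / 2) (by
      intro x hx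
      obtain ⟨e, he, rfl⟩ := Multiset.mem_map.1 hx
      have := hle3 e (h e he); linarith)
    simpa using this
  have hc2 : (2:ℚ) ≤ m'.card := by exact_mod_cast (by omega : 2 ≤ m'.card)
  have hb := hm'pos m' hm'mem
  have h0 := hpos 0
  have h01 := hmono 0
  have hsum' : a 1 + (m'.map Q.avg).sum ≤ 2 * a 0 := hsum
  have ha1 : a 1 = a 0 := by nlinarith
  have hai : ∀ i, a (i+1) = a i := by
    intro i
    induction i with
    | zero => exact ha1
    | succ i ih =>
      have := hconc i
      have := hmono (i+1)
      linarith
  have hai0 : ∀ i, a i = a 0 := by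
    intro i
    induction i with
    | zero => rfl
    | succ i ih => rw [hai, ih]
  have hme : ∀ e ∈ m', Q.avg e = a 0 / 2 := by
    intro e he
    obtain ⟨m'', rfl⟩ := Multiset.exists_cons_of_mem he
    have h1 := hm'pos m'' (fun e he => hm'mem e (Multiset.mem_cons_of_mem he))
    have h2 := hle3 e (hm'mem e he)
    simp only [Multiset.map_cons, Multiset.sum_cons, Multiset.card_cons, Nat.cast_add, Nat.cast_one] at hsum' hc2
    nlinarith
  have heq1 : ∀ i k, ({r (i+2), Q.t (r i)} : Multiset V).map (Q.t^[k]) = Q.mesh (Q.t^[k] (r (i+1))) := by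
    intro i
    refine (avg_mesh (hper (i+1)) _ (hm1 i) (hmesh1 i)).2 ?_
    rw [hs1]
    show a (i+2) + a i = 2 * a (i+1)
    rw [hai0 (i+2), hai0 i, hai0 (i+1)]; ring
  have heq2 : ∀ e ∈ m', ∀ k, ({Q.t (r 0)} : Multiset V).map (Q.t^[k]) = Q.mesh (Q.t^[k] e) := by
    intro e he
    refine (avg_mesh (hpm e (hm'mem e he)) _ hone (hle2 e (hm'mem e he))).2 ?_
    rw [hme e he]
    simp [ha, avg_t (hper 0)]; ring
  set S : Set V := {y | (∃ i k, y = Q.t^[k] (r i)) ∨ ∃ e ∈ m', ∃ k, y = Q.t^[k] e} with hSdef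
  have hclosed : ∀ x ∈ S, ∀ e, Q.arr e x → e ∈ S := by
    rintro x (⟨i, k, rfl⟩ | ⟨e', he', k, rfl⟩) e hea
    · have h1 := (Q.arr_mesh _ (hSl i k) _).1 hea
      cases i with
      | zero =>
        rw [hmi k, hm'] at h1
        simp only [Multiset.map_cons, Multiset.mem_cons, Multiset.mem_map] at h1
        rcases h1 with rfl | ⟨e', he', rfl⟩
        · exact Or.inl ⟨1, k, rfl⟩
        · exact Or.inr ⟨e', he', k, rfl⟩
      | succ i =>
        rw [← heq1] at h1
        simp only [Multiset.insert_eq_cons, Multiset.map_cons, Multiset.map_singleton,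
          Multiset.mem_cons, Multiset.mem_singleton] at h1
        rcases h1 with rfl | rfl
        · exact Or.inl ⟨_, k, rfl⟩
        · exact Or.inl ⟨i, k+1, by rw [Function.iterate_succ_apply]⟩
    · have h1 := (Q.arr_mesh _ ((hpm e' (hm'mem e' he')).1 k) _).1 hea
      rw [← heq2 e' he'] at h1
      simp only [Multiset.map_singleton, Multiset.mem_singleton] at h1
      exact Or.inl ⟨0, k+1, by rw [h1, Function.iterate_succ_apply]⟩
  have huniv := closed_univ hclosed (Or.inl ⟨0, 0, rfl⟩ : r 0 ∈ S)
  have hallper : ∀ x, Q.Per x := by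
    intro x
    rcases huniv x with ⟨i, k, rfl⟩ | ⟨e', he', k, rfl⟩
    · exact (per_iter_iff (hSl i) k).1 (hper i)
    · have := hpm e' (hm'mem e' he')
      exact (per_iter_iff this.1 k).1 this
  obtain ⟨hL, hR⟩ := all_per_R hallper
  obtain ⟨P, hP, hfix⟩ := common_period (Q := Q) (r 0 ::ₘ Q.mesh (r 0)) (fun e _ => hallper e)
  have hfr : ∀ i, Q.t^[P] (r i) = r i ∧ Q.t^[P] (r (i+1)) = r (i+1) := by
    intro i
    induction i with
    | zero =>
      exact ⟨hfix _ (Multiset.mem_cons_self _ _), hfix _ (Multiset.mem_cons_of_mem hr1)⟩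
    | succ i ih =>
      refine ⟨ih.2, ?_⟩
      have h1 := arr_iter (hSl (i+2)) (hSl (i+1)) (harr (i+1)) P
      rw [ih.2] at h1
      have h2 := (Q.arr_mesh _ (hSl (i+1) 0) _).1 h1
      have h3 := heq1 i 0
      simp only [Function.iterate_zero, Multiset.map_id, id] at h3
      rw [show Q.t^[0] (r (i+1)) = r (i+1) from rfl, ← h3] at h2
      simp only [Multiset.insert_eq_cons, Multiset.mem_cons, Multiset.mem_singleton] at h2
      rcases h2 with h2 | h2
      · exact h2
      · exfalso
        apply hne i
        apply iter_inj (hSl (i+2)) (sl_t (hSl i)) P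
        rw [h2, ← Function.iterate_succ_apply, Function.iterate_succ_apply', ih.1]
  have hfixk : ∀ x k, Q.t^[P] x = x → Q.t^[P] (Q.t^[k] x) = Q.t^[k] x := by
    intro x k h
    rw [← Function.iterate_add_apply, Nat.add_comm, Function.iterate_add_apply, h]
  have hfixall : ∀ x, Q.t^[P] x = x := by
    intro x
    rcases huniv x with ⟨i, k, rfl⟩ | ⟨e', he', k, rfl⟩
    · exact hfixk _ _ (hfr i).1
    · exact hfixk _ _ (hfix _ (Multiset.mem_cons_of_mem (hm'mem e' he')))
  have havg : ∀ x, Q.avg x ≤ a 0 := by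
    intro x
    rcases huniv x with ⟨i, k, rfl⟩ | ⟨e', he', k, rfl⟩
    · rw [avg_iter (hper i)]; exact (hai0 i).le
    · rw [avg_iter (hallper e'), hme e' he']; linarith
  have hlen : ∀ x, (Q.len x : ℚ) ≤ P * a 0 := by
    intro x
    have h1 := avg_eq hP (hfixall x)
    have h2 : (Q.len x : ℚ) ≤ ∑ k ∈ Finset.range P, (Q.len (Q.t^[k] x) : ℚ) := by
      have := Finset.single_le_sum (f := fun k => (Q.len (Q.t^[k] x) : ℚ)) (s := Finset.range P)
        (fun i _ => by positivity) (Finset.mem_range.2 hP)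
      simpa using this
    have hP' : (0:ℚ) < P := by exact_mod_cast hP
    have h3 := mul_le_mul_of_nonneg_left (havg x) hP'.le
    linarith
  obtain ⟨N, hN⟩ := exists_nat_gt ((P:ℚ) * a 0)
  obtain ⟨x, hx⟩ := v.unb hL hR N
  have := hlen x
  have hx' : (N:ℚ) < Q.len x := by exact_mod_cast hx
  linarith

/-- either the orbit of `x` meets `Bset`, or its class is finite and meets `Bset` -/
theorem per_bad (v : Val Q) {x : V} (hx : Q.Per x) (hb : Q.bad x) :
    (∃ z ∈ Q.Bset, Q.Per z ∧ ∃ k, x = Q.t^[k] z) ∨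
    (∃ z ∈ Q.Bset, {y | Q.Conn z y}.Finite ∧ Q.Conn z x) := by
  by_cases hA : ∃ k, Q.t^[k] x ∈ Q.Bset
  · left
    obtain ⟨k, hk⟩ := hA
    obtain ⟨hS, P, hP, he⟩ := hx
    refine ⟨_, hk, (per_iter_iff hS k).1 ⟨hS, P, hP, he⟩, k * P - k, ?_⟩
    rw [← Function.iterate_add_apply, Nat.sub_add_cancel (Nat.le_mul_of_pos_right k hP), iter_mul_fix he]
  · right
    have hS : ∀ k e, Q.arr e (Q.t^[k] x) → e ∈ Q.Sl := by
      intro k e h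
      by_contra he
      obtain ⟨j, hj⟩ := shift_to_L he (sl_iter hx.1 k) h
      rw [← Function.iterate_add_apply] at hj
      exact hA ⟨_, hj⟩
    by_cases hfin : {y | Q.Conn x y}.Finite
    · by_cases hz : ∃ z ∈ Q.Bset, Q.Conn x z
      · obtain ⟨z, hz, hxz⟩ := hz
        refine ⟨z, hz, hfin.subset (fun y hy => hxz.trans _ _ _ hy), hxz.symm _ _⟩
      · exfalso
        push Not at hz
        have hper : ∀ y, Q.Conn x y → Q.Per y := fun y hy => (per_conn_iff hy).1 hx
        have hcl : ∀ y ∈ {y | Q.Conn x y}, ∀ e, Q.arr e y → e ∈ {y | Q.Conn x y} := by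
          intro y hy e he
          have hyS := (hper y hy).1
          have heS : e ∈ Q.Sl := by
            by_contra hc
            obtain ⟨j, hj⟩ := shift_to_L hc hyS he
            exact hz _ hj (Relation.EqvGen.trans _ _ _ hy (Conn.iter hyS j))
          exact Relation.EqvGen.trans _ _ _ hy ((Conn.arr heS hyS he).symm _ _)
        have huniv := closed_univ hcl (Relation.EqvGen.refl x : x ∈ {y | Q.Conn x y})
        obtain ⟨hL, hR⟩ := all_per_R (fun y => hper y (huniv y))
        obtain ⟨N, hN⟩ := (hfin.image Q.len).bddAbove
        obtain ⟨y, hy⟩ := v.unb hL hR N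
        have := hN ⟨y, huniv y, rfl⟩
        omega
    · exfalso
      obtain ⟨r, ⟨k, hr0⟩, h1, h2, h3⟩ := exists_ray hx hfin
      refine no_ray v r h1 h2 h3 ?_ ?_
      · rw [hr0, v.mesh_iter hx hS, Multiset.card_map]; exact hb.2
      · intro j e he
        rw [hr0, ← Function.iterate_add_apply] at he
        exact hS _ e he

theorem main (v : Val Q) : {x | Q.bad x}.Finite ∧ (Q.L = ∅ → Q.R = ∅ → ∀ x, ¬ Q.bad x) := by
  constructor
  · have h1 : {x | Q.bad x ∧ Q.Per x}.Finite := by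
      have f1 : (⋃ z ∈ Q.Bset, {x | Q.Per z ∧ ∃ k, x = Q.t^[k] z}).Finite := by
        refine Q.Bset_finite.biUnion fun z _ => ?_
        by_cases hz : Q.Per z
        · exact (orbit_finite hz).subset (fun x h => h.2)
        · exact Set.finite_empty.subset (fun x h => hz h.1)
      have f2 : (⋃ z ∈ Q.Bset, {x | {y | Q.Conn z y}.Finite ∧ Q.Conn z x}).Finite := by
        refine Q.Bset_finite.biUnion fun z _ => ?_
        by_cases hz : {y | Q.Conn z y}.Finite
        · exact hz.subset (fun x h => h.2)
        · exact Set.finite_empty.subset (fun x h => hz h.1)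
      refine (f1.union f2).subset ?_
      rintro x ⟨hb, hp⟩
      rcases per_bad v hp hb with ⟨z, hz, h⟩ | ⟨z, hz, h⟩
      · left; simp only [Set.mem_iUnion]; exact ⟨z, hz, h⟩
      · right; simp only [Set.mem_iUnion]; exact ⟨z, hz, h⟩
    refine (h1.union (bad_nonper_finite' (Q := Q))).subset ?_
    intro x hx
    by_cases hp : Q.Per x
    · exact Or.inl ⟨hx, hp⟩
    · exact Or.inr ⟨hx, hp⟩
  · intro hL hR x hb
    by_cases hp : Q.Per x
    · rcases per_bad v hp hb with ⟨z, hz, _⟩ | ⟨z, hz, _⟩ <;>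
      · obtain ⟨_, l, hl, _⟩ := hz
        rw [hL] at hl
        exact hl
    · exact stable_nonper hL hR hp hb

end TQ
end CF
end

section
namespace CF

section len
variable (R : Type*) [Ring R] (M : Type*) [AddCommGroup M] [Module R M]
variable {N P : Type*} [AddCommGroup N] [AddCommGroup P] [Module R N] [Module R P]

noncomputable def ln : ℕ := (Module.length R M).toNat

variable {R M}
theorem ln_coe [IsNoetherian R M] [IsArtinian R M] : (ln R M : ℕ∞) = Module.length R M :=
  ENat.natCast_toNat Module.length_ne_top

theorem ln_exact [IsNoetherian R M] [IsArtinian R M] (f : N →ₗ[R] M) (g : M →ₗ[R] P)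
    (hf : Function.Injective f) (hg : Function.Surjective g) (H : LinearMap.range f = LinearMap.ker g) :
    ln R M = ln R N + ln R P := by
  have : IsNoetherian R N := isNoetherian_of_injective f hf
  have : IsArtinian R N := isArtinian_of_injective f hf
  have : IsNoetherian R P := isNoetherian_of_surjective g (LinearMap.range_eq_top.2 hg)
  have : IsArtinian R P := isArtinian_of_surjective M g hg
  have h := Module.length_eq_add_of_exact f g hf hg (LinearMap.exact_iff.2 H.symm)
  rw [← ln_coe, ← ln_coe, ← ln_coe] at h
  exact_mod_cast h

theorem ln_equiv (e : M ≃ₗ[R] N) : ln R M = ln R N := by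
  unfold ln; rw [e.length_eq]

theorem ln_inj [IsNoetherian R M] [IsArtinian R M] (f : N →ₗ[R] M) (hf : Function.Injective f) :
    ln R N ≤ ln R M := by
  have h := ln_exact f (LinearMap.range f).mkQ hf (Submodule.mkQ_surjective _) (by simp)
  omega

theorem ln_surj [IsNoetherian R M] [IsArtinian R M] (f : M →ₗ[R] N) (hf : Function.Surjective f) :
    ln R N ≤ ln R M := by
  have h := ln_exact (LinearMap.ker f).subtype f (Submodule.subtype_injective _) hf (by simp)
  omega

theorem ln_sub_lt [IsNoetherian R M] [IsArtinian R M] {S : Submodule R M} (h : S ≠ ⊤) : ln R S < ln R M := by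
  have := Submodule.length_lt h
  rw [← ln_coe, ← ln_coe] at this
  exact_mod_cast this

theorem ln_zero_iff [IsNoetherian R M] [IsArtinian R M] : ln R M = 0 ↔ Subsingleton M := by
  rw [← Module.length_eq_zero_iff (R := R), ← ln_coe]; simp

theorem ln_pos [IsNoetherian R M] [IsArtinian R M] [Nontrivial M] : 0 < ln R M := by
  rw [Nat.pos_iff_ne_zero, Ne, ln_zero_iff]; exact not_subsingleton M

theorem ln_ker [IsNoetherian R M] [IsArtinian R M] (f : M →ₗ[R] N) :
    ln R M = ln R (LinearMap.ker f) + ln R (LinearMap.range f) := by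
  refine ln_exact (LinearMap.ker f).subtype f.rangeRestrict (Submodule.subtype_injective _)
    (LinearMap.surjective_rangeRestrict f) (by simp)

theorem ln_prod [IsNoetherian R M] [IsArtinian R M] [IsNoetherian R N] [IsArtinian R N] :
    ln R (M × N) = ln R M + ln R N := by
  have h := Module.length_prod R M N
  rw [← ln_coe, ← ln_coe, ← ln_coe] at h
  exact_mod_cast h

theorem ln_pi {ι : Type*} [Fintype ι] {F : ι → Type*} [∀ i, AddCommGroup (F i)] [∀ i, Module R (F i)]
    [∀ i, IsNoetherian R (F i)] [∀ i, IsArtinian R (F i)] : ln R (∀ i, F i) = ∑ i, ln R (F i) := by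
  have h := Module.length_pi_of_fintype (R := R) F
  rw [← ln_coe] at h
  simp only [← ln_coe] at h
  exact_mod_cast h

theorem bij_of_inj_ln [IsNoetherian R M] [IsArtinian R M] [IsNoetherian R N] [IsArtinian R N]
    (f : M →ₗ[R] N) (hf : Function.Injective f) (h : ln R N ≤ ln R M) : Function.Bijective f := by
  refine ⟨hf, ?_⟩
  rw [← LinearMap.range_eq_top]
  by_contra hc
  have h1 := ln_sub_lt hc
  have h2 := ln_equiv (LinearEquiv.ofInjective f hf)
  omega

theorem bij_of_surj_ln [IsNoetherian R M] [IsArtinian R M] [IsNoetherian R N] [IsArtinian R N]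
    (f : M →ₗ[R] N) (hf : Function.Surjective f) (h : ln R M ≤ ln R N) : Function.Bijective f := by
  refine ⟨?_, hf⟩
  rw [← LinearMap.ker_eq_bot, ← Submodule.subsingleton_iff_eq_bot, ← ln_zero_iff (R := R)]
  have h1 := ln_ker f
  have h2 := ln_equiv (LinearEquiv.ofTop (LinearMap.range f) (LinearMap.range_eq_top.2 hf))
  omega

end len

section indec
variable {R : Type u} [Ring R] {X Y : Type u} [AddCommGroup X] [Module R X] [AddCommGroup Y] [Module R Y]

/-- idempotent from complementary submodules, via two-sided inverse pairs -/
theorem indec_compl (hX : IsIndecMod R X) {p q : Submodule R X} (h : IsCompl p q) : p = ⊥ ∨ q = ⊥ := by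
  rcases hX.2 (p.projection q h) (by
    ext x
    exact Submodule.projection_apply_of_mem_left h (Submodule.projection_apply_mem h x)) with h0 | h1
  · left
    rw [eq_bot_iff]
    intro x hx
    have := Submodule.projection_apply_of_mem_left h hx
    rw [h0] at this
    simpa using this.symm
  · right
    rw [eq_bot_iff]
    intro x hx
    have := (Submodule.projection_apply_eq_zero_iff h).2 hx
    rw [h1] at this
    simpa using this

theorem fitting [IsNoetherian R X] [IsArtinian R X] (hX : IsIndecMod R X) (f : Module.End R X) :
    Function.Bijective f ∨ IsNilpotent f := by
  obtain ⟨n, hn⟩ := Filter.eventually_atTop.1 f.eventually_isCompl_ker_pow_range_pow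
  have h := hn (n+1) (by omega)
  rcases indec_compl hX h with h | h
  · left
    have hi : Function.Injective f := by
      rw [LinearMap.ker_eq_bot] at h
      intro x y hxy
      apply h
      rw [pow_succ]; simp [hxy]
    exact bij_of_inj_ln f hi le_rfl
  · right
    exact ⟨n+1, LinearMap.range_eq_bot.1 h⟩

theorem nilp_not_bij [Nontrivial X] {f : Module.End R X} (h : IsNilpotent f) : ¬ Function.Bijective f := by
  intro hb
  exact h.not_isUnit ((Module.End.isUnit_iff f).2 hb)

theorem bij_add [IsNoetherian R X] [IsArtinian R X] (hX : IsIndecMod R X) {f g : Module.End R X}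
    (h : Function.Bijective (f + g)) : Function.Bijective f ∨ Function.Bijective g := by
  by_contra hc
  push Not at hc
  obtain ⟨hf, hg⟩ := hc
  obtain ⟨u, hu⟩ := (Module.End.isUnit_iff _).2 h
  have h1 : (↑u⁻¹ * f : Module.End R X) + ↑u⁻¹ * g = 1 := by
    rw [← mul_add, ← hu]; simp
  have hnf : ¬ Function.Bijective (↑u⁻¹ * f : Module.End R X) := by
    intro hb
    apply hf
    rw [← Module.End.isUnit_iff] at hb ⊢
    simpa using hb
  have hn : IsNilpotent (↑u⁻¹ * f : Module.End R X) := (fitting hX _).resolve_left hnf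
  apply hg
  rw [← Module.End.isUnit_iff]
  have : (↑u⁻¹ * g : Module.End R X) = 1 - ↑u⁻¹ * f := by rw [← h1]; simp
  have h2 : IsUnit (↑u⁻¹ * g : Module.End R X) := by rw [this]; exact hn.isUnit_one_sub
  simpa using h2

theorem bij_sum [IsNoetherian R X] [IsArtinian R X] (hX : IsIndecMod R X) {ι : Type*} (s : Finset ι)
    (f : ι → Module.End R X) (h : Function.Bijective (∑ i ∈ s, f i : Module.End R X)) : ∃ i ∈ s, Function.Bijective (f i) := by
  classical
  induction s using Finset.induction_on with
  | empty =>
    have := hX.1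
    simp only [Finset.sum_empty] at h
    obtain ⟨x, y, hxy⟩ := this
    exact absurd (h.1 (by simp : (0 : Module.End R X) x = (0 : Module.End R X) y)) hxy
  | insert a s ha ih =>
    rw [Finset.sum_insert ha] at h
    rcases bij_add hX h with h | h
    · exact ⟨a, Finset.mem_insert_self _ _, h⟩
    · obtain ⟨i, hi, h⟩ := ih h
      exact ⟨i, Finset.mem_insert_of_mem hi, h⟩

theorem bij_comp_indec (hY : IsIndecMod R Y) (hX : Nontrivial X) {g : X →ₗ[R] Y} {f : Y →ₗ[R] X}
    (h : Function.Bijective (f ∘ₗ g)) : Function.Bijective f ∧ Function.Bijective g := by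
  let e := LinearEquiv.ofBijective _ h
  have he : ∀ x, e.symm (f (g x)) = x := fun x => e.symm_apply_apply x
  rcases hY.2 (g ∘ₗ e.symm.toLinearMap ∘ₗ f) (by
    ext y
    show g (e.symm (f (g (e.symm (f y))))) = g (e.symm (f y))
    rw [he]) with h0 | h1
  · exfalso
    obtain ⟨x, hx⟩ := exists_ne (0 : X)
    have h2 : g (e.symm (f (g x))) = 0 := LinearMap.congr_fun h0 (g x)
    rw [he] at h2
    apply hx
    apply h.1
    simp [h2]
  · have hg : Function.Injective g := Function.Injective.of_comp h.1
    have hgs : Function.Surjective g := by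
      intro y
      exact ⟨e.symm (f y), LinearMap.congr_fun h1 y⟩
    have hgb : Function.Bijective g := ⟨hg, hgs⟩
    exact ⟨(Function.Bijective.of_comp_iff f hgb).1 h, hgb⟩

theorem indec_equiv (e : X ≃ₗ[R] Y) (hX : IsIndecMod R X) : IsIndecMod R Y := by
  refine ⟨e.symm.toEquiv.nontrivial_congr.2 hX.1, fun f hf => ?_⟩
  rcases hX.2 (e.symm.toLinearMap ∘ₗ f ∘ₗ e.toLinearMap) (by
    ext x
    have : ∀ y, f (f y) = f y := fun y => LinearMap.congr_fun hf y
    show e.symm (f (e (e.symm (f (e x))))) = e.symm (f (e x))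
    simp [this]) with h | h
  · left
    ext y
    have : e.symm (f (e (e.symm y))) = 0 := LinearMap.congr_fun h (e.symm y)
    simpa using this
  · right
    ext y
    have : e.symm (f (e (e.symm y))) = e.symm y := LinearMap.congr_fun h (e.symm y)
    simpa using this

end indec
end CF
end

section
namespace CF

section modA
variable {R : Type u} [Ring R]

instance instNoeth (X : ModA R) : IsNoetherian R X.M :=
  (isFiniteLength_iff_isNoetherian_isArtinian.1 X.finLen).1
instance instArt (X : ModA R) : IsArtinian R X.M :=
  (isFiniteLength_iff_isNoetherian_isArtinian.1 X.finLen).2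

variable (R) in
/-- bundling -/
abbrev bun (M : Type u) [AddCommGroup M] [Module R M] [IsNoetherian R M] [IsArtinian R M] : ModA R :=
  ⟨M, isFiniteLength_iff_isNoetherian_isArtinian.2 ⟨inferInstance, inferInstance⟩⟩

abbrev Hm (X Y : ModA R) := X.M →ₗ[R] Y.M

variable {X Y Z W : ModA R}

theorem inRad_add {f g : Hm X Y} (hf : InRad f) (hg : InRad g) : InRad (f + g) := by
  intro Z hZ a b h
  have : b.comp ((f + g).comp a) = (b.comp (f.comp a) : Module.End R Z.M) + b.comp (g.comp a) := by
    ext x; simp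
  rw [this] at h
  rcases bij_add hZ h with h | h
  · exact hf Z hZ a b h
  · exact hg Z hZ a b h

theorem inRad_zero : InRad (0 : Hm X Y) := by
  intro Z hZ a b h
  obtain ⟨x, y, hxy⟩ := hZ.1
  exact hxy (h.1 (by simp))

theorem inRad_comp_left {f : Hm X Y} (hf : InRad f) (k : Hm Y Z) : InRad (X := X) (Y := Z) (k ∘ₗ f) := by
  intro W hW a b h
  exact hf W hW a (b ∘ₗ k) h

theorem inRad_comp_right {f : Hm X Y} (hf : InRad f) (k : Hm Z X) : InRad (X := Z) (Y := Y) (f ∘ₗ k) := by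
  intro W hW a b h
  exact hf W hW (k ∘ₗ a) b h

theorem inRad_neg {f : Hm X Y} (hf : InRad f) : InRad (-f) := by
  have := inRad_comp_left hf (-LinearMap.id : Hm Y Y)
  convert this using 1
  ext x; simp

theorem inRad_sub {f g : Hm X Y} (hf : InRad f) (hg : InRad g) : InRad (f - g) := by
  rw [sub_eq_add_neg]; exact inRad_add hf (inRad_neg hg)

theorem inRad_sum {ι : Type*} (s : Finset ι) (f : ι → Hm X Y) (h : ∀ i ∈ s, InRad (f i)) :
    InRad (∑ i ∈ s, f i : Hm X Y) := by
  classical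
  induction s using Finset.induction_on with
  | empty => rw [Finset.sum_empty]; exact inRad_zero
  | insert a s ha ih =>
    rw [Finset.sum_insert ha]
    exact inRad_add (h a (Finset.mem_insert_self _ _))
      (ih fun i hi => h i (Finset.mem_insert_of_mem hi))

theorem bij_inv {f : Hm X Y} (h : Function.Bijective f) : ∃ g : Hm Y X, g ∘ₗ f = LinearMap.id ∧ f ∘ₗ g = LinearMap.id :=
  ⟨(LinearEquiv.ofBijective f h).symm.toLinearMap, by ext x; simp, by
    ext x; exact (LinearEquiv.ofBijective f h).apply_symm_apply x⟩

theorem bij_id : Function.Bijective (LinearMap.id : Hm X X) := Function.bijective_id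

theorem inRad_iff_nbij (hX : X.IsIndec) (hY : Y.IsIndec) {f : Hm X Y} :
    InRad f ↔ ¬ Function.Bijective f := by
  constructor
  · intro h hb
    obtain ⟨g, hg, -⟩ := bij_inv hb
    apply h X hX LinearMap.id g
    show Function.Bijective (g ∘ₗ f)
    rw [hg]; exact bij_id
  · intro h Z hZ a b hb
    have h1 : Function.Bijective ((b ∘ₗ f) ∘ₗ a) := hb
    have := hZ.1
    have := hX.1
    obtain ⟨h2, h3⟩ := bij_comp_indec hX hZ.1 h1
    have h4 : Function.Bijective (b ∘ₗ (f ∘ₗ a)) := hb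
    obtain ⟨h5, h6⟩ := bij_comp_indec hY hZ.1 h4
    apply h
    have : Function.Bijective (f ∘ a) := h6
    exact (Function.Bijective.of_comp_iff f h3).1 this

theorem inRad_iff_epi (hY : Y.IsIndec) {f : Hm X Y} : InRad f ↔ ¬ SplitEpiMap f := by
  constructor
  · rintro h ⟨s, hs⟩
    apply h Y hY s LinearMap.id
    show Function.Bijective (f ∘ₗ s)
    rw [hs]; exact bij_id
  · intro h Z hZ a b hb
    have h4 : Function.Bijective (b ∘ₗ (f ∘ₗ a)) := hb
    obtain ⟨h5, h6⟩ := bij_comp_indec hY hZ.1 h4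
    obtain ⟨g, -, hg⟩ := bij_inv (X := Z) (Y := Y) h6
    exact h ⟨a ∘ₗ g, hg⟩

theorem inRad_iff_mono (hX : X.IsIndec) {f : Hm X Y} : InRad f ↔ ¬ SplitMonoMap f := by
  constructor
  · rintro h ⟨s, hs⟩
    apply h X hX LinearMap.id s
    show Function.Bijective (s ∘ₗ f)
    rw [hs]; exact bij_id
  · intro h Z hZ a b hb
    have h4 : Function.Bijective ((b ∘ₗ f) ∘ₗ a) := hb
    obtain ⟨h5, h6⟩ := bij_comp_indec hX hZ.1 h4
    obtain ⟨g, hg, -⟩ := bij_inv (X := X) (Y := Z) h5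
    exact h ⟨g ∘ₗ b, hg⟩

theorem id_not_rad (hX : X.IsIndec) : ¬ InRad (LinearMap.id : Hm X X) := by
  rw [inRad_iff_nbij hX hX]; exact fun h => h bij_id

/-- decompositions -/
structure Dec (X : ModA R) where
  ι : Type
  [fin : Fintype ι]
  N : ι → ModA R
  indec : ∀ i, (N i).IsIndec
  inc : ∀ i, Hm (N i) X
  prj : ∀ i, Hm X (N i)
  pi_self : ∀ i, prj i ∘ₗ inc i = LinearMap.id
  pi_ne : ∀ i j, i ≠ j → prj i ∘ₗ inc j = 0
  sum : ∑ i, inc i ∘ₗ prj i = LinearMap.id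

attribute [instance] Dec.fin

def Dec.glue {A B : ModA R} (dA : Dec A) (dB : Dec B) (i1 : Hm A X) (p1 : Hm X A) (i2 : Hm B X) (p2 : Hm X B)
    (h1 : p1 ∘ₗ i1 = LinearMap.id) (h2 : p2 ∘ₗ i2 = LinearMap.id) (h12 : p1 ∘ₗ i2 = 0) (h21 : p2 ∘ₗ i1 = 0)
    (hs : i1 ∘ₗ p1 + i2 ∘ₗ p2 = LinearMap.id) : Dec X where
  ι := dA.ι ⊕ dB.ι
  N := Sum.elim dA.N dB.N
  indec := by rintro (i | i); exacts [dA.indec i, dB.indec i]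
  inc := fun i => match i with
    | .inl i => i1 ∘ₗ dA.inc i
    | .inr i => i2 ∘ₗ dB.inc i
  prj := fun i => match i with
    | .inl i => dA.prj i ∘ₗ p1
    | .inr i => dB.prj i ∘ₗ p2
  pi_self := by
    rintro (i | i)
    · show (dA.prj i ∘ₗ p1) ∘ₗ (i1 ∘ₗ dA.inc i) = _
      rw [LinearMap.comp_assoc, ← LinearMap.comp_assoc (dA.inc i), h1]
      exact dA.pi_self i
    · show (dB.prj i ∘ₗ p2) ∘ₗ (i2 ∘ₗ dB.inc i) = _
      rw [LinearMap.comp_assoc, ← LinearMap.comp_assoc (dB.inc i), h2]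
      exact dB.pi_self i
  pi_ne := by
    rintro (i | i) (j | j) hij
    · show (dA.prj i ∘ₗ p1) ∘ₗ (i1 ∘ₗ dA.inc j) = _
      rw [LinearMap.comp_assoc, ← LinearMap.comp_assoc (dA.inc j), h1]
      exact dA.pi_ne i j (fun h => hij (by rw [h]))
    · show (dA.prj i ∘ₗ p1) ∘ₗ (i2 ∘ₗ dB.inc j) = _
      rw [LinearMap.comp_assoc, ← LinearMap.comp_assoc (dB.inc j), h12, LinearMap.zero_comp, LinearMap.comp_zero]; rfl
    · show (dB.prj i ∘ₗ p2) ∘ₗ (i1 ∘ₗ dA.inc j) = _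
      rw [LinearMap.comp_assoc, ← LinearMap.comp_assoc (dA.inc j), h21, LinearMap.zero_comp, LinearMap.comp_zero]; rfl
    · show (dB.prj i ∘ₗ p2) ∘ₗ (i2 ∘ₗ dB.inc j) = _
      rw [LinearMap.comp_assoc, ← LinearMap.comp_assoc (dB.inc j), h2]
      exact dB.pi_ne i j (fun h => hij (by rw [h]))
  sum := by
    rw [Fintype.sum_sum_type, ← hs]
    congr 1
    · show ∑ i, (i1 ∘ₗ dA.inc i) ∘ₗ (dA.prj i ∘ₗ p1) = _
      have : ∀ i, (i1 ∘ₗ dA.inc i) ∘ₗ (dA.prj i ∘ₗ p1) = i1 ∘ₗ (dA.inc i ∘ₗ dA.prj i) ∘ₗ p1 := fun i => rfl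
      simp only [this]
      conv_rhs => rw [← LinearMap.id_comp p1, ← dA.sum]
      ext x; simp
    · show ∑ i, (i2 ∘ₗ dB.inc i) ∘ₗ (dB.prj i ∘ₗ p2) = _
      have : ∀ i, (i2 ∘ₗ dB.inc i) ∘ₗ (dB.prj i ∘ₗ p2) = i2 ∘ₗ (dB.inc i ∘ₗ dB.prj i) ∘ₗ p2 := fun i => rfl
      simp only [this]
      conv_rhs => rw [← LinearMap.id_comp p2, ← dB.sum]
      ext x; simp

theorem Dec.nonempty (X : ModA R) : Nonempty (Dec X) := by
  classical
  induction hn : ln R X.M using Nat.strong_induction_on generalizing X with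
  | _ n ih =>
  rcases subsingleton_or_nontrivial X.M with h | h
  · exact ⟨{
      ι := Empty
      N := Empty.elim
      indec := fun i => i.elim
      inc := fun i => i.elim
      prj := fun i => i.elim
      pi_self := fun i => i.elim
      pi_ne := fun i => i.elim
      sum := by ext x; exact Subsingleton.elim _ _ }⟩
  by_cases hX : X.IsIndec
  · exact ⟨{
      ι := Unit
      N := fun _ => X
      indec := fun _ => hX
      inc := fun _ => LinearMap.id
      prj := fun _ => LinearMap.id
      pi_self := fun _ => rfl
      pi_ne := fun i j h => absurd (Subsingleton.elim i j) h
      sum := by simp }⟩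
  · have : ¬ (∀ f : Module.End R X.M, f * f = f → f = 0 ∨ f = 1) := fun h' => hX ⟨h, h'⟩
    push Not at this
    obtain ⟨e, he, h0, h1⟩ := this
    have he' : ∀ x, e (e x) = e x := fun x => LinearMap.congr_fun he x
    let A := LinearMap.range e
    let B := LinearMap.range (1 - e)
    have hA : A ≠ ⊤ := by
      intro h
      apply h1
      ext x
      obtain ⟨y, rfl⟩ : x ∈ A := h ▸ Submodule.mem_top
      simp [he']
    have hB : B ≠ ⊤ := by
      intro h
      apply h0
      ext x
      obtain ⟨y, rfl⟩ : x ∈ B := h ▸ Submodule.mem_top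
      simp [he']
    obtain ⟨dA⟩ := ih _ (hn ▸ ln_sub_lt hA) (bun R A) rfl
    obtain ⟨dB⟩ := ih _ (hn ▸ ln_sub_lt hB) (bun R B) rfl
    refine ⟨Dec.glue dA dB A.subtype e.rangeRestrict B.subtype (LinearMap.rangeRestrict (1 - e)) ?_ ?_ ?_ ?_ ?_⟩
    · ext ⟨_, y, rfl⟩; simp [he']
    · ext ⟨_, y, rfl⟩; simp [he']
    · ext ⟨_, y, rfl⟩; simp [he']
    · ext ⟨_, y, rfl⟩; simp [he']
    · ext x; simp

/-- from submodules -/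
theorem Dec.ofSub (k : ℕ) (N : Fin k → Submodule R X.M) (h1 : ∀ i, IsIndecMod R (N i)) (h2 : iSupIndep N)
    (h3 : ⨆ i, N i = ⊤) : ∃ d : Dec X, Fintype.card d.ι = k := by
  classical
  have hI : DirectSum.IsInternal N := DirectSum.isInternal_submodule_of_iSupIndep_of_iSup_eq_top h2 h3
  let e : (DirectSum (Fin k) fun i => N i) ≃ₗ[R] X.M := LinearEquiv.ofBijective (DirectSum.coeLinearMap N) hI
  have he : ∀ i (x : N i), e.symm x.1 = DirectSum.lof R _ (fun i => N i) i x := by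
    intro i x
    rw [LinearEquiv.symm_apply_eq]
    exact (DirectSum.coeLinearMap_lof N i x).symm
  refine ⟨{
      ι := Fin k
      N := fun i => bun R (N i)
      indec := h1
      inc := fun i => (N i).subtype
      prj := fun i => DirectSum.component R _ _ i ∘ₗ e.symm.toLinearMap
      pi_self := ?_
      pi_ne := ?_
      sum := ?_ }, by simp⟩
  · intro i
    ext x : 1
    simp [he]
  · intro i j hij
    ext x : 1
    simp [he, DirectSum.component.of, hij.symm]
  · ext x
    obtain ⟨y, rfl⟩ := e.surjective x
    simp only [LinearMap.sum_apply, LinearMap.comp_apply, LinearEquiv.coe_coe, e.symm_apply_apply]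
    show _ = e y
    induction y using DirectSum.induction_on with
    | zero => simp
    | of i x =>
      rw [Finset.sum_eq_single i]
      · show ((DirectSum.component R _ (fun i => N i) i (DirectSum.lof R _ _ i x) : N i) : X.M) = e (DirectSum.lof R _ _ i x)
        rw [DirectSum.component.lof_self, ← he]; simp
      · intro j _ hj
        show ((DirectSum.component R _ (fun i => N i) j (DirectSum.lof R _ _ i x) : N j) : X.M) = 0
        rw [DirectSum.component.of]; simp [hj.symm]
      · simp
    | add x y hx hy =>
      simp only [map_add] at *
      rw [← hx, ← hy, ← Finset.sum_add_distrib]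

theorem Dec.retract (d : Dec X) (hZ : Z.IsIndec) (r : Hm X Z) (i : Hm Z X) (h : Function.Bijective (r ∘ₗ i)) :
    ∃ j, Function.Bijective (r ∘ₗ d.inc j) ∧ Function.Bijective (d.prj j ∘ₗ i) := by
  have h1 : r ∘ₗ i = (∑ j, (r ∘ₗ d.inc j) ∘ₗ (d.prj j ∘ₗ i) : Module.End R Z.M) := by
    conv_lhs => rw [← LinearMap.id_comp i, ← d.sum]
    ext x; simp
  rw [h1] at h
  obtain ⟨j, -, hj⟩ := bij_sum hZ _ _ h
  obtain ⟨h3, h4⟩ := bij_comp_indec (d.indec j) hZ.1 hj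
  exact ⟨j, h3, h4⟩

theorem iso_of_bij {f : Hm X Y} (h : Function.Bijective f) : X.Iso Y := ⟨LinearEquiv.ofBijective f h⟩
theorem iso_refl (X : ModA R) : X.Iso X := ⟨LinearEquiv.refl _ _⟩
theorem iso_symm (h : X.Iso Y) : Y.Iso X := h.elim fun e => ⟨e.symm⟩
theorem iso_trans (h : X.Iso Y) (h' : Y.Iso Z) : X.Iso Z := h.elim fun e => h'.elim fun e' => ⟨e.trans e'⟩
theorem iso_indec (h : X.Iso Y) (hX : X.IsIndec) : Y.IsIndec := h.elim fun e => indec_equiv e hX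

theorem Dec.comp_sum (d : Dec X) (f : Hm X Y) : f = ∑ j, (f ∘ₗ d.inc j) ∘ₗ d.prj j := by
  conv_lhs => rw [← LinearMap.comp_id f, ← d.sum]
  ext x; simp

theorem Dec.sum_comp (d : Dec X) (f : Hm Y X) : f = ∑ j, d.inc j ∘ₗ (d.prj j ∘ₗ f) := by
  conv_lhs => rw [← LinearMap.id_comp f, ← d.sum]
  ext x; simp

theorem Dec.mid_sum (d : Dec X) (g : Hm X Z) (f : Hm Y X) : g ∘ₗ f = ∑ j, (g ∘ₗ d.inc j) ∘ₗ (d.prj j ∘ₗ f) := by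
  conv_lhs => rw [← LinearMap.id_comp f, ← d.sum]
  ext x; simp

/-! ### radical powers -/
theorem mem_radPow_one {f : Hm X Y} : f ∈ radPow R 1 X Y ↔ InRad f := by
  constructor
  · intro h
    induction h using AddSubgroup.closure_induction with
    | mem f h => obtain ⟨Z, g, h, hg, -, rfl⟩ := h; exact inRad_comp_left hg h
    | zero => exact inRad_zero
    | add _ _ _ _ h h' => exact inRad_add h h'
    | neg _ _ h => exact inRad_neg h
  · intro h
    exact AddSubgroup.subset_closure ⟨Y, f, LinearMap.id, h, AddSubgroup.mem_top _, rfl⟩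

theorem radPow_comp {n : ℕ} {g : Hm X Z} {h : Hm Z Y} (hg : InRad g) (hh : h ∈ radPow R n Z Y) :
    h ∘ₗ g ∈ radPow R (n+1) X Y :=
  AddSubgroup.subset_closure ⟨Z, g, h, hg, hh, rfl⟩

theorem radPow_left {n : ℕ} {f : Hm X Y} (hf : f ∈ radPow R n X Y) (k : Hm Y Z) : k ∘ₗ f ∈ radPow R n X Z := by
  induction n generalizing X Y Z with
  | zero => exact AddSubgroup.mem_top _
  | succ n ih =>
    induction hf using AddSubgroup.closure_induction with
    | mem f h =>
      obtain ⟨W, g, h, hg, hh, rfl⟩ := h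
      exact radPow_comp (h := k ∘ₗ h) hg (ih hh k)
    | zero => rw [LinearMap.comp_zero]; exact zero_mem _
    | add _ _ _ _ h h' => rw [LinearMap.comp_add]; exact add_mem h h'
    | neg _ _ h => rw [LinearMap.comp_neg]; exact neg_mem h

theorem radPow_right {n : ℕ} {f : Hm X Y} (hf : f ∈ radPow R n X Y) (k : Hm Z X) : f ∘ₗ k ∈ radPow R n Z Y := by
  cases n with
  | zero => exact AddSubgroup.mem_top _
  | succ n =>
    induction hf using AddSubgroup.closure_induction with
    | mem f h =>
      obtain ⟨W, g, h, hg, hh, rfl⟩ := h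
      exact radPow_comp (h := h) (inRad_comp_right hg k) hh
    | zero => rw [LinearMap.zero_comp]; exact zero_mem _
    | add _ _ _ _ h h' => rw [LinearMap.add_comp]; exact add_mem h h'
    | neg _ _ h => rw [LinearMap.neg_comp]; exact neg_mem h

theorem mem_rad2 {g : Hm X Z} {h : Hm Z Y} (hg : InRad g) (hh : InRad h) : h ∘ₗ g ∈ radPow R 2 X Y :=
  radPow_comp hg (mem_radPow_one.2 hh)

theorem radPow_comp2 {n : ℕ} {g : Hm X Z} {h : Hm Z Y} (hg : g ∈ radPow R 2 X Z) (hh : h ∈ radPow R n Z Y) :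
    h ∘ₗ g ∈ radPow R (n+2) X Y := by
  induction hg using AddSubgroup.closure_induction with
  | mem f hf =>
    obtain ⟨W, a, b, ha, hb, rfl⟩ := hf
    exact radPow_comp (n := n+1) (h := h ∘ₗ b) ha (radPow_comp (mem_radPow_one.1 hb) hh)
  | zero => rw [LinearMap.comp_zero]; exact zero_mem _
  | add _ _ _ _ h h' => rw [LinearMap.comp_add]; exact add_mem h h'
  | neg _ _ h => rw [LinearMap.comp_neg]; exact neg_mem h

/-- induction for rad^2, with intermediate indecomposables -/
theorem rad2_ind {P : Hm X Y → Prop} (h0 : P 0) (ha : ∀ f g, P f → P g → P (f + g)) (hn : ∀ f, P f → P (-f))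
    (hc : ∀ (Z : ModA R), ∀ (g : Hm X Z) (h : Hm Z Y), InRad g → InRad h → P (h ∘ₗ g))
    {f : Hm X Y} (hf : f ∈ radPow R 2 X Y) : P f := by
  induction hf using AddSubgroup.closure_induction with
  | mem f hf =>
    obtain ⟨W, a, b, ha, hb, rfl⟩ := hf
    exact hc W a b ha (mem_radPow_one.1 hb)
  | zero => exact h0
  | add _ _ _ _ h h' => exact ha _ _ h h'
  | neg _ _ h => exact hn _ h

theorem rad2_le {f : Hm X Y} (hf : f ∈ radPow R 2 X Y) : InRad f :=
  rad2_ind (P := fun f => InRad f) inRad_zero (fun _ _ => inRad_add) (fun _ => inRad_neg)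
    (fun _ _ h hg _ => inRad_comp_left hg h) hf

/-- irreducible arrow -/
def Arr (X Y : ModA R) : Prop := ∃ f : Hm X Y, InRad f ∧ f ∉ radPow R 2 X Y

theorem Arr.iso {X' Y' : ModA R} (h : Arr X Y) (hX : X.Iso X') (hY : Y.Iso Y') : Arr X' Y' := by
  obtain ⟨f, hf, hf2⟩ := h
  obtain ⟨e⟩ := hX
  obtain ⟨e'⟩ := hY
  refine ⟨e'.toLinearMap ∘ₗ f ∘ₗ e.symm.toLinearMap, inRad_comp_left (inRad_comp_right hf _) _, fun h => hf2 ?_⟩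
  have := radPow_left (radPow_right h e.toLinearMap) e'.symm.toLinearMap
  convert this using 1
  ext x; simp

theorem sum_not_mem {n : ℕ} {ι : Type*} (s : Finset ι) (f : ι → Hm X Y)
    (h : (∑ i ∈ s, f i) ∉ radPow R n X Y) : ∃ i ∈ s, f i ∉ radPow R n X Y := by
  by_contra hc
  push Not at hc
  exact h (sum_mem hc)

/-- a map outside the infinite radical gives a path of arrows through indecomposables -/
theorem arr_path (m : ℕ) : ∀ (X Y : ModA R) (hX : X.IsIndec) (hY : Y.IsIndec), ∀ f : Hm X Y, f ∈ radPow R (m+1) X Y → f ∉ radPow R (m+2) X Y →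
    Relation.TransGen (fun x y : IndecModA R => Arr x.1 y.1) (Subtype.mk X hX) (Subtype.mk Y hY) := by
  induction m with
  | zero =>
    intro X Y hX hY f h1 h2
    exact .single ⟨f, mem_radPow_one.1 h1, h2⟩
  | succ m ih =>
    intro X Y hX hY f h1 h2
    have : ∃ (Z : ModA R) (g : Hm X Z) (h : Hm Z Y), InRad g ∧ h ∈ radPow R (m+1) Z Y ∧ h ∘ₗ g ∉ radPow R (m+3) X Y := by
      by_contra hc
      push Not at hc
      apply h2
      refine (AddSubgroup.closure_le _).2 ?_ h1
      rintro _ ⟨Z, g, h, hg, hh, rfl⟩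
      exact hc Z g h hg hh
    obtain ⟨Z, g, h, hg, hh, hgh⟩ := this
    obtain ⟨d⟩ := Dec.nonempty Z
    rw [d.mid_sum] at hgh
    obtain ⟨j, -, hj⟩ := sum_not_mem _ _ hgh
    refine .head (b := ⟨d.N j, d.indec j⟩) ⟨d.prj j ∘ₗ g, inRad_comp_left hg _, fun h' => hj ?_⟩
      (ih _ _ (d.indec j) hY (h ∘ₗ d.inc j) (radPow_right hh _) fun h' => hj ?_)
    · exact radPow_comp2 h' (radPow_right hh _)
    · exact radPow_comp (inRad_comp_left hg _) h'

theorem arr_path' (hX : X.IsIndec) (hY : Y.IsIndec) {f : Hm X Y} (hf : InRad f) (hi : ¬ InRadInf f) :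
    Relation.TransGen (fun x y : IndecModA R => Arr x.1 y.1) (Subtype.mk X hX) (Subtype.mk Y hY) := by
  classical
  have hi : ∃ n, f ∉ radPow R n X Y := by
    by_contra hc; push Not at hc; exact hi hc
  have h1 := Nat.find_spec hi
  have h2 : 2 ≤ Nat.find hi := by
    by_contra hc
    rcases (by omega : Nat.find hi = 0 ∨ Nat.find hi = 1) with h | h
    · rw [h] at h1; exact h1 (AddSubgroup.mem_top _)
    · rw [h] at h1; exact h1 (mem_radPow_one.2 hf)
  obtain ⟨m, hm⟩ := Nat.exists_eq_add_of_le' h2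
  have h3 : f ∈ radPow R (m+1) X Y := by
    have := Nat.find_min hi (m := m+1) (by omega)
    simpa using this
  exact arr_path m X Y hX hY f h3 (hm ▸ h1)

end modA
end CF
end

section
namespace CF
set_option linter.unusedSectionVars false
set_option linter.unusedVariables false

theorem sub_eq_of_ln {R M : Type*} [Ring R] [AddCommGroup M] [Module R M] [IsNoetherian R M] [IsArtinian R M]
    {S T : Submodule R M} (h : S ≤ T) (hl : ln R T ≤ ln R S) : S = T := by
  refine le_antisymm h fun x hx => ?_
  have := (bij_of_inj_ln (Submodule.inclusion h) (Submodule.inclusion_injective h) hl).2 ⟨x, hx⟩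
  obtain ⟨y, hy⟩ := this
  have : (y : M) = x := congrArg Subtype.val hy
  exact this ▸ y.2

section modA
variable {R : Type u} [Ring R] {X Y Z W : ModA R}

theorem rk_comp_left (f : Hm X Y) (g : Hm Y Z) : ln R (LinearMap.range (g ∘ₗ f)) ≤ ln R (LinearMap.range g) :=
  ln_inj (Submodule.inclusion (LinearMap.range_comp_le_range f g)) (Submodule.inclusion_injective _)

theorem rk_comp_right (f : Hm X Y) (g : Hm Y Z) : ln R (LinearMap.range (g ∘ₗ f)) ≤ ln R (LinearMap.range f) := by
  have h1 := ln_ker f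
  have h2 := ln_ker (g ∘ₗ f)
  have h3 : ln R (LinearMap.ker f) ≤ ln R (LinearMap.ker (g ∘ₗ f)) :=
    ln_inj (Submodule.inclusion (LinearMap.ker_le_ker_comp f g)) (Submodule.inclusion_injective _)
  omega

theorem hs_step (hY : Y.IsIndec) (f : Hm X Y) (h : Hm Y Z) (r : ℕ) (hr : 0 < r)
    (h1 : ln R (LinearMap.range f) ≤ r) (h2 : ln R (LinearMap.range h) ≤ r)
    (h3 : r ≤ ln R (LinearMap.range (h ∘ₗ f))) : Function.Injective h ∧ Function.Surjective f := by
  have h4 := rk_comp_left f h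
  have h5 := rk_comp_right f h
  have e1 : LinearMap.range (h ∘ₗ f) = LinearMap.range h :=
    sub_eq_of_ln (LinearMap.range_comp_le_range f h) (by omega)
  have e2 : LinearMap.ker f = LinearMap.ker (h ∘ₗ f) := by
    refine sub_eq_of_ln (LinearMap.ker_le_ker_comp f h) ?_
    have h1 := ln_ker f
    have h2 := ln_ker (h ∘ₗ f)
    omega
  have hc : IsCompl (LinearMap.range f) (LinearMap.ker h) := by
    refine IsCompl.of_eq ?_ ?_
    · rw [eq_bot_iff]
      rintro _ ⟨⟨x, rfl⟩, hx⟩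
      have : x ∈ LinearMap.ker (h ∘ₗ f) := hx
      rw [← e2] at this
      exact this
    · rw [eq_top_iff]
      rintro y -
      have : h y ∈ LinearMap.range (h ∘ₗ f) := e1 ▸ LinearMap.mem_range_self h y
      obtain ⟨x, hx⟩ := this
      have : y = f x + (y - f x) := by abel
      rw [this]
      refine Submodule.add_mem_sup (LinearMap.mem_range_self f x) ?_
      rw [LinearMap.mem_ker, map_sub, sub_eq_zero]; exact hx.symm
  rcases indec_compl hY hc with h | h
  · exfalso
    have : ln R (LinearMap.range f) = 0 := by
      rw [ln_zero_iff, h]; infer_instance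
    omega
  · refine ⟨LinearMap.ker_eq_bot.1 h, LinearMap.range_eq_top.1 ?_⟩
    have := hc.sup_eq_top
    rwa [h, sup_bot_eq] at this

/-- composites of `n` non-isomorphisms among modules satisfying `P` -/
inductive RC (P : ModA R → Prop) : ℕ → ∀ X Y : ModA R, Hm X Y → Prop
  | nil (X : ModA R) (hX : P X) : RC P 0 X X LinearMap.id
  | cons {n : ℕ} {X Z Y : ModA R} (hX : P X) (g : Hm X Z) (hg : ¬ Function.Bijective g) (h : Hm Z Y)
      (hh : RC P n Z Y h) : RC P (n+1) X Y (h ∘ₗ g)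

theorem RC.left {P : ModA R → Prop} {n : ℕ} {f : Hm X Y} (h : RC P n X Y f) : P X := by
  cases h <;> assumption
theorem RC.right {P : ModA R → Prop} {n : ℕ} {f : Hm X Y} (h : RC P n X Y f) : P Y := by
  induction h <;> assumption

theorem RC.split {P : ModA R → Prop} (a b : ℕ) : ∀ {X Y : ModA R} {f : Hm X Y}, RC P (a + b) X Y f →
    ∃ (Z : ModA R) (g : Hm X Z) (h : Hm Z Y), RC P a X Z g ∧ RC P b Z Y h ∧ f = h ∘ₗ g := by
  induction a with
  | zero =>
    intro X Y f h
    rw [zero_add] at h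
    exact ⟨X, LinearMap.id, f, .nil X h.left, h, rfl⟩
  | succ a ih =>
    intro X Y f h
    rw [show a + 1 + b = (a + b) + 1 by omega] at h
    cases h with
    | cons hX g hg h hh =>
      obtain ⟨Z', g', h', hg', hh', rfl⟩ := ih hh
      exact ⟨Z', g' ∘ₗ g, h', .cons hX g hg g' hg', hh', rfl⟩

theorem RC.snoc {P : ModA R → Prop} {n : ℕ} {X Z Y : ModA R} {h : Hm X Z} (hh : RC P n X Z h) (g : Hm Z Y)
    (hg : ¬ Function.Bijective g) (hY : P Y) : RC P (n+1) X Y (g ∘ₗ h) := by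
  induction hh with
  | nil X hX => exact .cons hX g hg LinearMap.id (.nil _ hY)
  | cons hX k hk h hh ih => exact .cons hX k hk (g ∘ₗ h) (ih g hg)

theorem RC.mono {P Q : ModA R → Prop} (hPQ : ∀ X, P X → Q X) {n : ℕ} {f : Hm X Y} (h : RC P n X Y f) : RC Q n X Y f := by
  induction h with
  | nil X hX => exact .nil X (hPQ X hX)
  | cons hX k hk h hh ih => exact .cons (hPQ _ hX) k hk _ ih

theorem RC.rank {P : ModA R → Prop} (b : ℕ) (hP : ∀ X, P X → X.IsIndec ∧ ln R X.M ≤ b) (k : ℕ) :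
    ∀ {X Y : ModA R} {f : Hm X Y}, RC P (2^k - 1) X Y f → ln R (LinearMap.range f) ≤ b - k := by
  induction k with
  | zero =>
    intro X Y f h
    have := ln_ker f
    have := (hP X h.left).2
    omega
  | succ k ih =>
    intro X Y f h
    have e : 2^(k+1) - 1 = (2^k - 1) + (1 + (2^k - 1)) := by
      have : 0 < 2^k := by positivity
      rw [pow_succ]; omega
    rw [e] at h
    obtain ⟨Y1, f1, h1, hf1, hh1, rfl⟩ := h.split
    obtain ⟨Y2, g, h2, hg, hh2, rfl⟩ := hh1.split
    have i1 := ih hf1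
    have i2 := ih hh2
    have hnb : ¬ Function.Bijective g := by
      cases hg with
      | cons hX g hg h hh =>
        cases hh; exact hg
    have hY1 := (hP _ hg.left).1
    have hY2 := (hP _ hg.right).1
    by_contra hc
    have hk : 0 < b - k := by
      have := rk_comp_right f1 (h2 ∘ₗ g)
      omega
    apply hnb
    have j1 := rk_comp_left g h2
    have a1 := hs_step hY1 f1 (h2 ∘ₗ g) (b-k) hk i1 (by omega) (by omega)
    have j2 := rk_comp_right f1 g
    have a2 := hs_step hY2 (g ∘ₗ f1) h2 (b-k) hk (by omega) i2 (by
      show b - k ≤ ln R (LinearMap.range ((h2 ∘ₗ g) ∘ₗ f1)); omega)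
    exact ⟨Function.Injective.of_comp (f := h2) a1.1, Function.Surjective.of_comp (g := f1) a2.2⟩

theorem RC.zero {P : ModA R → Prop} (b : ℕ) (hP : ∀ X, P X → X.IsIndec ∧ ln R X.M ≤ b)
    {f : Hm X Y} (h : RC P (2^b - 1) X Y f) : f = 0 := by
  have := h.rank b hP
  rw [Nat.sub_self, Nat.le_zero, ln_zero_iff, Submodule.subsingleton_iff_eq_bot] at this
  exact LinearMap.range_eq_bot.1 this

theorem pushout {A B C Z : ModA R} (i : Hm A B) (g : Hm B C) (hi : Function.Injective i)
    (hg : Function.Surjective g) (hex : LinearMap.range i = LinearMap.ker g) (h : Hm A Z) :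
    ∃ (P : ModA R) (iB : Hm B P) (iZ : Hm Z P) (q : Hm P C), iB ∘ₗ i = iZ ∘ₗ h ∧ Function.Injective iZ ∧
      q ∘ₗ iB = g ∧ q ∘ₗ iZ = 0 ∧ LinearMap.range iZ = LinearMap.ker q ∧ Function.Surjective q := by
  let S : Submodule R (B.M × Z.M) := LinearMap.range (i.prod (-h))
  have hgi : ∀ a, g (i a) = 0 := fun a => by
    have : i a ∈ LinearMap.ker g := hex ▸ LinearMap.mem_range_self i a
    exact this
  refine ⟨bun R ((B.M × Z.M) ⧸ S), S.mkQ ∘ₗ LinearMap.inl R _ _, S.mkQ ∘ₗ LinearMap.inr R _ _,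
    S.liftQ (g ∘ₗ LinearMap.fst R _ _) ?_, ?_, ?_, ?_, ?_, ?_, ?_⟩
  · rintro _ ⟨a, rfl⟩
    simp [hgi]
  · ext a
    simp only [LinearMap.comp_apply, Submodule.mkQ_apply]
    rw [Submodule.Quotient.eq]
    exact ⟨a, by simp⟩
  · rw [← LinearMap.ker_eq_bot, eq_bot_iff]
    intro z hz
    rw [LinearMap.mem_ker, LinearMap.comp_apply, Submodule.mkQ_apply, Submodule.Quotient.mk_eq_zero] at hz
    obtain ⟨a, ha⟩ := hz
    have h1 : i a = 0 := congrArg Prod.fst ha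
    have h2 : - h a = z := congrArg Prod.snd ha
    rw [← map_zero i] at h1
    rw [← h2, hi h1]; simp
  · ext b; simp
  · ext b; simp
  · ext p
    constructor
    · rintro ⟨z, rfl⟩
      simp
    · intro hp
      obtain ⟨⟨b, z⟩, rfl⟩ := S.mkQ_surjective p
      have : b ∈ LinearMap.ker g := by simpa using hp
      rw [← hex] at this
      obtain ⟨a, rfl⟩ := this
      refine ⟨z + h a, ?_⟩
      simp only [LinearMap.comp_apply, Submodule.mkQ_apply]
      rw [Submodule.Quotient.eq]
      exact ⟨-a, by simp⟩
  · intro c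
    obtain ⟨b, rfl⟩ := hg c
    exact ⟨S.mkQ (b, 0), Submodule.liftQ_apply S _ _⟩

end modA

section kmod
variable (K : Type u) [CommRing K] [IsArtinianRing K] {R : Type u} [Ring R] [Algebra K R]

instance kmod (X : ModA R) : Module K X.M := Module.compHom X.M (algebraMap K R)
instance ktower (X : ModA R) : IsScalarTower K R X.M :=
  ⟨fun k r x => by
    show (k • r) • x = algebraMap K R k • (r • x)
    rw [Algebra.smul_def, mul_smul]⟩

variable [Module.Finite K R]
instance kfin (X : ModA R) : Module.Finite K X.M := Module.Finite.trans R X.M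
instance knoeth (X : ModA R) : IsNoetherian K X.M := inferInstance
instance kart (X : ModA R) : IsArtinian K X.M := inferInstance

theorem hom_inj (X : ModA R) : ∃ n : ℕ, ∃ m : Fin n → X.M, Submodule.span R (Set.range m) = ⊤ :=
  Module.Finite.exists_fin

variable {K} in
def evalGen {X Y : ModA R} {n : ℕ} (m : Fin n → X.M) : Hm X Y →ₗ[K] (Fin n → Y.M) where
  toFun f i := f (m i)
  map_add' _ _ := rfl
  map_smul' _ _ := rfl

theorem evalGen_inj {X Y : ModA R} {n : ℕ} (m : Fin n → X.M) (hm : Submodule.span R (Set.range m) = ⊤) :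
    Function.Injective (evalGen (K := K) (Y := Y) m) := by
  intro f g h
  refine LinearMap.ext_on_range hm fun i => congrFun h i

instance knoethH (X Y : ModA R) : IsNoetherian K (Hm X Y) := by
  obtain ⟨n, m, hm⟩ := hom_inj X
  exact isNoetherian_of_injective _ (evalGen_inj K (Y := Y) m hm)
instance kartH (X Y : ModA R) : IsArtinian K (Hm X Y) := by
  obtain ⟨n, m, hm⟩ := hom_inj X
  exact isArtinian_of_injective _ (evalGen_inj K (Y := Y) m hm)

noncomputable def hl (X Y : ModA R) : ℕ := ln K (Hm X Y)

def postc {X Y Z : ModA R} (f : Hm Y Z) : Hm X Y →ₗ[K] Hm X Z where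
  toFun g := f ∘ₗ g
  map_add' _ _ := LinearMap.comp_add _ _ _
  map_smul' k g := by ext x; exact (f.map_smul_of_tower k (g x))

def prec {X Y Z : ModA R} (f : Hm X Y) : Hm Y Z →ₗ[K] Hm X Z where
  toFun g := g ∘ₗ f
  map_add' _ _ := LinearMap.add_comp _ _ _
  map_smul' k g := rfl

end kmod
end CF
end

section
namespace CF
set_option linter.unusedSectionVars false

section inj
variable (K : Type u) [CommRing K] [IsArtinianRing K]

theorem exists_inj (S : Type u) [AddCommGroup S] [Module K S] :
    ∃ (J : Type u) (_ : AddCommGroup J) (_ : Module K J) (j : S →ₗ[K] J), Module.Injective K J ∧ Function.Injective j := by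
  let J := CategoryTheory.Injective.under (ModuleCat.of K S)
  have h : CategoryTheory.Injective (ModuleCat.of K J) := inferInstanceAs (CategoryTheory.Injective J)
  refine ⟨J, inferInstance, inferInstance, (CategoryTheory.Injective.ι (ModuleCat.of K S)).hom,
    Module.injective_module_of_injective_object K J, ?_⟩
  exact (ModuleCat.mono_iff_injective _).1 inferInstance

theorem exists_hull (S : Type u) [AddCommGroup S] [Module K S] :
    ∃ (I : Type u) (_ : AddCommGroup I) (_ : Module K I) (j : S →ₗ[K] I), Module.Injective K I ∧ Function.Injective j ∧
      ∀ T : Submodule K I, Disjoint T (LinearMap.range j) → T = ⊥ := by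
  obtain ⟨J, _, _, j, hJ, hj⟩ := exists_inj K S
  obtain ⟨C, -, hC⟩ : ∃ C : Submodule K J, ⊥ ≤ C ∧ Maximal (fun C => C ⊓ LinearMap.range j = ⊥) C := by
    refine zorn_le_nonempty₀ {C : Submodule K J | C ⊓ LinearMap.range j = ⊥} ?_ ⊥ (by simp)
    intro c hc hch y hy
    refine ⟨sSup c, ?_, fun z hz => le_sSup hz⟩
    rw [Set.mem_ofPred_eq, eq_bot_iff]
    rintro x ⟨hx, hx'⟩
    have hx := (Submodule.mem_sSup_of_directed ⟨y, hy⟩ hch.directedOn).1 hx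
    obtain ⟨D, hD, hx⟩ := hx
    have := hc hD
    exact (Set.mem_ofPred_eq ▸ this : D ⊓ _ = ⊥) ▸ (⟨hx, hx'⟩ : x ∈ D ⊓ LinearMap.range j)
  obtain ⟨I, hSI, hI⟩ : ∃ I : Submodule K J, LinearMap.range j ≤ I ∧ Maximal (fun I => I ⊓ C = ⊥) I := by
    refine zorn_le_nonempty₀ {I : Submodule K J | I ⊓ C = ⊥} ?_ (LinearMap.range j) (by
      have := hC.prop
      rw [inf_comm] at this
      exact this)
    intro c hc hch y hy
    refine ⟨sSup c, ?_, fun z hz => le_sSup hz⟩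
    rw [Set.mem_ofPred_eq, eq_bot_iff]
    rintro x ⟨hx, hx'⟩
    have hx := (Submodule.mem_sSup_of_directed ⟨y, hy⟩ hch.directedOn).1 hx
    obtain ⟨D, hD, hx⟩ := hx
    have := hc hD
    exact (Set.mem_ofPred_eq ▸ this : D ⊓ _ = ⊥) ▸ (⟨hx, hx'⟩ : x ∈ D ⊓ C)
  have hIC : ∀ x ∈ I, x ∈ C → x = 0 := fun x h1 h2 => by
    have : x ∈ I ⊓ C := ⟨h1, h2⟩
    rw [hI.prop] at this; exact this
  -- the map
  let i0 : (C × I) →ₗ[K] J := C.subtype.coprod I.subtype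
  have hi0 : Function.Injective i0 := by
    rw [← LinearMap.ker_eq_bot, eq_bot_iff]
    rintro ⟨c, x⟩ h
    have h' : (c : J) + x = 0 := h
    have hx : (x : J) = 0 := hIC _ x.2 (by
      rw [show (x : J) = -c from by rw [eq_neg_iff_add_eq_zero, add_comm]; exact h']
      exact C.neg_mem c.2)
    have hc : (c : J) = 0 := by rw [hx, add_zero] at h'; exact h'
    rw [Submodule.mem_bot, Prod.mk_eq_zero]
    exact ⟨Subtype.ext hc, Subtype.ext hx⟩
  obtain ⟨φ, hφ⟩ := hJ.out i0 hi0 (I.subtype ∘ₗ LinearMap.snd K C I)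
  have hφC : ∀ x ∈ C, φ x = 0 := fun x hx => by
    have := hφ (⟨x, hx⟩, 0)
    simpa [i0] using this
  have hφI : ∀ x ∈ I, φ x = x := fun x hx => by
    have := hφ (0, ⟨x, hx⟩)
    simpa [i0] using this
  have hpre : C.comap φ ≤ C := by
    refine hC.le_of_ge ?_ ?_
    · rw [eq_bot_iff]
      rintro x ⟨hx, hx'⟩
      have h1 := hSI hx'
      have h2 : φ x ∈ C := hx
      rw [hφI x h1] at h2
      exact hIC x h1 h2
    · intro x hx
      rw [Submodule.mem_comap, hφC x hx]; exact C.zero_mem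
  have hran : LinearMap.range φ ≤ I := by
    refine hI.le_of_ge ?_ ?_
    · rw [eq_bot_iff]
      rintro _ ⟨⟨x, rfl⟩, hx⟩
      exact hφC x (hpre hx)
    · intro x hx
      exact ⟨x, hφI x hx⟩
  let ψ : J →ₗ[K] I := φ.codRestrict I fun x => hran ⟨x, rfl⟩
  have hψ : ∀ x : I, ψ x = x := fun x => Subtype.ext (hφI x x.2)
  let j' : S →ₗ[K] I := j.codRestrict I fun x => hSI ⟨x, rfl⟩
  refine ⟨I, inferInstance, inferInstance, j', ⟨?_⟩, ?_, ?_⟩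
  · intro X Y _ _ _ _ f hf g
    obtain ⟨h, hh⟩ := hJ.out f hf (I.subtype ∘ₗ g)
    refine ⟨ψ ∘ₗ h, fun x => ?_⟩
    rw [LinearMap.comp_apply, hh]
    exact hψ _
  · intro x y h
    exact hj (congrArg Subtype.val h)
  · intro T hT
    rw [eq_bot_iff]
    intro t ht
    have : T.map I.subtype ⊔ C ≤ C := by
      refine hC.le_of_ge ?_ le_sup_right
      rw [eq_bot_iff]
      rintro x ⟨hx, s, rfl⟩
      obtain ⟨_, ⟨a, ha, rfl⟩, c, hc, hac⟩ := Submodule.mem_sup.1 hx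
      have hac' : (a : J) + c = j s := hac
      have hc0 : c = 0 := hIC c (by
        rw [show c = j s - (a : J) from by rw [← hac']; abel]
        exact I.sub_mem (hSI ⟨s, rfl⟩) a.2) hc
      rw [hc0, add_zero] at hac'
      have ha' : a = j' s := Subtype.ext hac'
      have : a ∈ T ⊓ LinearMap.range j' := ⟨ha, s, ha'.symm⟩
      rw [hT.eq_bot] at this
      have : a = 0 := this
      rw [← hac', this]; rfl
    have : (t : J) ∈ C := this (Submodule.mem_sup_left ⟨t, ht, rfl⟩)
    exact Subtype.ext (hIC _ t.2 this)

theorem exists_I : ∃ (I : Type u) (_ : AddCommGroup I) (_ : Module K I), Module.Injective K I ∧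
    ∀ (M : Type u) [AddCommGroup M] [Module K M], IsFiniteLength K M →
      Module.length K (M →ₗ[K] I) = Module.length K M := by
  classical
  obtain ⟨I, _, _, j, hI, hj, hT⟩ := exists_hull K (∀ m : MaximalSpectrum K, K ⧸ m.asIdeal)
  refine ⟨I, inferInstance, inferInstance, hI, ?_⟩
  have hsimple : ∀ (T : Type u) [AddCommGroup T] [Module K T] [IsSimpleModule K T], Module.length K (T →ₗ[K] I) = 1 := by
    intro T _ _ _
    obtain ⟨m, hm, ⟨e⟩⟩ := isSimpleModule_iff_quot_maximal.1 (inferInstance : IsSimpleModule K T)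
    let m' : MaximalSpectrum K := ⟨m, hm⟩
    have hs : IsSimpleModule K (K ⧸ m) := isSimpleModule_iff_quot_maximal.2 ⟨m, hm, ⟨LinearEquiv.refl _ _⟩⟩
    -- maps from T land in range j
    have hran : ∀ f : T →ₗ[K] I, ∀ t, f t ∈ LinearMap.range j := by
      intro f t
      by_cases hf : f = 0
      · rw [hf]; exact zero_mem _
      have hfi : Function.Injective f := (LinearMap.injective_or_eq_zero f).resolve_right hf
      have h1 : ¬ Disjoint (LinearMap.range f) (LinearMap.range j) := by
        intro h
        exact hf (LinearMap.range_eq_bot.1 (hT _ h))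
      have h2 : (LinearMap.range j).comap f ≠ ⊥ := by
        intro h
        apply h1
        rw [disjoint_iff, eq_bot_iff]
        rintro _ ⟨⟨x, rfl⟩, hx⟩
        have : x ∈ (LinearMap.range j).comap f := hx
        rw [h] at this
        have : x = 0 := this
        rw [this, map_zero]; exact zero_mem _
      have h3 : (LinearMap.range j).comap f = ⊤ := (eq_bot_or_eq_top _).resolve_left h2
      have : t ∈ (LinearMap.range j).comap f := h3 ▸ Submodule.mem_top
      exact this
    let jj := LinearEquiv.ofInjective j hj
    have hjj : ∀ y, j (jj.symm y) = y := fun y => congrArg Subtype.val (jj.apply_symm_apply y)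
    let ev : (T →ₗ[K] I) →ₗ[K] (K ⧸ m) :=
      { toFun := fun f => jj.symm ⟨f (e.symm 1), hran f _⟩ m'
        map_add' := fun f g => by
          rw [← Pi.add_apply, ← map_add]; rfl
        map_smul' := fun k f => by
          rw [RingHom.id_apply, ← Pi.smul_apply, ← map_smul]; rfl }
    have hgen : ∀ t : T, ∃ a : K, t = a • e.symm 1 := by
      intro t
      obtain ⟨a, ha⟩ := Ideal.Quotient.mk_surjective (e t)
      refine ⟨a, ?_⟩
      rw [← map_smul, ← e.symm_apply_apply t, ← ha]
      congr 1
      rw [Algebra.smul_def, mul_one]; rfl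
    have hinj : Function.Injective ev := by
      rw [← LinearMap.ker_eq_bot, eq_bot_iff]
      intro f hf
      have hf : jj.symm ⟨f (e.symm 1), hran f _⟩ m' = 0 := hf
      have h0 : jj.symm ⟨f (e.symm 1), hran f _⟩ = 0 := by
        ext n
        by_cases hn : n = m'
        · rw [hn]; exact hf
        · have : ∃ a ∈ m, a ∉ n.asIdeal := by
            by_contra hc
            push Not at hc
            apply hn
            ext1
            exact (hm.eq_of_le n.isMaximal.ne_top hc).symm
          obtain ⟨a, ham, han⟩ := this
          have h1 : a • e.symm 1 = 0 := by
            rw [← map_smul, Algebra.smul_def, mul_one]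
            have : (algebraMap K (K ⧸ m)) a = 0 := Ideal.Quotient.eq_zero_iff_mem.2 ham
            rw [this, map_zero]
          have h2 : a • jj.symm ⟨f (e.symm 1), hran f _⟩ = 0 := by
            rw [← map_smul, ← map_zero jj.symm]
            congr 1
            apply Subtype.ext
            show a • f (e.symm 1) = 0
            rw [← map_smul, h1, map_zero]
          have h3 := congrFun h2 n
          rw [Pi.smul_apply, Algebra.smul_def] at h3
          have hdom : IsDomain (K ⧸ n.asIdeal) := (Ideal.Quotient.isDomain_iff_prime _).2 n.isMaximal.isPrime
          rcases mul_eq_zero.1 h3 with h | h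
          · exact absurd (Ideal.Quotient.eq_zero_iff_mem.1 h) han
          · exact h
      have h4 : f (e.symm 1) = 0 := by
        have := hjj ⟨f (e.symm 1), hran f _⟩
        rw [h0, map_zero] at this
        exact this.symm
      rw [Submodule.mem_bot]
      ext t
      obtain ⟨a, rfl⟩ := hgen t
      rw [map_smul, h4]; simp
    have hne : ∃ f : T →ₗ[K] I, ev f ≠ 0 := by
      refine ⟨j ∘ₗ LinearMap.single K (fun m : MaximalSpectrum K => K ⧸ m.asIdeal) m' ∘ₗ e.toLinearMap, ?_⟩
      have : jj.symm ⟨j (LinearMap.single K (fun m : MaximalSpectrum K => K ⧸ m.asIdeal) m' 1), ⟨_, rfl⟩⟩ =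
        LinearMap.single K (fun m : MaximalSpectrum K => K ⧸ m.asIdeal) m' 1 := jj.symm_apply_apply _
      intro h
      have h' : jj.symm ⟨j (LinearMap.single K (fun m : MaximalSpectrum K => K ⧸ m.asIdeal) m' (e (e.symm 1))), ⟨_, rfl⟩⟩ m' = 0 := h
      simp only [e.apply_symm_apply] at h'
      rw [this] at h'
      simp only [LinearMap.single_apply, Pi.single_eq_same] at h'
      have : Nontrivial (K ⧸ m) := hs.nontrivial
      exact one_ne_zero h'
    obtain ⟨f, hf⟩ := hne
    have hsurj : Function.Surjective ev := (LinearMap.surjective_or_eq_zero ev).resolve_right fun h => hf (by rw [h]; rfl)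
    rw [(LinearEquiv.ofBijective ev ⟨hinj, hsurj⟩).length_eq]
    exact Module.length_eq_one K _
  intro M _ _ hM
  induction hM with
  | of_subsingleton =>
    rename_i M _ _ _
    have : Subsingleton (M →ₗ[K] I) := ⟨fun f g => by ext x; rw [Subsingleton.elim x 0, map_zero, map_zero]⟩
    rw [Module.length_eq_zero, Module.length_eq_zero]
  | of_simple_quotient hN ih =>
    rename_i M _ _ N _
    have h1 := Module.length_eq_add_of_exact (LinearMap.lcomp K I N.mkQ) (LinearMap.lcomp K I N.subtype) ?_ ?_ ?_
    · rw [h1, ih, hsimple, Module.length_eq_add_of_exact N.subtype N.mkQ N.subtype_injective N.mkQ_surjective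
        (LinearMap.exact_subtype_mkQ N), Module.length_eq_one K (M ⧸ N), add_comm]
    · intro f g h
      ext x
      exact LinearMap.congr_fun h x
    · intro f
      obtain ⟨g, hg⟩ := hI.out N.subtype N.subtype_injective f
      exact ⟨g, by ext x; exact hg x⟩
    · intro f
      constructor
      · intro h
        refine ⟨N.liftQ f fun x hx => LinearMap.congr_fun h ⟨x, hx⟩, ?_⟩
        ext x; rfl
      · rintro ⟨g, rfl⟩
        ext x
        show g (N.mkQ x) = 0
        rw [(Submodule.Quotient.mk_eq_zero N).2 x.2 |> (show N.mkQ x = 0 from ·), map_zero]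
end inj
end CF
end

section
namespace CF
set_option linter.style.haveILetI false
set_option linter.unusedVariables false
noncomputable section
set_option linter.unusedSectionVars false

section I
variable (K : Type u) [CommRing K] [IsArtinianRing K]
/-- the dualizing module -/
def DI : Type u := (exists_I K).choose
noncomputable instance : AddCommGroup (DI K) := (exists_I K).choose_spec.choose
noncomputable instance : Module K (DI K) := (exists_I K).choose_spec.choose_spec.choose

theorem DI_spec : Module.Injective K (DI K) ∧
    ∀ (M : Type u) [AddCommGroup M] [Module K M], IsFiniteLength K M →
      Module.length K (M →ₗ[K] DI K) = Module.length K M := (exists_I K).choose_spec.choose_spec.choose_spec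

variable {K}
theorem DI_ext {A B : Type u} [AddCommGroup A] [AddCommGroup B] [Module K A] [Module K B] (i : A →ₗ[K] B)
    (hi : Function.Injective i) (f : A →ₗ[K] DI K) : ∃ g : B →ₗ[K] DI K, ∀ x, g (i x) = f x :=
  (DI_spec K).1.out i hi f

/-- factor along a map vanishing where needed -/
theorem DI_fac {A B : Type u} [AddCommGroup A] [AddCommGroup B] [Module K A] [Module K B] (i : A →ₗ[K] B)
    (f : A →ₗ[K] DI K) (h : ∀ x, i x = 0 → f x = 0) : ∃ g : B →ₗ[K] DI K, ∀ x, g (i x) = f x := by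
  obtain ⟨g, hg⟩ := DI_ext ((LinearMap.ker i).liftQ i le_rfl) (by
    rw [← LinearMap.ker_eq_bot, Submodule.ker_liftQ_eq_bot]; exact le_rfl) ((LinearMap.ker i).liftQ f fun x hx => h x hx)
  refine ⟨g, fun x => ?_⟩
  exact hg ((LinearMap.ker i).mkQ x)

variable (M : Type u) [AddCommGroup M] [Module K M] [IsNoetherian K M] [IsArtinian K M]

theorem flen : IsFiniteLength K M := isFiniteLength_iff_isNoetherian_isArtinian.2 ⟨inferInstance, inferInstance⟩

theorem DI_len : Module.length K (M →ₗ[K] DI K) = Module.length K M := (DI_spec K).2 M (flen M)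

theorem DI_fl : IsFiniteLength K (M →ₗ[K] DI K) := by
  rw [← Module.length_ne_top_iff, DI_len, Module.length_ne_top_iff]; exact flen M

instance : IsNoetherian K (M →ₗ[K] DI K) := (isFiniteLength_iff_isNoetherian_isArtinian.1 (DI_fl M)).1
instance : IsArtinian K (M →ₗ[K] DI K) := (isFiniteLength_iff_isNoetherian_isArtinian.1 (DI_fl M)).2

theorem DI_ln : ln K (M →ₗ[K] DI K) = ln K M := by unfold ln; rw [DI_len]

variable {M} in
theorem DI_cog (x : M) (hx : x ≠ 0) : ∃ f : M →ₗ[K] DI K, f x ≠ 0 := by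
  have h1 : Nontrivial (Submodule.span K {x}) := by
    rw [Submodule.nontrivial_iff_ne_bot, Ne, Submodule.span_singleton_eq_bot]; exact hx
  have h2 : 0 < ln K (Submodule.span K {x} →ₗ[K] DI K) := by
    rw [DI_ln]; exact ln_pos
  have h3 : ∃ f : Submodule.span K {x} →ₗ[K] DI K, f ≠ 0 := by
    by_contra hc
    push Not at hc
    have : Subsingleton (Submodule.span K {x} →ₗ[K] DI K) := ⟨fun a b => by rw [hc a, hc b]⟩
    rw [ln_zero_iff.2 this] at h2
    omega
  obtain ⟨f, hf⟩ := h3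
  obtain ⟨g, hg⟩ := DI_ext (Submodule.span K {x}).subtype (Submodule.subtype_injective _) f
  refine ⟨g, fun h => hf ?_⟩
  ext ⟨y, hy⟩
  obtain ⟨k, rfl⟩ := Submodule.mem_span_singleton.1 hy
  rw [← hg]
  show g (k • x) = 0
  rw [map_smul, h, smul_zero]
end I

structure Anti (K R R' : Type u) [CommRing K] [Ring R] [Ring R'] [Algebra K R] [Algebra K R'] where
  a : R →+ R'
  b : R' →+ R
  ab : ∀ x, a (b x) = x
  ba : ∀ x, b (a x) = x
  a_mul : ∀ x y, a (x * y) = a y * a x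
  b_mul : ∀ x y, b (x * y) = b y * b x
  a_K : ∀ k : K, a (algebraMap K R k) = algebraMap K R' k
  b_K : ∀ k : K, b (algebraMap K R' k) = algebraMap K R k

def Anti.symm {K R R' : Type u} [CommRing K] [Ring R] [Ring R'] [Algebra K R] [Algebra K R'] (t : Anti K R R') :
    Anti K R' R := ⟨t.b, t.a, t.ba, t.ab, t.b_mul, t.a_mul, t.b_K, t.a_K⟩

section D
variable {K R R' : Type u} [CommRing K] [IsArtinianRing K] [Ring R] [Ring R'] [Algebra K R] [Algebra K R']
  [Module.Finite K R] [Module.Finite K R'] (t : Anti K R R')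

theorem k_smul (X : ModA R) (k : K) (x : X.M) : k • x = algebraMap K R k • x := rfl

theorem r_comm (X : ModA R) (k : K) (r : R) (x : X.M) : r • (k • x) = k • (r • x) := smul_comm r k x

@[reducible] def Dmod (X : ModA R) : Module R' (X.M →ₗ[K] DI K) where
  smul r p := { toFun := fun x => p (t.b r • x)
                map_add' := fun x y => by rw [smul_add, map_add]
                map_smul' := fun k x => by rw [r_comm, map_smul]; rfl }
  one_smul p := by
    ext x
    have : t.b 1 = 1 := by rw [← map_one (algebraMap K R'), t.b_K, map_one]
    show p (t.b 1 • x) = p x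
    rw [this, one_smul]
  mul_smul r s p := by
    ext x
    show p (t.b (r * s) • x) = p (t.b s • t.b r • x)
    rw [t.b_mul, mul_smul]
  smul_zero r := by ext x; rfl
  smul_add r p q := by ext x; rfl
  add_smul r s p := by
    ext x
    show p (t.b (r + s) • x) = p (t.b r • x) + p (t.b s • x)
    rw [map_add, add_smul, map_add]
  zero_smul p := by
    ext x
    show p (t.b 0 • x) = 0
    rw [map_zero, zero_smul, map_zero]

theorem Dtower (X : ModA R) : @IsScalarTower K R' (X.M →ₗ[K] DI K) _ (Dmod t X).toSMul _ := by
  letI := Dmod t X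
  refine ⟨fun k r p => ?_⟩
  ext x
  show p (t.b (k • r) • x) = k • p (t.b r • x)
  rw [Algebra.smul_def, t.b_mul, t.b_K, ← map_smul, mul_smul, k_smul]
  congr 1
  rw [← mul_smul, ← mul_smul, Algebra.commutes]

/-- dual module -/
noncomputable def D (X : ModA R) : ModA R' :=
  letI := Dmod t X
  haveI := Dtower t X
  { M := X.M →ₗ[K] DI K
    finLen := isFiniteLength_iff_isNoetherian_isArtinian.2
      ⟨isNoetherian_of_tower K inferInstance, isArtinian_of_tower K inferInstance⟩ }

variable {t} {X Y Z : ModA R}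

/-- evaluation pairing -/
def ap (p : (D t X).M) : X.M →ₗ[K] DI K := p
def mkD (p : X.M →ₗ[K] DI K) : (D t X).M := p

theorem ap_ext {p q : (D t X).M} (h : ∀ x, ap p x = ap q x) : p = q := LinearMap.ext h
@[simp] theorem ap_mk (p : X.M →ₗ[K] DI K) : ap (mkD (t := t) p) = p := rfl
@[simp] theorem ap_add (p q : (D t X).M) : ap (p + q) = ap p + ap q := rfl
@[simp] theorem ap_zero : ap (0 : (D t X).M) = 0 := rfl
@[simp] theorem ap_smul (r : R') (p : (D t X).M) (x : X.M) : ap (r • p) x = ap p (t.b r • x) := rfl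
@[simp] theorem ap_ksmul (k : K) (p : (D t X).M) (x : X.M) : ap (k • p) x = k • ap p x := by
  rw [k_smul, ap_smul, t.b_K, ← k_smul, map_smul]

theorem D_ln : ln K (D t X).M = ln K X.M := by
  rw [← DI_ln X.M]
  exact ln_equiv (R := K) (M := (D t X).M) (N := X.M →ₗ[K] DI K)
    { toFun := ap, invFun := mkD, map_add' := fun _ _ => rfl
      map_smul' := fun k p => by ext x; exact ap_ksmul k p x
      left_inv := fun _ => rfl, right_inv := fun _ => rfl }

variable (t) in
/-- dual map -/
def Dm (f : Hm X Y) : Hm (D t Y) (D t X) where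
  toFun p := mkD (ap p ∘ₗ f.restrictScalars K)
  map_add' _ _ := rfl
  map_smul' r p := by
    refine ap_ext fun x => ?_
    show ap p (t.b r • f x) = ap p (f (t.b r • x))
    rw [f.map_smul]

@[simp] theorem ap_Dm (f : Hm X Y) (p : (D t Y).M) (x : X.M) : ap (Dm t f p) x = ap p (f x) := rfl

theorem Dm_id : Dm t (LinearMap.id : Hm X X) = LinearMap.id := rfl
theorem Dm_comp (g : Hm Y Z) (f : Hm X Y) : Dm t (g ∘ₗ f) = Dm t f ∘ₗ Dm t g := rfl
theorem Dm_zero : Dm t (0 : Hm X Y) = 0 := by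
  ext p; refine ap_ext fun x => ?_
  rw [ap_Dm]; simp

variable (t X) in
/-- biduality -/
def ev : Hm X (D t.symm (D t X)) where
  toFun x := mkD
    { toFun := fun p => ap p x
      map_add' := fun _ _ => rfl
      map_smul' := fun k p => ap_ksmul k p x }
  map_add' x y := by refine ap_ext fun p => ?_; exact map_add (ap p) x y
  map_smul' r x := by
    refine ap_ext fun p => ?_
    show ap p (r • x) = ap (t.a r • p) x
    rw [ap_smul, t.ba]

@[simp] theorem ap_ev (x : X.M) (p : (D t X).M) : ap (ev t X x) p = ap p x := rfl

theorem ev_bij : Function.Bijective (ev t X) := by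
  have hi : Function.Injective ((ev t X).restrictScalars K) := by
    rw [← LinearMap.ker_eq_bot, eq_bot_iff]
    intro x hx
    by_contra h
    obtain ⟨f, hf⟩ := DI_cog (K := K) x h
    apply hf
    have h2 : ev t X x = 0 := hx
    have : ap (ev t X x) (mkD f) = 0 := by rw [h2]; rfl
    exact this
  have : Function.Bijective ((ev t X).restrictScalars K) := bij_of_inj_ln _ hi (by rw [D_ln, D_ln])
  exact this

theorem ev_nat (f : Hm X Y) : Dm t.symm (Dm t f) ∘ₗ ev t X = ev t Y ∘ₗ f := by
  ext x; rfl

theorem Dm_inj {f g : Hm X Y} (h : Dm t f = Dm t g) : f = g := by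
  ext x
  apply (ev_bij (t := t)).1
  have h1 := LinearMap.congr_fun (ev_nat (t := t) f) x
  have h2 := LinearMap.congr_fun (ev_nat (t := t) g) x
  rw [h] at h1
  exact h1.symm.trans h2

theorem Dm_full (g : Hm (D t Y) (D t X)) : ∃ f : Hm X Y, Dm t f = g := by
  obtain ⟨i, hi1, hi2⟩ := bij_inv (ev_bij (t := t) (X := Y))
  refine ⟨i ∘ₗ Dm t.symm g ∘ₗ ev t X, ?_⟩
  ext p
  refine ap_ext fun x => ?_
  rw [ap_Dm]
  have : ev t Y (i (Dm t.symm g (ev t X x))) = Dm t.symm g (ev t X x) := LinearMap.congr_fun hi2 _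
  have h2 : ap (ev t Y (i (Dm t.symm g (ev t X x)))) p = ap (Dm t.symm g (ev t X x)) p := by rw [this]
  exact h2

theorem D_indec (h : X.IsIndec) : (D t X).IsIndec := by
  refine ⟨?_, fun e he => ?_⟩
  · by_contra hc
    rw [not_nontrivial_iff_subsingleton, ← ln_zero_iff (R := K), D_ln, ln_zero_iff] at hc
    have := h.1
    exact not_subsingleton _ hc
  · obtain ⟨f, rfl⟩ := Dm_full e
    rcases h.2 f (Dm_inj (t := t) he) with h | h
    · left; rw [h, Dm_zero]
    · right; rw [h]; rfl

theorem Dm_surj {f : Hm X Y} (h : Function.Injective f) : Function.Surjective (Dm t f) := by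
  intro p
  obtain ⟨g, hg⟩ := DI_ext (f.restrictScalars K) h (ap p)
  exact ⟨mkD g, ap_ext hg⟩

theorem Dm_injective {f : Hm X Y} (h : Function.Surjective f) : Function.Injective (Dm t f) := by
  intro p q hpq
  refine ap_ext fun y => ?_
  obtain ⟨x, rfl⟩ := h y
  exact congrArg (fun p => ap p x) hpq

theorem Dm_exact {f : Hm X Y} {g : Hm Y Z} (h : LinearMap.range f = LinearMap.ker g) (hg : Function.Surjective g) :
    LinearMap.range (Dm t g) = LinearMap.ker (Dm t f) := by
  ext p
  constructor
  · rintro ⟨q, rfl⟩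
    rw [LinearMap.mem_ker]
    refine ap_ext fun x => ?_
    rw [ap_Dm, ap_Dm]
    have : f x ∈ LinearMap.ker g := h ▸ LinearMap.mem_range_self f x
    rw [LinearMap.mem_ker.1 this, map_zero]; rfl
  · intro hp
    rw [LinearMap.mem_ker] at hp
    obtain ⟨q, hq⟩ := DI_fac (g.restrictScalars K) (ap p) (by
      intro y hy
      have : y ∈ LinearMap.range f := h ▸ hy
      obtain ⟨x, rfl⟩ := this
      rw [← ap_Dm, hp]; rfl)
    exact ⟨mkD q, ap_ext hq⟩

theorem D_iso (h : X.Iso Y) : (D t Y).Iso (D t X) := by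
  obtain ⟨e⟩ := h
  exact iso_of_bij (f := Dm t e.toLinearMap) ⟨Dm_injective e.surjective, Dm_surj e.injective⟩

theorem ev_iso : X.Iso (D t.symm (D t X)) := iso_of_bij (f := ev t X) ev_bij

theorem D_epi {f : Hm X Y} : SplitEpiMap (Dm t f) ↔ SplitMonoMap f := by
  constructor
  · rintro ⟨s, hs⟩
    obtain ⟨r, rfl⟩ := Dm_full s
    exact ⟨r, Dm_inj (t := t) hs⟩
  · rintro ⟨r, hr⟩
    exact ⟨Dm t r, by
      show Dm t (r ∘ₗ f) = _
      have hr : r ∘ₗ f = LinearMap.id := hr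
      rw [hr]; rfl⟩

theorem D_mono {f : Hm X Y} : SplitMonoMap (Dm t f) ↔ SplitEpiMap f := by
  constructor
  · rintro ⟨s, hs⟩
    obtain ⟨r, rfl⟩ := Dm_full s
    exact ⟨r, Dm_inj (t := t) hs⟩
  · rintro ⟨r, hr⟩
    exact ⟨Dm t r, by
      show Dm t (f ∘ₗ r) = _
      have hr : f ∘ₗ r = LinearMap.id := hr
      rw [hr]; rfl⟩

/-- maps into `Z` are duals: for `h : D X → Z` there is `k : D Z → X` with `h` conjugate to `D k` -/
theorem dual_map {X : ModA R'} (h : Hm (D t.symm X) Z) : ∃ k : Hm (D t Z) X, Dm t.symm k = ev t Z ∘ₗ h :=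
  Dm_full (t := t.symm) (ev t Z ∘ₗ h)

end D
end
end CF
end

section
namespace CF
set_option linter.unusedSectionVars false
set_option linter.unusedVariables false
noncomputable section

theorem fac_surj {R : Type*} [Ring R] {A B C : Type*} [AddCommGroup A] [AddCommGroup B] [AddCommGroup C]
    [Module R A] [Module R B] [Module R C] (π : A →ₗ[R] B) (hπ : Function.Surjective π) (q : A →ₗ[R] C)
    (h : ∀ x, π x = 0 → q x = 0) : ∃ v : B →ₗ[R] C, ∀ x, v (π x) = q x := by
  refine ⟨(LinearMap.ker π).liftQ q (fun x hx => h x hx) ∘ₗ (π.quotKerEquivOfSurjective hπ).symm.toLinearMap, fun x => ?_⟩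
  have : (π.quotKerEquivOfSurjective hπ).symm (π x) = (LinearMap.ker π).mkQ x := by
    rw [LinearEquiv.symm_apply_eq]; rfl
  rw [LinearMap.comp_apply, LinearEquiv.coe_coe, this]; rfl

theorem fac_inj {R : Type*} [Ring R] {A B C : Type*} [AddCommGroup A] [AddCommGroup B] [AddCommGroup C]
    [Module R A] [Module R B] [Module R C] (i : A →ₗ[R] B) (hi : Function.Injective i) (q : C →ₗ[R] B)
    (h : ∀ x, q x ∈ LinearMap.range i) : ∃ v : C →ₗ[R] A, ∀ x, i (v x) = q x := by
  refine ⟨(LinearEquiv.ofInjective i hi).symm.toLinearMap ∘ₗ q.codRestrict _ h, fun x => ?_⟩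
  have := (LinearEquiv.ofInjective i hi).apply_symm_apply (q.codRestrict _ h x)
  exact congrArg Subtype.val this

theorem nR (K R : Type u) [CommRing K] [IsArtinianRing K] [Ring R] [Algebra K R] [Module.Finite K R] :
    IsNoetherianRing R := isNoetherian_of_tower K inferInstance
theorem aR (K R : Type u) [CommRing K] [IsArtinianRing K] [Ring R] [Algebra K R] [Module.Finite K R] :
    IsArtinianRing R := isArtinian_of_tower K inferInstance

section
variable (K R : Type u) [CommRing K] [IsArtinianRing K] [Ring R] [Algebra K R] [Module.Finite K R]

abbrev freeM (n : ℕ) : ModA R where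
  M := Fin n → R
  finLen := by
    have := nR K R
    have := aR K R
    exact isFiniteLength_iff_isNoetherian_isArtinian.2 ⟨inferInstance, inferInstance⟩

abbrev regM : ModA R where
  M := R
  finLen := by
    have := nR K R
    have := aR K R
    exact isFiniteLength_iff_isNoetherian_isArtinian.2 ⟨inferInstance, inferInstance⟩
end

section
variable {K R R' : Type u} [CommRing K] [IsArtinianRing K] [Ring R] [Ring R'] [Algebra K R] [Algebra K R']
  [Module.Finite K R] [Module.Finite K R']

variable (K) in
abbrev Dty (X : ModA R) := X.M →ₗ[K] DI K

def mkDty {P : ModA R} (f : P.M → DI K) (h1 : ∀ x y, f (x + y) = f x + f y)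
    (h2 : ∀ (k : K) x, f (algebraMap K R k • x) = k • f x) : Dty K P where
  toFun := f
  map_add' := h1
  map_smul' := h2

/-- right almost split -/
def IsRAS {E M : ModA R} (g : Hm E M) : Prop :=
  InRad g ∧ ∀ (Z : ModA R) (h : Hm Z M), InRad h → ∃ h' : Hm Z E, g ∘ₗ h' = h

def IsLAS {M E : ModA R} (g : Hm M E) : Prop :=
  InRad g ∧ ∀ (Z : ModA R) (h : Hm M Z), InRad h → ∃ h' : Hm E Z, h' ∘ₗ g = h

variable (K) in
/-- radical as K-submodule -/
def radS (X Y : ModA R) : Submodule K (Hm X Y) where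
  carrier := {f | InRad f}
  add_mem' := fun h h' => inRad_add h h'
  zero_mem' := inRad_zero
  smul_mem' := fun k f h => by
    have := inRad_comp_left h ((k • LinearMap.id : Hm Y Y))
    exact this

theorem exists_phi {M : ModA R} (hM : M.IsIndec) : ∃ φ : Hm M M →ₗ[K] DI K, (∀ f, InRad f → φ f = 0) ∧ φ LinearMap.id ≠ 0 := by
  obtain ⟨f, hf⟩ := DI_cog (K := K) ((radS K M M).mkQ LinearMap.id) (by
    rw [Ne, Submodule.mkQ_apply, Submodule.Quotient.mk_eq_zero]; exact id_not_rad hM)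
  refine ⟨f ∘ₗ (radS K M M).mkQ, fun g hg => ?_, hf⟩
  have : (radS K M M).mkQ g = 0 := (Submodule.Quotient.mk_eq_zero _).2 hg
  rw [LinearMap.comp_apply, this, map_zero]

theorem exists_RAS (t : Anti K R R') {M : ModA R} (hM : M.IsIndec) : ∃ (E : ModA R) (g : Hm E M), IsRAS g := by
  classical
  have := nR K R
  obtain ⟨φ, hφ, hφ1⟩ := exists_phi (K := K) hM
  obtain ⟨b, m, hm⟩ := hom_inj M
  let π : (Fin b → R) →ₗ[R] M.M := Fintype.linearCombination R m
  have hπ : ∀ y, π y = ∑ j, y j • m j := fun y => Fintype.linearCombination_apply R m y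
  have hπs : Function.Surjective π := by
    rw [← LinearMap.range_eq_top, Fintype.range_linearCombination]; exact hm
  obtain ⟨a, F, hF⟩ : ∃ a : ℕ, ∃ F : Fin a → (LinearMap.ker π), Submodule.span R (Set.range F) = ⊤ :=
    Module.Finite.exists_fin
  have hF0 : ∀ i, ∑ j, (F i).1 j • m j = 0 := fun i => by rw [← hπ]; exact (F i).2
  obtain ⟨Ψ, hΨ⟩ := DI_ext (evalGen (K := K) (Y := M) m) (evalGen_inj K m hm) φ
  -- relations determine homs
  have hrel : ∀ (X : ModA R) (x : Fin b → X.M), (∀ i, ∑ j, (F i).1 j • x j = 0) → ∃ v : Hm M X, ∀ j, v (m j) = x j := by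
    intro X x hx
    obtain ⟨v, hv⟩ := fac_surj π hπs (Fintype.linearCombination R x) (by
      intro y hy
      have hy' : (⟨y, hy⟩ : LinearMap.ker π) ∈ Submodule.span R (Set.range F) := hF ▸ Submodule.mem_top
      have : Submodule.span R (Set.range F) ≤ LinearMap.ker (Fintype.linearCombination R x ∘ₗ (LinearMap.ker π).subtype) := by
        rw [Submodule.span_le]
        rintro _ ⟨i, rfl⟩
        rw [SetLike.mem_coe, LinearMap.mem_ker, LinearMap.comp_apply, Fintype.linearCombination_apply]
        exact hx i
      exact this hy')
    refine ⟨v, fun j => ?_⟩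
    have h1 := hv (Pi.single j 1)
    have h2 : ∀ {Y : ModA R} (y : Fin b → Y.M), Fintype.linearCombination R y (Pi.single j 1) = y j := by
      intro Y y
      rw [Fintype.linearCombination_apply_single, one_smul]
    rw [h2, h2] at h1
    exact h1
  let P : ModA R' := freeM K R' a
  let W : ModA R := D t.symm P
  let Fm : (Fin b → R) → P.M := fun w i => t.a (∑ j, (F i).1 j * w j)
  have hpK : ∀ (p : W.M) (y z : P.M), ap p (y + z) = ap p y + ap p z := fun p y z => map_add _ _ _
  let E : Submodule R (W.M × M.M) :=
    { carrier := {px | ∀ w : Fin b → R, ap px.1 (Fm w) = Ψ fun j => w j • px.2}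
      add_mem' := by
        intro p q hp hq w
        show ap p.1 (Fm w) + ap q.1 (Fm w) = Ψ fun j => w j • (p.2 + q.2)
        rw [hp w, hq w, ← map_add]
        congr 1; ext j; simp [smul_add]
      zero_mem' := by
        intro w
        show 0 = Ψ fun j => w j • (0 : M.M)
        simp only [smul_zero]
        exact (map_zero Ψ).symm
      smul_mem' := by
        intro r p hp w
        show ap (r • p.1) (Fm w) = Ψ fun j => w j • (r • p.2)
        rw [ap_smul]
        have := hp (fun j => w j * r)
        simp only [mul_smul] at this
        rw [← this]
        congr 1
        ext i
        show t.a r * t.a _ = t.a _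
        rw [← t.a_mul, Finset.sum_mul]
        simp only [mul_assoc] }
  let EE : ModA R := bun R E
  let g : Hm EE M := LinearMap.snd R _ _ ∘ₗ E.subtype
  -- (A)
  have hA : ∀ (X : ModA R) (h : Hm X M), (∀ v : Hm M X, φ (h ∘ₗ v) = 0) → ∃ h' : Hm X EE, g ∘ₗ h' = h := by
    intro X h hv
    let FX : (Fin b → X.M) →ₗ[K] (Fin a → X.M) :=
      { toFun := fun x i => ∑ j, (F i).1 j • x j
        map_add' := fun x y => by ext i; simp [smul_add, Finset.sum_add_distrib]
        map_smul' := fun k x => by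
          ext i
          simp only [Pi.smul_apply, RingHom.id_apply, Finset.smul_sum]
          exact Finset.sum_congr rfl fun j _ => r_comm X k _ _ }
    let hb : (Fin b → X.M) →ₗ[K] (Fin b → M.M) := (h.restrictScalars K).compLeft (Fin b)
    obtain ⟨Λ, hΛ⟩ := DI_fac FX (Ψ ∘ₗ hb) (by
      intro x hx
      obtain ⟨v, hv'⟩ := hrel X x fun i => congrFun hx i
      rw [← hv v, ← hΨ, LinearMap.comp_apply]
      congr 1
      ext j
      show h (x j) = h (v (m j))
      rw [hv'])
    let l0 : X.M → Dty K P := fun x =>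
      mkDty (P := P) (fun y => Λ fun i => t.b (y i) • x)
        (fun y z => by
          rw [← map_add]; congr 1; ext i
          show t.b (y i + z i) • x = _
          rw [map_add, add_smul]; rfl)
        (fun k y => by
          rw [← map_smul]; congr 1; ext i
          show t.b (algebraMap K R' k * y i) • x = k • (t.b (y i) • x)
          rw [t.b_mul, t.b_K, mul_smul, ← k_smul, r_comm])
    let h0 : Hm X EE :=
      { toFun := fun x => ⟨(mkD (l0 x), h x), by
          intro w
          show Λ (fun i => t.b (t.a (∑ j, (F i).1 j * w j)) • x) = Ψ fun j => w j • h x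
          have := hΛ (fun j => w j • x)
          have e : FX (fun j => w j • x) = fun i => t.b (t.a (∑ j, (F i).1 j * w j)) • x := by
            ext i
            rw [t.ba, Finset.sum_smul]
            show ∑ j, (F i).1 j • (w j • x) = _
            exact Finset.sum_congr rfl fun j _ => (mul_smul ((F i).1 j) (w j) x).symm
          rw [e] at this
          rw [this, LinearMap.comp_apply]
          congr 1
          ext j
          exact h.map_smul _ _⟩
        map_add' := fun x y => by
          apply Subtype.ext
          refine Prod.ext ?_ (h.map_add x y)
          refine ap_ext fun z => ?_
          show Λ (fun i => t.b (z i) • (x + y)) = Λ (fun i => t.b (z i) • x) + Λ (fun i => t.b (z i) • y)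
          rw [← map_add]
          congr 1; ext i; simp [smul_add]
        map_smul' := fun r x => by
          apply Subtype.ext
          refine Prod.ext ?_ (h.map_smul r x)
          refine ap_ext fun z => ?_
          show Λ (fun i => t.b (z i) • (r • x)) = Λ (fun i => t.b (t.a r * z i) • x)
          congr 1; ext i
          rw [t.b_mul, t.ba, mul_smul] }
    exact ⟨h0, rfl⟩
  refine ⟨EE, g, ?_, fun Z h hh => hA Z h fun v => hφ _ (inRad_comp_right hh v)⟩
  rw [inRad_iff_epi hM]
  rintro ⟨s, hs⟩
  apply hφ1
  rw [← hΨ]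
  have hs2 : ∀ x, (s x).1.2 = x := fun x => LinearMap.congr_fun hs x
  have hc : ∀ x (w : Fin b → R), ap (s x).1.1 (Fm w) = Ψ fun j => w j • x := by
    intro x w
    have := (s x).2 w
    rw [hs2] at this
    exact this
  have e1 : evalGen (K := K) (Y := M) m LinearMap.id = ∑ j, fun j' => (Pi.single j (1 : R) : Fin b → R) j' • m j := by
    ext j'
    rw [Finset.sum_apply, Finset.sum_eq_single j']
    · rw [Pi.single_eq_same, one_smul]; rfl
    · intro j _ hj
      rw [Pi.single_eq_of_ne (Ne.symm hj), zero_smul]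
    · simp
  rw [e1, map_sum]
  have e2 : ∀ j, Ψ (fun j' => (Pi.single j (1 : R) : Fin b → R) j' • m j) =
      ∑ i, ap ((F i).1 j • (s (m j)).1.1) (Pi.single i (1 : R') : Fin a → R') := by
    intro j
    rw [← hc, ]
    have : Fm (Pi.single j 1) = ∑ i, (t.a ((F i).1 j) • (Pi.single i (1 : R') : Fin a → R')) := by
      ext i'
      rw [Finset.sum_apply, Finset.sum_eq_single i']
      · simp only [Pi.smul_apply, Pi.single_eq_same, smul_eq_mul, mul_one]
        show t.a _ = _
        congr 1
        rw [Finset.sum_eq_single j] <;> simp +contextual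
      · intro i _ hi
        rw [Pi.smul_apply, Pi.single_eq_of_ne (Ne.symm hi), smul_zero]
      · simp
    rw [this, map_sum]
    rfl
  simp only [e2]
  rw [Finset.sum_comm]
  refine Finset.sum_eq_zero fun i _ => ?_
  have e3 : ∀ j, ap ((F i).1 j • (s (m j)).1.1) (Pi.single i (1 : R') : Fin a → R') =
    ap (s ((F i).1 j • m j)).1.1 (Pi.single i (1 : R') : Fin a → R') := by
    intro j; rw [map_smul]; rfl
  simp only [e3]
  let ζ : M.M →+ DI K := 
    { toFun := fun x => ap (s x).1.1 (Pi.single i (1 : R') : Fin a → R')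
      map_zero' := by rw [map_zero]; rfl
      map_add' := fun x y => by rw [map_add]; rfl }
  show ∑ j, ζ ((F i).1 j • m j) = 0
  rw [← map_sum, hF0, map_zero]

end
end
end CF
end

section
namespace CF
set_option linter.unusedSectionVars false
set_option linter.unusedVariables false
noncomputable section

section seqs
variable {R : Type u} [Ring R]

theorem ses_split {A B C : ModA R} (f : Hm A B) (g : Hm B C) (hg : Function.Surjective g)
    (hex : LinearMap.range f = LinearMap.ker g) (h : SplitMonoMap f) : SplitEpiMap g := by
  obtain ⟨r, hr⟩ := h
  have hr' : ∀ x, r (f x) = x := fun x => LinearMap.congr_fun hr x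
  obtain ⟨v, hv⟩ := fac_surj g hg (LinearMap.id - f ∘ₗ r) (by
    intro x hx
    have : x ∈ LinearMap.range f := hex ▸ hx
    obtain ⟨a, rfl⟩ := this
    simp [hr'])
  refine ⟨v, ?_⟩
  ext y
  obtain ⟨x, rfl⟩ := hg y
  have h0 : g (f (r x)) = 0 := by
    have : f (r x) ∈ LinearMap.ker g := hex ▸ LinearMap.mem_range_self f _
    exact this
  show g (v (g x)) = g x
  rw [hv]; simp [h0]

variable (s : AlmostSplitSeq R)

abbrev AFf : Hm s.l s.m := s.f
abbrev AFg : Hm s.m s.r := s.g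

theorem s_gf (x) : s.g (s.f x) = 0 := by
  have : s.f x ∈ LinearMap.ker s.g := s.exact ▸ LinearMap.mem_range_self s.f x
  exact this

theorem s_gf0 {Z : ModA R} (z : Hm Z s.l) : s.g ∘ₗ (s.f ∘ₗ z) = 0 := by
  ext x; exact s_gf s _

theorem s_f_nsplit : ¬ SplitMonoMap s.f := fun h => s.not_split (ses_split s.f s.g s.surj s.exact h)
theorem s_g_rad : InRad s.g := (inRad_iff_epi s.r_indec).2 s.not_split
theorem s_f_rad : InRad s.f := (inRad_iff_mono s.l_indec).2 (s_f_nsplit s)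

theorem s_right {Z : ModA R} (h : Hm Z s.r) (hh : InRad h) : ∃ h' : Hm Z s.m, s.g ∘ₗ h' = h :=
  s.right_almost Z h ((inRad_iff_epi s.r_indec).1 hh)
theorem s_left {Z : ModA R} (h : Hm s.l Z) (hh : InRad h) : ∃ h' : Hm s.m Z, h' ∘ₗ s.f = h :=
  s.left_almost Z h ((inRad_iff_mono s.l_indec).1 hh)

theorem s_thru_f {Z : ModA R} (k : Hm Z s.m) (h : s.g ∘ₗ k = 0) : ∃ c : Hm Z s.l, s.f ∘ₗ c = k := by
  obtain ⟨c, hc⟩ := fac_inj s.f s.inj k (fun x => by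
    rw [s.exact]; exact LinearMap.congr_fun h x)
  exact ⟨c, LinearMap.ext hc⟩
theorem s_thru_g {Z : ModA R} (k : Hm s.m Z) (h : k ∘ₗ s.f = 0) : ∃ c : Hm s.r Z, c ∘ₗ s.g = k := by
  obtain ⟨c, hc⟩ := fac_surj s.g s.surj k (fun x hx => by
    have : x ∈ LinearMap.range s.f := s.exact ▸ hx
    obtain ⟨a, rfl⟩ := this
    exact LinearMap.congr_fun h a)
  exact ⟨c, LinearMap.ext hc⟩
theorem s_epi {Z : ModA R} {a b : Hm s.r Z} (h : a ∘ₗ s.g = b ∘ₗ s.g) : a = b := by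
  ext y; obtain ⟨x, rfl⟩ := s.surj y; exact LinearMap.congr_fun h x
theorem s_mono {Z : ModA R} {a b : Hm Z s.l} (h : s.f ∘ₗ a = s.f ∘ₗ b) : a = b := by
  ext y; exact s.inj (LinearMap.congr_fun h y)

theorem s_key (u : Hm s.r s.r) (v : Hm s.m s.m) (w : Hm s.l s.l) (h1 : v ∘ₗ s.f = s.f ∘ₗ w) (h2 : s.g ∘ₗ v = u ∘ₗ s.g) :
    InRad u ↔ InRad w := by
  constructor
  · intro hu
    obtain ⟨z, hz⟩ := s_right s u hu
    obtain ⟨c, hc⟩ := s_thru_f s (v - z ∘ₗ s.g) (by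
      rw [LinearMap.comp_sub, h2, ← LinearMap.comp_assoc, hz, sub_self])
    have : w = c ∘ₗ s.f := by
      apply s_mono s
      rw [← LinearMap.comp_assoc, hc, LinearMap.sub_comp, h1]
      ext x; simp [s_gf]
    rw [this]; exact inRad_comp_left (s_f_rad s) c
  · intro hw
    obtain ⟨k, hk⟩ := s_left s w hw
    obtain ⟨z, hz⟩ := s_thru_g s (v - s.f ∘ₗ k) (by
      rw [LinearMap.sub_comp, h1, LinearMap.comp_assoc, hk, sub_self])
    have : u = s.g ∘ₗ z := by
      apply s_epi s
      rw [LinearMap.comp_assoc, hz, LinearMap.comp_sub, h2]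
      ext x; simp [s_gf]
    rw [this]; exact inRad_comp_right (s_g_rad s) z

theorem s_lift (s s' : AlmostSplitSeq R) (φ : Hm s.r s'.r) : ∃ (v : Hm s.m s'.m) (w : Hm s.l s'.l),
    s'.g ∘ₗ v = φ ∘ₗ s.g ∧ v ∘ₗ s.f = s'.f ∘ₗ w := by
  obtain ⟨v, hv⟩ := s_right s' (φ ∘ₗ s.g) (inRad_comp_left (s_g_rad s) φ)
  obtain ⟨w, hw⟩ := s_thru_f s' (v ∘ₗ s.f) (by
    rw [← LinearMap.comp_assoc, hv]; ext x; simp [s_gf])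
  exact ⟨v, w, hv, hw.symm⟩
theorem s_ext (s s' : AlmostSplitSeq R) (ψ : Hm s.l s'.l) : ∃ (v : Hm s.m s'.m) (φ : Hm s.r s'.r),
    s'.g ∘ₗ v = φ ∘ₗ s.g ∧ v ∘ₗ s.f = s'.f ∘ₗ ψ := by
  obtain ⟨v, hv⟩ := s_left s (s'.f ∘ₗ ψ) (inRad_comp_right (s_f_rad s') ψ)
  obtain ⟨w, hw⟩ := s_thru_g s (s'.g ∘ₗ v) (by
    rw [LinearMap.comp_assoc, hv]; ext x; simp [s_gf])
  exact ⟨v, w, hw.symm, hv⟩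

theorem s_uniq (s s' : AlmostSplitSeq R) : s.r.Iso s'.r ↔ s.l.Iso s'.l := by
  constructor
  · rintro ⟨e⟩
    obtain ⟨v, w, h1, h2⟩ := s_lift s s' e.toLinearMap
    obtain ⟨v', w', h1', h2'⟩ := s_lift s' s e.symm.toLinearMap
    have hk := s_key s LinearMap.id (v' ∘ₗ v) (w' ∘ₗ w) (by
      rw [LinearMap.comp_assoc, h2, ← LinearMap.comp_assoc, h2', LinearMap.comp_assoc]) (by
      rw [← LinearMap.comp_assoc, h1', LinearMap.comp_assoc, h1, ← LinearMap.comp_assoc]; simp)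
    have hb : Function.Bijective (w' ∘ₗ w) := by
      by_contra hc
      exact id_not_rad s.r_indec (hk.2 ((inRad_iff_nbij s.l_indec s.l_indec).2 hc))
    exact iso_of_bij (bij_comp_indec s'.l_indec s.l_indec.1 hb).2
  · rintro ⟨e⟩
    obtain ⟨v, w, h1, h2⟩ := s_ext s s' e.toLinearMap
    obtain ⟨v', w', h1', h2'⟩ := s_ext s' s e.symm.toLinearMap
    have hk := s_key s (w' ∘ₗ w) (v' ∘ₗ v) LinearMap.id (by
      rw [LinearMap.comp_assoc, h2, ← LinearMap.comp_assoc, h2', LinearMap.comp_assoc]; simp) (by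
      rw [← LinearMap.comp_assoc, h1', LinearMap.comp_assoc, h1, ← LinearMap.comp_assoc])
    have hb : Function.Bijective (w' ∘ₗ w) := by
      by_contra hc
      exact id_not_rad s.l_indec (hk.1 ((inRad_iff_nbij s.r_indec s.r_indec).2 hc))
    exact iso_of_bij (bij_comp_indec s'.r_indec s.r_indec.1 hb).2
end seqs

section ex
variable {K R R' : Type u} [CommRing K] [IsArtinianRing K] [Ring R] [Ring R'] [Algebra K R] [Algebra K R']
  [Module.Finite K R] [Module.Finite K R']

variable (K) in
/-- indecomposable projectives: retracts of the regular module -/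
def IsP (M : ModA R) : Prop := ∃ p : Hm (regM K R) M, SplitEpiMap p

theorem exists_AR (t : Anti K R R') {M : ModA R} (hM : M.IsIndec) (hP : ¬ IsP K M) : ∃ s : AlmostSplitSeq R, s.r = M := by
  classical
  have hex : ∃ n, ∃ (E : ModA R) (g : Hm E M), IsRAS g ∧ ln R E.M = n := by
    obtain ⟨E, g, hg⟩ := exists_RAS t hM
    exact ⟨_, E, g, hg, rfl⟩
  obtain ⟨E, g, hg, hn⟩ := Nat.find_spec hex
  have hmin : ∀ (E' : ModA R) (g' : Hm E' M), IsRAS g' → ln R E.M ≤ ln R E'.M := by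
    intro E' g' hg'
    rw [hn]; exact Nat.find_min' hex ⟨E', g', hg', rfl⟩
  have hgs : Function.Surjective g := by
    intro x
    have h1 : InRad (X := regM K R) (Y := M) (LinearMap.toSpanSingleton R M.M x) := by
      rw [inRad_iff_epi hM]
      exact fun h => hP ⟨_, h⟩
    obtain ⟨h', hh⟩ := hg.2 _ _ h1
    refine ⟨h' (1 : R), ?_⟩
    have := LinearMap.congr_fun hh (1 : R)
    rw [LinearMap.comp_apply] at this
    rw [this]
    exact (LinearMap.toSpanSingleton_apply_one R M.M x)
  have hv : ∀ v : Hm E E, g ∘ₗ v = g → Function.Bijective v := by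
    intro v hv
    have hR : IsRAS (E := bun R (LinearMap.range v)) (M := M) (g ∘ₗ (LinearMap.range v).subtype) := by
      refine ⟨inRad_comp_right (Z := bun R (LinearMap.range v)) hg.1 (LinearMap.range v).subtype, fun Z h hh => ?_⟩
      obtain ⟨h', hh'⟩ := hg.2 Z h hh
      refine ⟨v.rangeRestrict ∘ₗ h', ?_⟩
      ext z
      have := LinearMap.congr_fun hv (h' z)
      have h2 := LinearMap.congr_fun hh' z
      exact this.trans h2
    have := hmin _ _ hR
    have hs : Function.Surjective v := by
      rw [← LinearMap.range_eq_top]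
      by_contra hc
      exact absurd this (not_le.2 (ln_sub_lt hc))
    exact bij_of_surj_ln v hs le_rfl
  have hnsp : ¬ SplitEpiMap g := (inRad_iff_epi hM).1 hg.1
  let L : ModA R := bun R (LinearMap.ker g)
  let f : Hm L E := (LinearMap.ker g).subtype
  have hfi : Function.Injective f := Submodule.subtype_injective _
  have hexa : LinearMap.range f = LinearMap.ker g := Submodule.range_subtype _
  have hgf : ∀ x, g (f x) = 0 := fun x => x.2
  have hleft : ∀ (Z : ModA R) (h : Hm L Z), ¬ SplitMonoMap h → ∃ h' : Hm E Z, h' ∘ₗ f = h := by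
    intro Z h hh
    obtain ⟨P, iB, iZ, q, e1, e2, e3, e4, e5, e6⟩ := pushout f g hfi hgs hexa h
    by_cases hq : SplitEpiMap q
    · obtain ⟨σ, hσ⟩ := hq
      obtain ⟨ρ, hρ⟩ := fac_inj iZ e2 (LinearMap.id - σ ∘ₗ q) (by
        intro x
        rw [e5, LinearMap.mem_ker]
        have := LinearMap.congr_fun hσ (q x)
        simp only [LinearMap.comp_apply, LinearMap.id_apply] at this
        simp [this])
      refine ⟨ρ ∘ₗ iB, ?_⟩
      ext x
      apply e2
      show iZ (ρ (iB (f x))) = _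
      rw [hρ]
      have h1 := LinearMap.congr_fun e3 (f x)
      have h2 := LinearMap.congr_fun e1 x
      simp only [LinearMap.comp_apply] at h1 h2
      rw [LinearMap.sub_apply, LinearMap.comp_apply, h1, hgf, map_zero, sub_zero]
      exact h2
    · exfalso
      obtain ⟨k, hk⟩ := hg.2 P q ((inRad_iff_epi hM).2 hq)
      obtain ⟨v', hv1, hv2⟩ := bij_inv (hv (k ∘ₗ iB) (by rw [← LinearMap.comp_assoc, hk, e3]))
      have hgv' : g ∘ₗ v' = g := by
        have : g ∘ₗ (k ∘ₗ iB) = g := by rw [← LinearMap.comp_assoc, hk, e3]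
        calc g ∘ₗ v' = (g ∘ₗ (k ∘ₗ iB)) ∘ₗ v' := by rw [this]
          _ = g := by rw [LinearMap.comp_assoc, hv2, LinearMap.comp_id]
      obtain ⟨c, hc⟩ := fac_inj f hfi (k ∘ₗ iZ) (by
        intro z
        rw [hexa, LinearMap.mem_ker]
        have := LinearMap.congr_fun hk (iZ z)
        exact this.trans (LinearMap.congr_fun e4 z))
      obtain ⟨w, hw⟩ := fac_inj f hfi (v' ∘ₗ f) (by
        intro z
        rw [hexa, LinearMap.mem_ker]
        exact (LinearMap.congr_fun hgv' (f z)).trans (hgf z))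
      apply hh
      refine ⟨w ∘ₗ c, ?_⟩
      ext x : 1
      apply hfi
      show f (w (c (h x))) = f x
      rw [hw, LinearMap.comp_apply, hc, LinearMap.comp_apply]
      have h2 := LinearMap.congr_fun e1 x
      simp only [LinearMap.comp_apply] at h2
      rw [← h2]
      exact LinearMap.congr_fun hv1 (f x)
  have hfn : ¬ SplitMonoMap f := fun h => hnsp (ses_split f g hgs hexa h)
  refine ⟨⟨L, E, M, f, g, hfi, hgs, hexa, hnsp, ⟨?_, ?_⟩, hM, fun Z h hh => hg.2 Z h ((inRad_iff_epi hM).2 hh), hleft⟩, rfl⟩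
  · by_contra hc
    rw [not_nontrivial_iff_subsingleton] at hc
    have hk : LinearMap.ker g = ⊥ := (Submodule.subsingleton_iff_eq_bot).1 hc
    obtain ⟨v, h1, h2⟩ := bij_inv (f := g) ⟨LinearMap.ker_eq_bot.1 hk, hgs⟩
    exact hnsp ⟨v, h2⟩
  · intro e he
    have he : ∀ x, e (e x) = e x := fun x => LinearMap.congr_fun he x
    by_contra hc
    push Not at hc
    obtain ⟨h1, h1'⟩ := hleft L e (by
      rintro ⟨r, hr⟩
      apply hc.2
      ext x : 1
      have := congrArg r (he x)
      have hr : ∀ x, r (e x) = x := fun x => LinearMap.congr_fun hr x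
      rw [hr, hr] at this
      exact this)
    obtain ⟨h2, h2'⟩ := hleft L (LinearMap.id - e) (by
      rintro ⟨r, hr⟩
      apply hc.1
      ext x : 1
      have hr : ∀ x, r (x - e x) = x := fun x => LinearMap.congr_fun hr x
      have := hr (e x)
      rw [he, sub_self, map_zero] at this
      exact this.symm)
    apply hfn
    refine ⟨h1 + h2, ?_⟩
    have : (h1 + h2) ∘ₗ f = e + (LinearMap.id - e) := by rw [LinearMap.add_comp, h1', h2']
    refine this.trans ?_
    abel

theorem ev_inv (t : Anti K R R') (X : ModA R) : ∃ v : Hm (D t.symm (D t X)) X, v ∘ₗ ev t X = LinearMap.id ∧ ev t X ∘ₗ v = LinearMap.id :=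
  bij_inv ev_bij

theorem exists_LAS (t : Anti K R R') {M : ModA R} (hM : M.IsIndec) : ∃ (E : ModA R) (g : Hm M E), IsLAS g := by
  obtain ⟨E, g, hg⟩ := exists_RAS t.symm (D_indec (t := t) hM)
  refine ⟨D t.symm E, Dm t.symm g ∘ₗ ev t M, ?_, ?_⟩
  · rw [inRad_iff_mono hM]
    rintro ⟨r, hr⟩
    have : SplitMonoMap (Dm t.symm g) := by
      refine ⟨ev t M ∘ₗ r, ?_⟩
      obtain ⟨v, h1, h2⟩ := ev_inv t M
      have hr : r ∘ₗ (Dm t.symm g ∘ₗ ev t M) = LinearMap.id := hr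
      calc ev t M ∘ₗ r ∘ₗ Dm t.symm g = ev t M ∘ₗ r ∘ₗ Dm t.symm g ∘ₗ (ev t M ∘ₗ v) := by rw [h2, LinearMap.comp_id]
        _ = ev t M ∘ₗ (r ∘ₗ (Dm t.symm g ∘ₗ ev t M)) ∘ₗ v := rfl
        _ = LinearMap.id := by rw [hr, LinearMap.id_comp, h2]
    exact (inRad_iff_epi (D_indec hM)).1 hg.1 (D_mono.1 this)
  · intro Z h hh
    obtain ⟨h', e⟩ := hg.2 (D t Z) (Dm t h) ((inRad_iff_epi (D_indec hM)).2 fun hc => (inRad_iff_mono hM).1 hh (D_epi.1 hc))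
    obtain ⟨v, h1, h2⟩ := ev_inv t Z
    refine ⟨v ∘ₗ Dm t.symm h', ?_⟩
    calc v ∘ₗ (Dm t.symm h' ∘ₗ Dm t.symm g) ∘ₗ ev t M = v ∘ₗ Dm t.symm (g ∘ₗ h') ∘ₗ ev t M := rfl
      _ = v ∘ₗ (ev t Z ∘ₗ h) := by rw [e, ev_nat]
      _ = h := by rw [← LinearMap.comp_assoc, h1, LinearMap.id_comp]

/-- dual sequence -/
def dualSeq (t : Anti K R R') (s : AlmostSplitSeq R') : AlmostSplitSeq R where
  l := D t.symm s.r
  m := D t.symm s.m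
  r := D t.symm s.l
  f := Dm t.symm s.g
  g := Dm t.symm s.f
  inj := Dm_injective s.surj
  surj := Dm_surj s.inj
  exact := Dm_exact s.exact s.surj
  not_split := fun h => s_f_nsplit s (D_epi.1 h)
  l_indec := D_indec s.r_indec
  r_indec := D_indec s.l_indec
  right_almost := by
    intro Z h hh
    obtain ⟨v, h1, h2⟩ := ev_inv t Z
    obtain ⟨k, hk⟩ := Dm_full (t := t.symm) (X := s.l) (Y := D t Z) (h ∘ₗ v)
    have hk' : ¬ SplitMonoMap k := by
      intro hc
      obtain ⟨σ, hσ⟩ := (D_epi (t := t.symm)).2 hc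
      apply hh
      refine ⟨v ∘ₗ σ, ?_⟩
      rw [hk] at hσ
      exact hσ
    obtain ⟨h', e⟩ := s.left_almost _ k hk'
    refine ⟨Dm t.symm h' ∘ₗ ev t Z, ?_⟩
    calc Dm t.symm (h' ∘ₗ s.f) ∘ₗ ev t Z = Dm t.symm k ∘ₗ ev t Z := by
          have e : h' ∘ₗ s.f = k := e
          rw [e]
      _ = h ∘ₗ (v ∘ₗ ev t Z) := by rw [hk]; rfl
      _ = h := by rw [h1, LinearMap.comp_id]
  left_almost := by
    intro Z h hh
    obtain ⟨v, h1, h2⟩ := ev_inv t Z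
    obtain ⟨k, hk⟩ := Dm_full (t := t.symm) (X := D t Z) (Y := s.r) (ev t Z ∘ₗ h)
    have hk' : ¬ SplitEpiMap k := by
      intro hc
      obtain ⟨σ, hσ⟩ := (D_mono (t := t.symm)).2 hc
      apply hh
      refine ⟨σ ∘ₗ ev t Z, ?_⟩
      rw [hk] at hσ
      exact hσ
    obtain ⟨h', e⟩ := s.right_almost _ k hk'
    refine ⟨v ∘ₗ Dm t.symm h', ?_⟩
    calc v ∘ₗ Dm t.symm (s.g ∘ₗ h') = v ∘ₗ Dm t.symm k := by
          have e : s.g ∘ₗ h' = k := e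
          rw [e]
      _ = (v ∘ₗ ev t Z) ∘ₗ h := by rw [hk]; rfl
      _ = h := by rw [h1, LinearMap.id_comp]

def IsI (t : Anti K R R') (X : ModA R) : Prop := IsP K (D t X)

theorem exists_AR' (t : Anti K R R') {X : ModA R} (hX : X.IsIndec) (hI : ¬ IsI t X) : ∃ s : AlmostSplitSeq R, s.l.Iso X := by
  obtain ⟨s, hs⟩ := exists_AR t.symm (D_indec (t := t) hX) hI
  refine ⟨dualSeq t s, ?_⟩
  show (D t.symm s.r).Iso X
  rw [hs]
  exact iso_symm ev_iso

theorem IsP.iso {X Y : ModA R} (h : IsP K X) (e : X.Iso Y) : IsP K Y := by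
  obtain ⟨p, σ, hσ⟩ := h
  obtain ⟨e⟩ := e
  refine ⟨e.toLinearMap ∘ₗ p, σ ∘ₗ e.symm.toLinearMap, ?_⟩
  ext x
  have := LinearMap.congr_fun hσ (e.symm x)
  have h2 := congrArg e this
  exact h2.trans (e.apply_symm_apply x)

theorem IsP.proj {X : ModA R} (h : IsP K X) : Module.Projective R X.M := by
  obtain ⟨p, σ, hσ⟩ := h
  have : Module.Projective R (regM K R).M := inferInstanceAs (Module.Projective R R)
  exact Module.Projective.of_split σ p hσ

theorem s_not_proj (s : AlmostSplitSeq R) : ¬ Module.Projective R s.r.M := by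
  intro h
  obtain ⟨σ, hσ⟩ := Module.projective_lifting_property s.g LinearMap.id s.surj
  exact s.not_split ⟨σ, hσ⟩

theorem s_not_P (s : AlmostSplitSeq R) : ¬ IsP K s.r := fun h => s_not_proj s h.proj

/-- finitely many indecomposable projectives up to iso -/
theorem P_fin (d : Dec (regM K R)) {X : ModA R} (hX : X.IsIndec) (h : IsP K X) : ∃ j, (d.N j).Iso X := by
  obtain ⟨p, σ, hσ⟩ := h
  obtain ⟨j, h1, h2⟩ := d.retract hX p σ (by
    have : p ∘ₗ σ = LinearMap.id := hσ
    rw [this]; exact bij_id)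
  exact ⟨j, iso_of_bij h1⟩

theorem IsI.iso {t : Anti K R R'} {X Y : ModA R} (h : IsI t X) (e : X.Iso Y) : IsI t Y := IsP.iso h (D_iso (iso_symm e))

theorem I_fin (t : Anti K R R') (d : Dec (regM K R')) {X : ModA R} (hX : X.IsIndec) (h : IsI t X) :
    ∃ j, (D t.symm (d.N j)).Iso X := by
  obtain ⟨j, hj⟩ := P_fin d (D_indec hX) h
  exact ⟨j, iso_trans (D_iso (t := t.symm) (iso_symm hj)) (iso_symm ev_iso)⟩
end ex
end
end CF
end

section
namespace CF
set_option linter.unusedSectionVars false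
set_option linter.unusedVariables false
noncomputable section

section arrows
variable {R : Type u} [Ring R]

theorem ras_rad2 {E M X : ModA R} {g : Hm E M} (hg : IsRAS g) {x : Hm X M} (hx : x ∈ radPow R 2 X M) :
    ∃ w : Hm X E, InRad w ∧ g ∘ₗ w = x := by
  refine rad2_ind (P := fun x => ∃ w : Hm X E, InRad w ∧ g ∘ₗ w = x) ⟨0, inRad_zero, by simp⟩ ?_ ?_ ?_ hx
  · rintro _ _ ⟨w, hw, rfl⟩ ⟨w', hw', rfl⟩
    exact ⟨w + w', inRad_add hw hw', LinearMap.comp_add _ _ _⟩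
  · rintro _ ⟨w, hw, rfl⟩
    exact ⟨-w, inRad_neg hw, LinearMap.comp_neg _ _⟩
  · intro Z a b ha hb
    obtain ⟨h', rfl⟩ := hg.2 Z b hb
    exact ⟨h' ∘ₗ a, inRad_comp_left ha h', rfl⟩

theorem las_rad2 {E M X : ModA R} {g : Hm M E} (hg : IsLAS g) {x : Hm M X} (hx : x ∈ radPow R 2 M X) :
    ∃ w : Hm E X, InRad w ∧ w ∘ₗ g = x := by
  refine rad2_ind (P := fun x => ∃ w : Hm E X, InRad w ∧ w ∘ₗ g = x) ⟨0, inRad_zero, by simp⟩ ?_ ?_ ?_ hx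
  · rintro _ _ ⟨w, hw, rfl⟩ ⟨w', hw', rfl⟩
    exact ⟨w + w', inRad_add hw hw', LinearMap.add_comp _ _ _⟩
  · rintro _ ⟨w, hw, rfl⟩
    exact ⟨-w, inRad_neg hw, LinearMap.neg_comp _ _⟩
  · intro Z a b ha hb
    obtain ⟨h', rfl⟩ := hg.2 Z a ha
    exact ⟨b ∘ₗ h', inRad_comp_right hb h', rfl⟩

theorem ras_arr {E M X : ModA R} {g : Hm E M} (hg : IsRAS g) (d : Dec E) (hX : X.IsIndec) (h : Arr X M) :
    ∃ j, (d.N j).Iso X := by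
  obtain ⟨x, hx, hx2⟩ := h
  obtain ⟨w, rfl⟩ := hg.2 X x hx
  by_contra hc
  push Not at hc
  apply hx2
  refine mem_rad2 ?_ hg.1
  rw [d.sum_comp w]
  refine inRad_sum _ _ fun j _ => inRad_comp_left ?_ _
  rw [inRad_iff_nbij hX (d.indec j)]
  exact fun hb => hc j (iso_symm (iso_of_bij hb))

theorem las_arr {E M X : ModA R} {g : Hm M E} (hg : IsLAS g) (d : Dec E) (hX : X.IsIndec) (h : Arr M X) :
    ∃ j, (d.N j).Iso X := by
  obtain ⟨x, hx, hx2⟩ := h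
  obtain ⟨w, rfl⟩ := hg.2 X x hx
  by_contra hc
  push Not at hc
  apply hx2
  refine mem_rad2 hg.1 ?_
  rw [d.comp_sum w]
  refine inRad_sum _ _ fun j _ => inRad_comp_right ?_ _
  rw [inRad_iff_nbij (d.indec j) hX]
  exact fun hb => hc j (iso_of_bij hb)

variable (s : AlmostSplitSeq R)
theorem s_ras : IsRAS (E := s.m) (M := s.r) s.g := ⟨s_g_rad s, fun Z h hh => s_right s h hh⟩
theorem s_las : IsLAS (M := s.l) (E := s.m) s.f := ⟨s_f_rad s, fun Z h hh => s_left s h hh⟩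

theorem s_ker_rad {Z : ModA R} (w : Hm Z s.m) (h : s.g ∘ₗ w = 0) : InRad w := by
  obtain ⟨c, rfl⟩ := s_thru_f s w h
  exact inRad_comp_right (s_f_rad s) c
theorem s_coker_rad {Z : ModA R} (w : Hm s.m Z) (h : w ∘ₗ s.f = 0) : InRad w := by
  obtain ⟨c, rfl⟩ := s_thru_g s w h
  exact inRad_comp_left (s_g_rad s) c

theorem s_rad2_right {X : ModA R} (w : Hm X s.m) : s.g ∘ₗ w ∈ radPow R 2 X s.r ↔ InRad w := by
  constructor
  · intro h
    obtain ⟨w', h1, h2⟩ := ras_rad2 (s_ras s) h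
    have := s_ker_rad s (w - w') (by rw [LinearMap.comp_sub, h2, sub_self])
    have h3 := inRad_add this h1
    rwa [sub_add_cancel] at h3
  · intro h; exact mem_rad2 h (s_g_rad s)
theorem s_rad2_left {X : ModA R} (w : Hm s.m X) : w ∘ₗ s.f ∈ radPow R 2 s.l X ↔ InRad w := by
  constructor
  · intro h
    obtain ⟨w', h1, h2⟩ := las_rad2 (s_las s) h
    have := s_coker_rad s (w - w') (by rw [LinearMap.sub_comp, h2, sub_self])
    have h3 := inRad_add this h1
    rwa [sub_add_cancel] at h3
  · intro h; exact mem_rad2 (s_f_rad s) h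

theorem dec_inc_nrad {X : ModA R} (d : Dec X) (j) : ¬ InRad (d.inc j) := fun h => by
  have := inRad_comp_left h (d.prj j)
  rw [d.pi_self] at this
  exact id_not_rad (d.indec j) this
theorem dec_prj_nrad {X : ModA R} (d : Dec X) (j) : ¬ InRad (d.prj j) := fun h => by
  have := inRad_comp_right h (d.inc j)
  rw [d.pi_self] at this
  exact id_not_rad (d.indec j) this

theorem s_arr_r (d : Dec s.m) (j) : Arr (d.N j) s.r :=
  ⟨s.g ∘ₗ d.inc j, inRad_comp_right (s_g_rad s) _, fun h => dec_inc_nrad d j ((s_rad2_right s _).1 h)⟩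
theorem s_arr_l (d : Dec s.m) (j) : Arr s.l (d.N j) :=
  ⟨d.prj j ∘ₗ s.f, inRad_comp_left (s_f_rad s) _, fun h => dec_prj_nrad d j ((s_rad2_left s _).1 h)⟩

theorem s_arr_r_iff (d : Dec s.m) {X : ModA R} (hX : X.IsIndec) : Arr X s.r ↔ ∃ j, (d.N j).Iso X :=
  ⟨fun h => ras_arr (s_ras s) d hX h, fun ⟨j, hj⟩ => (s_arr_r s d j).iso hj (iso_refl _)⟩
theorem s_arr_l_iff (d : Dec s.m) {X : ModA R} (hX : X.IsIndec) : Arr s.l X ↔ ∃ j, (d.N j).Iso X :=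
  ⟨fun h => las_arr (s_las s) d hX h, fun ⟨j, hj⟩ => (s_arr_l s d j).iso (iso_refl _) hj⟩

theorem dec_ln {X : ModA R} (d : Dec X) : ln R X.M = ∑ j, ln R (d.N j).M := by
  rw [← ln_pi]
  refine ln_equiv (LinearEquiv.ofLinearMap (LinearMap.pi d.prj) (∑ j, d.inc j ∘ₗ LinearMap.proj j) ?_ ?_)
  · refine LinearMap.ext fun x => funext fun i => ?_
    simp only [LinearMap.comp_apply, LinearMap.pi_apply, LinearMap.sum_apply, map_sum, LinearMap.proj_apply, LinearMap.id_apply]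
    rw [Finset.sum_eq_single i]
    · exact LinearMap.congr_fun (d.pi_self i) (x i)
    · intro j _ hj
      exact LinearMap.congr_fun (d.pi_ne i j (Ne.symm hj)) (x j)
    · simp
  · rw [← d.sum]
    ext x
    simp

theorem s_ln (d : Dec s.m) : ln R s.r.M + ln R s.l.M = ∑ j, ln R (d.N j).M := by
  rw [← dec_ln d, ln_exact s.f s.g s.inj s.surj s.exact, add_comm]
end arrows

section lns
variable {K : Type*} [CommRing K] {P A B : Type*} [AddCommGroup P] [AddCommGroup A] [AddCommGroup B]
  [Module K P] [Module K A] [Module K B]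

theorem surj_comp (f : P →ₗ[K] A) (g : A →ₗ[K] B) (hg : Function.Surjective g) (hf : Function.Surjective f) :
    Function.Surjective (g ∘ₗ f) := by
  rw [LinearMap.coe_comp]; exact hg.comp hf

theorem ln_quot (f : P →ₗ[K] A) (hf : Function.Surjective f) (S : Submodule K P) (h : ∀ x, f x = 0 ↔ x ∈ S) :
    ln K (P ⧸ S) = ln K A := by
  have : S = LinearMap.ker f := by ext x; exact (h x).symm
  rw [this]
  exact ln_equiv (f.quotKerEquivOfSurjective hf)

theorem ln_le_of [IsNoetherian K B] [IsArtinian K B] (α : P →ₗ[K] A) (hα : Function.Surjective α) (β : P →ₗ[K] B)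
    (h : ∀ x, β x = 0 → α x = 0) : ln K A ≤ ln K B := by
  obtain ⟨v, hv⟩ := fac_surj β.rangeRestrict (LinearMap.surjective_rangeRestrict β) α (by
    intro x hx
    exact h x (congrArg Subtype.val hx))
  refine le_trans (ln_surj v ?_) (ln_inj (LinearMap.range β).subtype (Submodule.subtype_injective _))
  intro a
  obtain ⟨p, rfl⟩ := hα a
  exact ⟨_, hv p⟩
end lns

section mult
variable (K : Type u) {R : Type u} [CommRing K] [IsArtinianRing K] [Ring R] [Algebra K R] [Module.Finite K R]

def qr (X Y : ModA R) : ℕ := ln K (Hm X Y ⧸ radS K X Y)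
def mu (X : ModA R) : ℕ := qr K X X

def rad2S (X Y : ModA R) : Submodule K (Hm X Y) where
  carrier := {f | f ∈ radPow R 2 X Y}
  add_mem' := fun h h' => (radPow R 2 X Y).add_mem h h'
  zero_mem' := (radPow R 2 X Y).zero_mem
  smul_mem' := fun k f h => by
    have h : f ∈ radPow R 2 X Y := h
    have := radPow_left h ((k • LinearMap.id : Hm Y Y))
    exact this

def irr (X Y : ModA R) : ℕ := ln K (radS K X Y ⧸ (rad2S K X Y).comap (radS K X Y).subtype)

theorem irr_right' (s : AlmostSplitSeq R) (X : ModA R) : irr K X s.r = qr K X s.m := by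
  let φ : Hm X s.m →ₗ[K] radS K X s.r := (postc K s.g).codRestrict _ fun w => inRad_comp_right (s_g_rad s) w
  let ψ := ((rad2S K X s.r).comap (radS K X s.r).subtype).mkQ ∘ₗ φ
  refine (ln_quot ψ ?_ (radS K X s.m) ?_).symm
  · refine surj_comp _ _ (Submodule.mkQ_surjective _) ?_
    rintro ⟨x, hx⟩
    obtain ⟨w, hw⟩ := s_right s x hx
    exact ⟨w, Subtype.ext hw⟩
  · intro w
    rw [LinearMap.comp_apply, Submodule.mkQ_apply, Submodule.Quotient.mk_eq_zero]
    exact s_rad2_right s w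
theorem irr_left' (s : AlmostSplitSeq R) (X : ModA R) : irr K s.l X = qr K s.m X := by
  let φ : Hm s.m X →ₗ[K] radS K s.l X := (prec K s.f).codRestrict _ fun w => inRad_comp_left (s_f_rad s) w
  let ψ := ((rad2S K s.l X).comap (radS K s.l X).subtype).mkQ ∘ₗ φ
  refine (ln_quot ψ ?_ (radS K s.m X) ?_).symm
  · refine surj_comp _ _ (Submodule.mkQ_surjective _) ?_
    rintro ⟨x, hx⟩
    obtain ⟨w, hw⟩ := s_left s x hx
    exact ⟨w, Subtype.ext hw⟩
  · intro w
    rw [LinearMap.comp_apply, Submodule.mkQ_apply, Submodule.Quotient.mk_eq_zero]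
    exact s_rad2_left s w

theorem qr_sum_right {E : ModA R} (d : Dec E) (X : ModA R) : qr K X E = ∑ j, qr K X (d.N j) := by
  unfold qr
  rw [← ln_pi]
  refine ln_quot (LinearMap.pi fun j => (radS K X (d.N j)).mkQ ∘ₗ postc K (d.prj j)) ?_ _ ?_
  · intro y
    choose z hz using fun j => Submodule.mkQ_surjective _ (y j)
    refine ⟨∑ j, d.inc j ∘ₗ z j, ?_⟩
    funext i
    rw [LinearMap.pi_apply, ← hz i]
    show (radS K X (d.N i)).mkQ (d.prj i ∘ₗ ∑ j, d.inc j ∘ₗ z j) = _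
    congr 1
    ext x
    simp only [LinearMap.comp_apply, LinearMap.sum_apply, map_sum]
    rw [Finset.sum_eq_single i]
    · exact LinearMap.congr_fun (d.pi_self i) (z i x)
    · intro j _ hj
      exact LinearMap.congr_fun (d.pi_ne i j (Ne.symm hj)) (z j x)
    · simp
  · intro w
    constructor
    · intro h
      show InRad w
      rw [d.sum_comp w]
      refine inRad_sum _ _ fun j _ => inRad_comp_left ?_ _
      exact (Submodule.Quotient.mk_eq_zero (radS K X (d.N j))).1 (congrFun h j)
    · intro h
      funext j
      exact (Submodule.Quotient.mk_eq_zero (radS K X (d.N j))).2 (inRad_comp_left h (d.prj j))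
theorem qr_sum_left {E : ModA R} (d : Dec E) (X : ModA R) : qr K E X = ∑ j, qr K (d.N j) X := by
  unfold qr
  rw [← ln_pi]
  refine ln_quot (LinearMap.pi fun j => (radS K (d.N j) X).mkQ ∘ₗ prec K (d.inc j)) ?_ _ ?_
  · intro y
    choose z hz using fun j => Submodule.mkQ_surjective _ (y j)
    refine ⟨∑ j, z j ∘ₗ d.prj j, ?_⟩
    funext i
    rw [LinearMap.pi_apply, ← hz i]
    show (radS K (d.N i) X).mkQ ((∑ j, z j ∘ₗ d.prj j) ∘ₗ d.inc i) = _
    congr 1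
    ext x
    simp only [LinearMap.comp_apply, LinearMap.sum_apply]
    rw [Finset.sum_eq_single i]
    · exact congrArg (z i) (LinearMap.congr_fun (d.pi_self i) x)
    · intro j _ hj
      exact (congrArg (z j) (LinearMap.congr_fun (d.pi_ne j i hj) x)).trans (map_zero _)
    · simp
  · intro w
    constructor
    · intro h
      show InRad w
      rw [d.comp_sum w]
      refine inRad_sum _ _ fun j _ => inRad_comp_right ?_ _
      exact (Submodule.Quotient.mk_eq_zero (radS K (d.N j) X)).1 (congrFun h j)
    · intro h
      funext j
      exact (Submodule.Quotient.mk_eq_zero (radS K (d.N j) X)).2 (inRad_comp_right h (d.inc j))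

theorem qr_zero {X Y : ModA R} (hX : X.IsIndec) (hY : Y.IsIndec) (h : ¬ X.Iso Y) : qr K X Y = 0 := by
  unfold qr
  rw [ln_zero_iff, Submodule.Quotient.subsingleton_iff, eq_top_iff]
  intro f _
  show InRad f
  rw [inRad_iff_nbij hX hY]
  exact fun hb => h (iso_of_bij hb)

theorem qr_iso_right {X Y Z : ModA R} (h : Y.Iso Z) : qr K X Y = qr K X Z := by
  obtain ⟨e⟩ := h
  refine ln_quot ((radS K X Z).mkQ ∘ₗ postc K e.toLinearMap) ?_ _ ?_
  · refine surj_comp _ _ (Submodule.mkQ_surjective _) ?_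
    intro z
    exact ⟨e.symm.toLinearMap ∘ₗ z, by ext x; exact e.apply_symm_apply _⟩
  · intro w
    rw [LinearMap.comp_apply, Submodule.mkQ_apply, Submodule.Quotient.mk_eq_zero]
    constructor
    · intro h
      have h : InRad (e.toLinearMap ∘ₗ w) := h
      have := inRad_comp_left h e.symm.toLinearMap
      have e2 : e.symm.toLinearMap ∘ₗ e.toLinearMap ∘ₗ w = w := by ext x; exact e.symm_apply_apply _
      rw [e2] at this
      exact this
    · intro h; exact inRad_comp_left h _
theorem qr_iso_left {X Y Z : ModA R} (h : Y.Iso Z) : qr K Y X = qr K Z X := by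
  obtain ⟨e⟩ := h
  refine (ln_quot ((radS K Y X).mkQ ∘ₗ prec K e.toLinearMap) ?_ _ ?_).symm
  · refine surj_comp _ _ (Submodule.mkQ_surjective _) ?_
    intro z
    exact ⟨z ∘ₗ e.symm.toLinearMap, by ext x; exact congrArg z (e.symm_apply_apply _)⟩
  · intro w
    rw [LinearMap.comp_apply, Submodule.mkQ_apply, Submodule.Quotient.mk_eq_zero]
    constructor
    · intro h
      have h : InRad (w ∘ₗ e.toLinearMap) := h
      have := inRad_comp_right h e.symm.toLinearMap
      have e2 : (w ∘ₗ e.toLinearMap) ∘ₗ e.symm.toLinearMap = w := by ext x; exact congrArg w (e.apply_symm_apply _)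
      rw [e2] at this
      exact this
    · intro h; exact inRad_comp_right h _

theorem mu_iso {X Y : ModA R} (h : X.Iso Y) : mu K X = mu K Y :=
  (qr_iso_right K h).trans (qr_iso_left K h)

theorem mu_pos {X : ModA R} (hX : X.IsIndec) : 0 < mu K X := by
  rw [Nat.pos_iff_ne_zero]
  intro h
  unfold mu qr at h
  rw [ln_zero_iff, Submodule.Quotient.subsingleton_iff] at h
  have : LinearMap.id ∈ radS K X X := h ▸ Submodule.mem_top
  exact id_not_rad hX this

open Classical in
theorem cnt_lem (s s' : AlmostSplitSeq R) (d : Dec s.m) (d' : Dec s'.m) :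
    (Finset.univ.filter fun j => (d.N j).Iso s'.r).card * mu K s'.r =
    (Finset.univ.filter fun j => (d'.N j).Iso s.l).card * mu K s.l := by
  have h1 : irr K s.l s'.r = (Finset.univ.filter fun j => (d.N j).Iso s'.r).card * mu K s'.r := by
    rw [irr_left', qr_sum_left K d, Finset.card_filter, Finset.sum_mul]
    refine Finset.sum_congr rfl fun j _ => ?_
    split_ifs with h
    · rw [one_mul]; exact qr_iso_left K h
    · rw [zero_mul]; exact qr_zero K (d.indec j) s'.r_indec h
  have h2 : irr K s.l s'.r = (Finset.univ.filter fun j => (d'.N j).Iso s.l).card * mu K s.l := by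
    rw [irr_right', qr_sum_right K d', Finset.card_filter, Finset.sum_mul]
    refine Finset.sum_congr rfl fun j _ => ?_
    split_ifs with h
    · rw [one_mul]; exact qr_iso_right K h
    · rw [zero_mul]; exact qr_zero K s.l_indec (d'.indec j) fun h' => h (iso_symm h')
  rw [← h1, h2]

theorem mu_mono (s : AlmostSplitSeq R) : mu K s.r ≤ mu K s.l := by
  let P : Submodule K (Hm s.r s.r × Hm s.m s.m × Hm s.l s.l) :=
    LinearMap.ker (postc K s.g ∘ₗ LinearMap.fst K (Hm s.m s.m) (Hm s.l s.l) ∘ₗ LinearMap.snd K (Hm s.r s.r) _ - prec K s.g ∘ₗ LinearMap.fst K (Hm s.r s.r) _) ⊓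
    LinearMap.ker (prec K s.f ∘ₗ LinearMap.fst K (Hm s.m s.m) (Hm s.l s.l) ∘ₗ LinearMap.snd K (Hm s.r s.r) _ -
      postc K s.f ∘ₗ LinearMap.snd K (Hm s.m s.m) (Hm s.l s.l) ∘ₗ LinearMap.snd K (Hm s.r s.r) _)
  have hP : ∀ p, p ∈ P ↔ s.g ∘ₗ p.2.1 = p.1 ∘ₗ s.g ∧ p.2.1 ∘ₗ s.f = s.f ∘ₗ p.2.2 := by
    intro p
    rw [Submodule.mem_inf, LinearMap.mem_ker, LinearMap.mem_ker, LinearMap.sub_apply, LinearMap.sub_apply, sub_eq_zero, sub_eq_zero]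
    exact Iff.rfl
  refine ln_le_of ((radS K s.r s.r).mkQ ∘ₗ LinearMap.fst K _ _ ∘ₗ P.subtype) ?_
    ((radS K s.l s.l).mkQ ∘ₗ LinearMap.snd K _ _ ∘ₗ LinearMap.snd K _ _ ∘ₗ P.subtype) ?_
  · refine surj_comp _ _ (Submodule.mkQ_surjective _) ?_
    intro u
    obtain ⟨v, w, h1, h2⟩ := s_lift s s u
    exact ⟨⟨(u, v, w), (hP _).2 ⟨h1, h2⟩⟩, rfl⟩
  · rintro ⟨⟨u, v, w⟩, hp⟩ h
    obtain ⟨h1, h2⟩ := (hP _).1 hp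
    have h : (radS K s.l s.l).mkQ w = 0 := h
    show (radS K s.r s.r).mkQ u = 0
    rw [Submodule.mkQ_apply, Submodule.Quotient.mk_eq_zero] at h ⊢
    exact (s_key s u v w h2 h1).2 h
end mult
end
end CF
end

section
namespace CF
set_option linter.unusedSectionVars false
set_option linter.unusedVariables false
noncomputable section

variable {K R : Type u} [CommRing K] [IsArtinianRing K] [Ring R] [Algebra K R] [Module.Finite K R]

theorem proj_cover (Ω : ModA R) (hex : ∃ (P : ModA R) (d : Hm P Ω), Module.Projective R P.M ∧ Function.Surjective d) :
    ∃ (P : ModA R) (d : Hm P Ω), Module.Projective R P.M ∧ Function.Surjective d ∧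
      ∀ S : Submodule R P.M, LinearMap.ker d ⊔ S = ⊤ → S = ⊤ := by
  classical
  have hex' : ∃ n, ∃ (P : ModA R) (d : Hm P Ω), (Module.Projective R P.M ∧ Function.Surjective d) ∧ ln R P.M = n := by
    obtain ⟨P, d, h⟩ := hex
    exact ⟨_, P, d, h, rfl⟩
  obtain ⟨P, d, ⟨hP, hd⟩, hn⟩ := Nat.find_spec hex'
  refine ⟨P, d, hP, hd, fun S hS => ?_⟩
  by_contra hc
  have hds : Function.Surjective (d ∘ₗ S.subtype) := by
    intro y
    obtain ⟨x, rfl⟩ := hd y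
    have : x ∈ LinearMap.ker d ⊔ S := hS ▸ Submodule.mem_top
    obtain ⟨a, ha, b, hb, rfl⟩ := Submodule.mem_sup.1 this
    refine ⟨⟨b, hb⟩, ?_⟩
    have ha : d a = 0 := ha
    simp [ha]
  obtain ⟨u, hu⟩ := Module.projective_lifting_property (d ∘ₗ S.subtype) d hds
  let v : Module.End R P.M := S.subtype ∘ₗ u
  have hv : ∀ x, d (v x) = d x := fun x => LinearMap.congr_fun hu x
  have hvn : ∀ n x, d ((v ^ n) x) = d x := by
    intro n
    induction n with
    | zero => intro x; simp
    | succ n ih => intro x; rw [pow_succ', Module.End.mul_apply, hv, ih]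
  obtain ⟨n, hn'⟩ := Filter.eventually_atTop.1 v.eventually_isCompl_ker_pow_range_pow
  have hcompl := hn' (n+1) (by omega)
  have hlt : ln R (LinearMap.range (v^(n+1))) < ln R P.M := by
    apply ln_sub_lt
    intro h
    apply hc
    rw [eq_top_iff, ← h]
    rintro _ ⟨x, rfl⟩
    rw [pow_succ', Module.End.mul_apply]
    exact (u _).2
  have hproj : Module.Projective R (LinearMap.range (v^(n+1))) :=
    Module.Projective.of_split (LinearMap.range (v^(n+1))).subtype
      (Submodule.projectionOnto _ _ hcompl.symm) (by
        ext x
        exact congrArg Subtype.val (Submodule.projectionOnto_apply_left hcompl.symm x))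
  have hmin := Nat.find_min' hex' ⟨bun R (LinearMap.range (v^(n+1))), d ∘ₗ (LinearMap.range (v^(n+1))).subtype,
    ⟨hproj, by
      intro y
      obtain ⟨x, rfl⟩ := hd y
      exact ⟨⟨(v^(n+1)) x, LinearMap.mem_range_self _ x⟩, hvn (n+1) x⟩⟩, rfl⟩
  rw [← hn] at hmin
  exact absurd hlt (not_lt.2 hmin)

instance (n : ℕ) : Module.Projective R (freeM K R n).M := inferInstanceAs (Module.Projective R (Fin n → R))

variable (K) in
theorem free_onto (X : ModA R) : ∃ (n : ℕ) (d : Hm (freeM K R n) X), Function.Surjective d := by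
  obtain ⟨n, m, hm⟩ := hom_inj X
  refine ⟨n, Fintype.linearCombination R m, ?_⟩
  rw [← LinearMap.range_eq_top, Fintype.range_linearCombination]; exact hm

theorem proj_IsP {X : ModA R} (hX : X.IsIndec) (h : Module.Projective R X.M) : IsP K X := by
  classical
  obtain ⟨n, d, hd⟩ := free_onto K X
  obtain ⟨σ, hσ⟩ := Module.projective_lifting_property d LinearMap.id hd
  have e : (∑ i, (d ∘ₗ LinearMap.single R (fun _ => R) i) ∘ₗ (LinearMap.proj i ∘ₗ σ) : Module.End R X.M) = LinearMap.id := by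
    rw [← hσ]
    ext x
    simp only [LinearMap.sum_apply, LinearMap.comp_apply]
    rw [← map_sum]
    congr 1
    exact LinearMap.sum_single_apply (fun _ => R) (σ x)
  obtain ⟨i, -, hi⟩ := bij_sum hX Finset.univ (fun i => (d ∘ₗ LinearMap.single R (fun _ => R) i) ∘ₗ (LinearMap.proj i ∘ₗ σ))
    (by rw [e]; exact bij_id)
  obtain ⟨v, h1, h2⟩ := bij_inv (X := X) (Y := X) hi
  exact ⟨d ∘ₗ LinearMap.single R (fun _ => R) i, (LinearMap.proj i ∘ₗ σ) ∘ₗ v, h2⟩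

variable (K) in
theorem hl_iso_left {X X' Y : ModA R} (h : X.Iso X') : hl K X Y = hl K X' Y := by
  obtain ⟨e⟩ := h
  refine (ln_equiv (LinearEquiv.ofBijective (prec K e.toLinearMap) ⟨fun a b h => ?_, fun b => ⟨b ∘ₗ e.symm.toLinearMap, ?_⟩⟩)).symm
  · ext x
    obtain ⟨y, rfl⟩ := e.surjective x
    exact LinearMap.congr_fun h y
  · ext x; exact congrArg b (e.symm_apply_apply x)
variable (K) in
theorem hl_iso_right {X X' Y : ModA R} (h : X.Iso X') : hl K Y X = hl K Y X' := by
  obtain ⟨e⟩ := h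
  refine (ln_equiv (LinearEquiv.ofBijective (postc K e.toLinearMap) ⟨fun a b h => ?_, fun b => ⟨e.symm.toLinearMap ∘ₗ b, ?_⟩⟩))
  · ext x
    exact e.injective (LinearMap.congr_fun h x)
  · ext x; exact e.apply_symm_apply _

variable (K) in
theorem hl_sum_left {E : ModA R} (d : Dec E) (X : ModA R) : hl K E X = ∑ j, hl K (d.N j) X := by
  unfold hl
  rw [← ln_pi]
  refine ln_equiv (LinearEquiv.ofBijective (LinearMap.pi fun j => prec K (d.inc j)) ⟨fun a b h => ?_, fun z => ⟨∑ j, z j ∘ₗ d.prj j, ?_⟩⟩)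
  · rw [d.comp_sum a, d.comp_sum b]
    refine Finset.sum_congr rfl fun j _ => ?_
    congr 1
    exact congrFun h j
  · funext i
    ext x
    show (∑ j, z j ∘ₗ d.prj j) (d.inc i x) = _
    simp only [LinearMap.comp_apply, LinearMap.sum_apply]
    rw [Finset.sum_eq_single i]
    · exact congrArg (z i) (LinearMap.congr_fun (d.pi_self i) x)
    · intro j _ hj
      exact (congrArg (z j) (LinearMap.congr_fun (d.pi_ne j i hj) x)).trans (map_zero _)
    · simp
variable (K) in
theorem hl_sum_right {E : ModA R} (d : Dec E) (X : ModA R) : hl K X E = ∑ j, hl K X (d.N j) := by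
  unfold hl
  rw [← ln_pi]
  refine ln_equiv (LinearEquiv.ofBijective (LinearMap.pi fun j => postc K (d.prj j)) ⟨fun a b h => ?_, fun z => ⟨∑ j, d.inc j ∘ₗ z j, ?_⟩⟩)
  · rw [d.sum_comp a, d.sum_comp b]
    refine Finset.sum_congr rfl fun j _ => ?_
    congr 1
    exact congrFun h j
  · funext i
    ext x
    show d.prj i ((∑ j, d.inc j ∘ₗ z j) x) = _
    simp only [LinearMap.comp_apply, LinearMap.sum_apply, map_sum]
    rw [Finset.sum_eq_single i]
    · exact LinearMap.congr_fun (d.pi_self i) (z i x)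
    · intro j _ hj
      exact LinearMap.congr_fun (d.pi_ne i j (Ne.symm hj)) (z j x)
    · simp

theorem hl_proj (dR : Dec (regM K R)) (P : ModA R) (hP : Module.Projective R P.M) :
    ∃ c : dR.ι → ℕ, ∀ X, hl K P X = ∑ j, c j * hl K (dR.N j) X := by
  classical
  obtain ⟨d⟩ := Dec.nonempty P
  have h1 : ∀ i, ∃ j, (dR.N j).Iso (d.N i) := fun i =>
    P_fin dR (d.indec i) (proj_IsP (d.indec i) (Module.Projective.of_split (d.inc i) (d.prj i) (d.pi_self i)))
  choose φ hφ using h1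
  refine ⟨fun j => (Finset.univ.filter fun i => φ i = j).card, fun X => ?_⟩
  rw [hl_sum_left K d, ← Finset.sum_fiberwise Finset.univ φ]
  refine Finset.sum_congr rfl fun j _ => ?_
  rw [← smul_eq_mul, ← Finset.sum_const]
  refine Finset.sum_congr rfl fun i hi => ?_
  rw [Finset.mem_filter] at hi
  rw [← hi.2]
  exact (hl_iso_left K (hφ i)).symm

/-- extensions of `s.r` by `Z` split if `Hom(Z, τ)=0` -/
theorem ext_zero (s : AlmostSplitSeq R) {A B Z : ModA R} (i : Hm A B) (g : Hm B s.r) (hi : Function.Injective i)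
    (hg : Function.Surjective g) (hex : LinearMap.range i = LinearMap.ker g) (hZ : ∀ c : Hm Z s.l, c = 0) (h : Hm A Z) :
    ∃ e : Hm B Z, e ∘ₗ i = h := by
  obtain ⟨P, iB, iZ, q, e1, e2, e3, e4, e5, e6⟩ := pushout i g hi hg hex h
  by_cases hq : SplitEpiMap q
  · obtain ⟨σ, hσ⟩ := hq
    obtain ⟨ρ, hρ⟩ := fac_inj iZ e2 (LinearMap.id - σ ∘ₗ q) (by
      intro x
      rw [e5, LinearMap.mem_ker]
      have := LinearMap.congr_fun hσ (q x)
      simp only [LinearMap.comp_apply, LinearMap.id_apply] at this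
      simp [this])
    refine ⟨ρ ∘ₗ iB, ?_⟩
    ext x
    apply e2
    show iZ (ρ (iB (i x))) = _
    rw [hρ]
    have h1 := LinearMap.congr_fun e3 (i x)
    have h2 := LinearMap.congr_fun e1 x
    have h3 : g (i x) = 0 := by
      have : i x ∈ LinearMap.ker g := hex ▸ LinearMap.mem_range_self i x
      exact this
    simp only [LinearMap.comp_apply] at h1 h2
    rw [LinearMap.sub_apply, LinearMap.comp_apply, h1, h3, map_zero, sub_zero]
    exact h2
  · exfalso
    obtain ⟨k, hk⟩ := s.right_almost P q hq
    have hk : s.g ∘ₗ k = q := hk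
    obtain ⟨c, hc⟩ := s_thru_f s (k ∘ₗ iZ) (by rw [← LinearMap.comp_assoc, hk, e4])
    rw [hZ c, LinearMap.comp_zero] at hc
    obtain ⟨k', hk'⟩ := fac_surj q e6 k (by
      intro x hx
      have : x ∈ LinearMap.range iZ := e5 ▸ hx
      obtain ⟨z, rfl⟩ := this
      exact (LinearMap.congr_fun hc z).symm)
    apply s.not_split
    refine ⟨k', ?_⟩
    ext y
    obtain ⟨x, rfl⟩ := e6 y
    show s.g (k' (q x)) = q x
    rw [hk']
    exact LinearMap.congr_fun hk x

theorem pres_hl (dR : Dec (regM K R)) (s : AlmostSplitSeq R) : ∃ c : dR.ι → ℤ, ∀ X : ModA R,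
    (∀ (X' : ModA R) (p : Hm X X'), Function.Surjective p → ∀ c : Hm X' s.l, c = 0) →
    (hl K s.r X : ℤ) = ∑ j, c j * hl K (dR.N j) X := by
  obtain ⟨P0, π, hP0, hπ⟩ : ∃ (P0 : ModA R) (π : Hm P0 s.r), Module.Projective R P0.M ∧ Function.Surjective π := by
    obtain ⟨m, d, hd⟩ := free_onto K s.r
    exact ⟨_, d, inferInstance, hd⟩
  let Ω : ModA R := bun R (LinearMap.ker π)
  let i : Hm Ω P0 := (LinearMap.ker π).subtype
  have hi : Function.Injective i := Submodule.subtype_injective _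
  have hex : LinearMap.range i = LinearMap.ker π := Submodule.range_subtype _
  obtain ⟨P1, d, hP1, hd, hsup⟩ := proj_cover Ω (by
    obtain ⟨m, d, hd⟩ := free_onto K Ω
    exact ⟨_, d, inferInstance, hd⟩)
  obtain ⟨c0, hc0⟩ := hl_proj dR P0 hP0
  obtain ⟨c1, hc1⟩ := hl_proj dR P1 hP1
  refine ⟨fun j => (c0 j : ℤ) - c1 j, fun X hX => ?_⟩
  have key : ln K (Hm P0 X) = ln K (Hm s.r X) + ln K (Hm P1 X) := by
    refine ln_exact (prec K π) (prec K (i ∘ₗ d)) ?_ ?_ ?_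
    · intro a b h
      ext x
      obtain ⟨y, rfl⟩ := hπ x
      exact LinearMap.congr_fun h y
    · intro q
      let S : Submodule R X.M := (LinearMap.ker d).map q
      obtain ⟨qb, hqb⟩ := fac_surj d hd (S.mkQ ∘ₗ q) (by
        intro x hx
        rw [LinearMap.comp_apply, Submodule.mkQ_apply, Submodule.Quotient.mk_eq_zero]
        exact ⟨x, hx, rfl⟩)
      obtain ⟨e', he'⟩ := ext_zero s (Z := bun R (X.M ⧸ S)) i π hi hπ hex
        (hX (bun R (X.M ⧸ S)) S.mkQ (Submodule.mkQ_surjective S)) qb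
      obtain ⟨e, he⟩ := Module.projective_lifting_property S.mkQ e' (Submodule.mkQ_surjective S)
      refine ⟨e, ?_⟩
      show e ∘ₗ (i ∘ₗ d) = q
      have hz : ∀ x, (q - e ∘ₗ (i ∘ₗ d)) x ∈ S := by
        intro x
        rw [← Submodule.Quotient.mk_eq_zero, ← Submodule.mkQ_apply, LinearMap.sub_apply, map_sub, sub_eq_zero]
        have h1 := hqb x
        have h2 := LinearMap.congr_fun he' (d x)
        have h3 := LinearMap.congr_fun he (i (d x))
        exact h1.symm.trans (h2.symm.trans h3.symm)
      have hker : LinearMap.ker (q - e ∘ₗ (i ∘ₗ d)) = ⊤ := by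
        apply hsup
        rw [eq_top_iff]
        intro x _
        obtain ⟨k, hk, hk2⟩ := hz x
        have hk0 : d k = 0 := hk
        have : x = k + (x - k) := by abel
        rw [this]
        refine Submodule.add_mem_sup hk ?_
        rw [LinearMap.mem_ker, map_sub, ← hk2, sub_eq_zero]
        simp [hk0]
      have := LinearMap.ker_eq_top.1 hker
      rw [sub_eq_zero] at this
      exact this.symm
    · ext q
      constructor
      · rintro ⟨r, rfl⟩
        rw [LinearMap.mem_ker]
        ext x
        show r (π (i (d x))) = 0
        have : π (i (d x)) = 0 := (d x).2
        rw [this, map_zero]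
      · intro hq
        have hq : q ∘ₗ (i ∘ₗ d) = 0 := hq
        obtain ⟨v, hv⟩ := fac_surj π hπ q (by
          intro x hx
          obtain ⟨y, hy⟩ := hd ⟨x, hx⟩
          have := LinearMap.congr_fun hq y
          simp only [LinearMap.comp_apply] at this
          rw [hy] at this
          exact this)
        exact ⟨v, LinearMap.ext hv⟩
  have e0 := hc0 X
  have e1 := hc1 X
  have key' : hl K P0 X = hl K s.r X + hl K P1 X := key
  rw [e0, e1] at key'
  have : (hl K s.r X : ℤ) = (∑ j, c0 j * hl K (dR.N j) X : ℕ) - (∑ j, c1 j * hl K (dR.N j) X : ℕ) := by omega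
  rw [this]
  push_cast
  rw [← Finset.sum_sub_distrib]
  exact Finset.sum_congr rfl fun j _ => by ring

theorem tau_rigid (dR : Dec (regM K R)) {ι : Type*} [Fintype ι] (s : ι → AlmostSplitSeq R)
    (hne : ∀ i j, (s i).r.Iso (s j).r → i = j) (h0 : ∀ i j (h : Hm (s i).r (s j).l), h = 0) :
    Fintype.card ι ≤ Fintype.card dR.ι := by
  classical
  by_contra hcard
  push Not at hcard
  choose c hc using fun i => pres_hl dR (s i)
  have hdep : ¬ LinearIndependent ℚ (fun i j => (c i j : ℚ) : ι → dR.ι → ℚ) := by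
    intro h
    have := h.fintype_card_le_finrank
    rw [Module.finrank_fintype_fun_eq_card] at this
    omega
  obtain ⟨a, ha, i1, hi1⟩ := Fintype.not_linearIndependent_iff.1 hdep
  -- modules generated by the family
  have hrel : ∀ X : ModA R, (∀ (Z : ModA R) (h : Hm X Z), (∀ i (b : Hm (s i).r X), h ∘ₗ b = 0) → h = 0) →
      ∑ i, a i * (hl K (s i).r X : ℚ) = 0 := by
    intro X hX
    have h1 : ∀ i, (hl K (s i).r X : ℚ) = ∑ j, (c i j : ℚ) * hl K (dR.N j) X := by
      intro i
      have := hc i X (by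
        intro X' p hp e
        have : e ∘ₗ p = 0 := hX _ _ fun j b => by
          rw [LinearMap.comp_assoc]; exact h0 j i _
        ext x
        obtain ⟨y, rfl⟩ := hp x
        exact LinearMap.congr_fun this y)
      have h2 := congrArg (fun z : ℤ => (z : ℚ)) this
      push_cast at h2
      exact h2
    simp only [h1, Finset.mul_sum]
    rw [Finset.sum_comm]
    refine Finset.sum_eq_zero fun j _ => ?_
    have := congrFun ha j
    simp only [Finset.sum_apply, Pi.smul_apply, smul_eq_mul, Pi.zero_apply] at this
    calc ∑ i, a i * ((c i j : ℚ) * hl K (dR.N j) X) = (∑ i, a i * (c i j : ℚ)) * hl K (dR.N j) X := by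
          rw [Finset.sum_mul]; exact Finset.sum_congr rfl fun _ _ => by ring
      _ = 0 := by rw [this, zero_mul]
  let T : ∀ i, Submodule R (s i).r.M := fun i =>
    Submodule.span R {y | ∃ j, a j ≠ 0 ∧ ∃ b : Hm (s j).r (s i).r, InRad b ∧ y ∈ LinearMap.range b}
  have hT : ∃ i0, a i0 ≠ 0 ∧ T i0 ≠ ⊤ := by
    by_contra hcon
    push Not at hcon
    let Q : ModA R → Prop := fun X => ∃ j, a j ≠ 0 ∧ X = (s j).r
    have hgen : ∀ n i, a i ≠ 0 → Submodule.span R {y | ∃ j, ∃ f : Hm (s j).r (s i).r, RC Q n _ _ f ∧ y ∈ LinearMap.range f} = ⊤ := by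
      intro n
      induction n with
      | zero =>
        intro i hi
        rw [eq_top_iff]
        intro x _
        exact Submodule.subset_span ⟨i, LinearMap.id, RC.nil _ ⟨i, hi, rfl⟩, x, rfl⟩
      | succ n ih =>
        intro i hi
        rw [eq_top_iff, ← hcon i hi]
        refine Submodule.span_le.2 ?_
        rintro _ ⟨j, hj, b, hb, z, rfl⟩
        have hz : z ∈ Submodule.span R {y | ∃ j', ∃ f : Hm (s j').r (s j).r, RC Q n _ _ f ∧ y ∈ LinearMap.range f} :=
          ih j hj ▸ Submodule.mem_top
        have := Submodule.mem_map_of_mem (f := b) hz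
        rw [Submodule.map_span] at this
        refine Submodule.span_mono ?_ this
        rintro _ ⟨y, ⟨j', f, hf, w, rfl⟩, rfl⟩
        exact ⟨j', b ∘ₗ f, hf.snoc b ((inRad_iff_nbij (s j).r_indec (s i).r_indec).1 hb) ⟨i, hi, rfl⟩, w, rfl⟩
    let bd := ∑ i, ln R (s i).r.M
    have := hgen (2^bd - 1) i1 hi1
    have hbot : Submodule.span R {y | ∃ j, ∃ f : Hm (s j).r (s i1).r, RC Q (2^bd - 1) _ _ f ∧ y ∈ LinearMap.range f} = ⊥ := by
      rw [eq_bot_iff]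
      refine Submodule.span_le.2 ?_
      rintro _ ⟨j, f, hf, x, rfl⟩
      have := hf.zero bd (by
        rintro X ⟨j, hj, rfl⟩
        exact ⟨(s j).r_indec, Finset.single_le_sum (f := fun i => ln R (s i).r.M) (fun _ _ => Nat.zero_le _) (Finset.mem_univ j)⟩)
      rw [this]; simp
    rw [hbot] at this
    have hnt : Nontrivial (s i1).r.M := (s i1).r_indec.1
    exact bot_ne_top this
  obtain ⟨i0, hi0, hT0⟩ := hT
  let TT : ModA R := bun R (T i0)
  have r1 := hrel (s i0).r (fun Z h hh => hh i0 LinearMap.id)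
  have hmem : ∀ j, a j ≠ 0 → ∀ b : Hm (s j).r (s i0).r, InRad b → ∀ x, b x ∈ T i0 := fun j hj b hb x =>
    Submodule.subset_span ⟨j, hj, b, hb, x, rfl⟩
  have r2 := hrel TT (by
    intro Z h hh
    have : ∀ y (hy : y ∈ T i0), h ⟨y, hy⟩ = 0 := by
      intro y hy
      induction hy using Submodule.span_induction with
      | mem y hy =>
        obtain ⟨j, hj, b, hb, x, rfl⟩ := hy
        exact LinearMap.congr_fun (hh j (b.codRestrict (T i0) (hmem j hj b hb))) x
      | zero => exact map_zero h
      | add x y hx hy h1 h2 =>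
        have := map_add h ⟨x, hx⟩ ⟨y, hy⟩
        rw [h1, h2, add_zero] at this
        exact this
      | smul r x hx h1 =>
        have := map_smul h r ⟨x, hx⟩
        rw [h1, smul_zero] at this
        exact this
    ext ⟨y, hy⟩
    exact this y hy)
  have hinj : ∀ j, Function.Injective (postc K (X := (s j).r) (Y := TT) (Z := (s i0).r) (T i0).subtype) := by
    intro j a b h
    ext x
    exact LinearMap.congr_fun h x
  have heq : ∀ j, j ≠ i0 → a j ≠ 0 → hl K (s j).r TT = hl K (s j).r (s i0).r := by
    intro j hj haj
    refine ln_equiv (LinearEquiv.ofBijective _ ⟨hinj j, fun b => ?_⟩)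
    have hb : InRad b := (inRad_iff_nbij (s j).r_indec (s i0).r_indec).2 fun hb => hj (hne _ _ (iso_of_bij hb))
    exact ⟨b.codRestrict (T i0) (hmem j haj b hb), rfl⟩
  have hlt : hl K (s i0).r TT < hl K (s i0).r (s i0).r := by
    by_contra hge
    push Not at hge
    obtain ⟨b, hb⟩ := (@bij_of_inj_ln K _ _ _ _ _ _ _ (knoethH K (s i0).r TT) (kartH K (s i0).r TT) (knoethH K (s i0).r (s i0).r) (kartH K (s i0).r (s i0).r) _ (hinj i0) hge).2 LinearMap.id
    apply hT0
    rw [eq_top_iff]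
    intro x _
    have := LinearMap.congr_fun hb x
    have h2 : (b x).1 = x := this
    rw [← h2]
    exact (b x).2
  have hdiff : ∑ i, a i * ((hl K (s i).r (s i0).r : ℚ) - hl K (s i).r TT) = 0 := by
    simp only [mul_sub, Finset.sum_sub_distrib]
    rw [r1, r2, sub_zero]
  rw [Finset.sum_eq_single i0] at hdiff
  · rcases mul_eq_zero.1 hdiff with h | h
    · exact hi0 h
    · have : (hl K (s i0).r TT : ℚ) < hl K (s i0).r (s i0).r := by exact_mod_cast hlt
      linarith
  · intro j _ hj
    by_cases haj : a j = 0
    · rw [haj, zero_mul]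
    · rw [heq j hj haj, sub_self, mul_zero]
  · simp
end
end CF
end

section
namespace CF
set_option linter.unusedSectionVars false
set_option linter.unusedVariables false
noncomputable section
open Relation

variable {R : Type u} [Ring R]

/-- a nonzero nonisomorphism between indecomposables -/
def Pr (x y : IndecModA R) : Prop := ∃ f : Hm x.1 y.1, f ≠ 0 ∧ ¬ Function.Bijective f

theorem Pr.iso {x y x' y' : IndecModA R} (h : Pr x y) (hx : x.1.Iso x'.1) (hy : y.1.Iso y'.1) : Pr x' y' := by
  obtain ⟨f, h0, hb⟩ := h
  obtain ⟨a⟩ := hx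
  obtain ⟨b⟩ := hy
  refine ⟨b.toLinearMap ∘ₗ f ∘ₗ a.symm.toLinearMap, ?_, ?_⟩
  · intro h
    apply h0
    ext z
    have := LinearMap.congr_fun h (a z)
    simpa using this
  · intro h
    apply hb
    have e : (f : x.1.M → y.1.M) = b.symm ∘ (b.toLinearMap ∘ₗ f ∘ₗ a.symm.toLinearMap) ∘ a := by
      funext z
      simp
    rw [e]
    exact b.symm.bijective.comp (h.comp a.bijective)

theorem tp_iso_right {x y y' : IndecModA R} (h : TransGen Pr x y) (hy : y.1.Iso y'.1) : TransGen Pr x y' := by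
  cases h with
  | single h => exact .single (h.iso (iso_refl _) hy)
  | tail h1 h2 => exact .tail h1 (h2.iso (iso_refl _) hy)

theorem tp_iso_left {x x' y : IndecModA R} (h : TransGen Pr x y) (hx : x.1.Iso x'.1) : TransGen Pr x' y := by
  induction h with
  | single h => exact .single (h.iso hx (iso_refl _))
  | tail h1 h2 ih => exact .tail ih h2

theorem Arr.pr {x y : IndecModA R} (h : Arr x.1 y.1) : Pr x y := by
  obtain ⟨f, hf, hn⟩ := h
  refine ⟨f, ?_, (inRad_iff_nbij x.2 y.2).1 hf⟩
  rintro rfl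
  exact hn (zero_mem _)

/-- the strong component of `m` -/
def Cy (m x : IndecModA R) : Prop := TransGen Pr m x ∧ TransGen Pr x m

theorem Cy.iso {m x x' : IndecModA R} (h : Cy m x) (hx : x.1.Iso x'.1) : Cy m x' :=
  ⟨tp_iso_right h.1 hx, tp_iso_left h.2 hx⟩

theorem Cy.conv {m x y z : IndecModA R} (hx : Cy m x) (hz : Cy m z) (h1 : TransGen Pr x y) (h2 : TransGen Pr y z) :
    Cy m y := ⟨hx.1.trans h1, h2.trans hz.2⟩

theorem Cy.tr {m x y : IndecModA R} (hx : Cy m x) (hy : Cy m y) : TransGen Pr x y := hx.2.trans hy.1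

theorem path_of {α : Type*} {r : α → α → Prop} {a b : α} (h : ReflTransGen r a b) :
    ∃ (n : ℕ) (p : ℕ → α), p 0 = a ∧ p n = b ∧ ∀ i < n, r (p i) (p (i+1)) := by
  induction h using ReflTransGen.head_induction_on with
  | refl => exact ⟨0, fun _ => b, rfl, rfl, by simp⟩
  | head hab _ ih =>
    rename_i a c _
    obtain ⟨n, p, h0, hn, hs⟩ := ih
    refine ⟨n+1, fun i => Nat.casesOn i a p, rfl, hn, ?_⟩
    intro i hi
    cases i with
    | zero => show r a (p 0); rw [h0]; exact hab
    | succ i => exact hs i (by omega)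

theorem path_thru {α : Type*} {r : α → α → Prop} {a m b : α} (h : ReflTransGen r a m) (h' : ReflTransGen r m b) :
    ∃ (n : ℕ) (p : ℕ → α), p 0 = a ∧ p n = b ∧ (∃ k ≤ n, p k = m) ∧ ∀ i < n, r (p i) (p (i+1)) := by
  induction h using ReflTransGen.head_induction_on with
  | refl =>
    obtain ⟨n, p, h0, hn, hs⟩ := path_of h'
    exact ⟨n, p, h0, hn, ⟨0, Nat.zero_le _, h0⟩, hs⟩
  | head hab _ ih =>
    rename_i a c _
    obtain ⟨n, p, h0, hn, ⟨k, hk, hk'⟩, hs⟩ := ih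
    refine ⟨n+1, fun i => Nat.casesOn i a p, rfl, hn, ⟨k+1, by omega, hk'⟩, ?_⟩
    intro i hi
    cases i with
    | zero => show r a (p 0); rw [h0]; exact hab
    | succ i => exact hs i (by omega)

/-- all maps in the component of `m` are finite -/
def fx (m : IndecModA R) : Prop := TransGen Pr m m ∧
  ∀ (x y : IndecModA R), Cy m x → Cy m y → ∀ f : Hm x.1 y.1, f ≠ 0 → ¬ Function.Bijective f → ¬ InRadInf f

theorem cyc_self (c : ModCycle R) (i : Fin (c.len+1)) : TransGen Pr (⟨c.obj i, c.obj_indec i⟩ : IndecModA R) ⟨c.obj i, c.obj_indec i⟩ := by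
  let o : Fin (c.len+1) → IndecModA R := fun i => ⟨c.obj i, c.obj_indec i⟩
  have hcl : o (Fin.last _) = o 0 := Subtype.ext c.closed
  have hstep : ∀ i : Fin c.len, Pr (o i.castSucc) (o i.succ) := fun i => ⟨c.hom i, c.hom_ne_zero i, c.hom_not_iso i⟩
  have h1 : ∀ i, ReflTransGen Pr (o 0) (o i) := by
    intro i
    induction i using Fin.induction with
    | zero => exact .refl
    | succ i ih => exact .tail ih (hstep i)
  have h2 : ∀ i, ReflTransGen Pr (o i) (o (Fin.last _)) := by
    intro i
    induction i using Fin.reverseInduction with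
    | last => exact .refl
    | cast i ih => exact .head (hstep i) ih
  have h3 : ∀ i : Fin c.len, TransGen Pr (o i.castSucc) (o i.castSucc) := by
    intro i
    refine TransGen.head' (hstep i) ((h2 _).trans ?_)
    rw [hcl]; exact h1 _
  show TransGen Pr (o i) (o i)
  induction i using Fin.lastCases with
  | last =>
    rw [hcl]
    have := h3 ⟨0, c.len_pos⟩
    exact this
  | cast i => exact h3 i

theorem fx_of {m : IndecModA R} (h : IsCycleFiniteModule m.1) : fx m := by
  obtain ⟨⟨c, i, hi⟩, h⟩ := h
  refine ⟨?_, ?_⟩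
  · have := cyc_self c i
    exact tp_iso_right (tp_iso_left this (x' := m) hi) hi
  · intro x y hx hy f hf0 hfb hinf
    obtain ⟨n, p, h0, hn, ⟨k, hk, hk'⟩, hs⟩ := path_thru hy.2.to_reflTransGen hx.1.to_reflTransGen
    let q : ℕ → IndecModA R := fun i => Nat.casesOn i x p
    have hq : ∀ i : Fin (n+1), ∃ g : Hm (q i).1 (q (i+1)).1, g ≠ 0 ∧ ¬ Function.Bijective g ∧ (i = 0 → InRadInf g) := by
      intro i
      induction i using Fin.cases with
      | zero =>
        have e : q (((0 : Fin (n+1)) : ℕ) + 1) = y := h0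
        have : ∀ z : IndecModA R, z = y → ∃ g : Hm x.1 z.1, g ≠ 0 ∧ ¬ Function.Bijective g ∧ InRadInf g := by
          rintro z rfl
          exact ⟨f, hf0, hfb, hinf⟩
        obtain ⟨g, a, b, d⟩ := this _ e
        exact ⟨g, a, b, fun _ => d⟩
      | succ i =>
        obtain ⟨g, a, b⟩ := hs i i.2
        exact ⟨g, a, b, fun h => absurd h (Fin.succ_ne_zero i)⟩
    choose g hg0 hgb hgi using hq
    let c' : ModCycle R :=
      { len := n+1
        len_pos := Nat.succ_pos _
        obj := fun i => (q i).1
        obj_indec := fun i => (q i).2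
        closed := by
          show (p n).1 = x.1
          rw [hn]
        hom := fun i => g i
        hom_ne_zero := hg0
        hom_not_iso := hgb }
    refine h c' ⟨⟨k+1, by show k+1 < n+1+1; omega⟩, ?_⟩ 0 (hgi 0 rfl)
    show (p k).1.Iso m.1
    rw [hk']; exact iso_refl _

theorem fx.move {m p : IndecModA R} (h : fx m) (hp : Cy m p) : fx p ∧ Cy p m := by
  refine ⟨⟨hp.tr hp, fun x y hx hy => h.2 x y ?_ ?_⟩, hp.2, hp.1⟩
  · exact ⟨hp.1.trans hx.1, hx.2.trans hp.2⟩
  · exact ⟨hp.1.trans hy.1, hy.2.trans hp.2⟩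

/-- vertices of the component -/
def VC (m : IndecModA R) : Type (u+1) := {v : ARVertex R // Cy m (Quotient.out v)}

variable {m : IndecModA R}

def rep (v : VC m) : IndecModA R := Quotient.out v.1
theorem rep_cy (v : VC m) : Cy m (rep v) := v.2

theorem out_iso (x : IndecModA R) : (Quotient.out (ARVertex.mk x)).1.Iso x.1 := Quotient.mk_out (s := isoSetoid R) x

def vx (x : IndecModA R) (h : Cy m x) : VC m := ⟨ARVertex.mk x, h.iso (iso_symm (out_iso x))⟩

theorem rep_vx (x : IndecModA R) (h : Cy m x) : (rep (vx x h)).1.Iso x.1 := out_iso x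

theorem mk_eq {x y : IndecModA R} : ARVertex.mk x = ARVertex.mk y ↔ x.1.Iso y.1 :=
  ⟨fun h => Quotient.exact (s := isoSetoid R) h, fun h => Quotient.sound (s := isoSetoid R) h⟩

theorem vx_eq {x : IndecModA R} {h : Cy m x} {v : VC m} : vx x h = v ↔ x.1.Iso (rep v).1 := by
  rw [← mk_eq]
  constructor
  · rintro rfl
    exact (Quotient.out_eq _).symm
  · intro e
    exact Subtype.ext (e.trans (Quotient.out_eq _))

theorem rep_inj {v w : VC m} (h : (rep v).1.Iso (rep w).1) : v = w := by
  have : vx (rep v) (rep_cy v) = v := vx_eq.2 (iso_refl _)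
  rw [← this]
  exact vx_eq.2 h

theorem vx_rep (v : VC m) : vx (rep v) (rep_cy v) = v := vx_eq.2 (iso_refl _)

def arrV (v w : VC m) : Prop := Arr (rep v).1 (rep w).1

theorem lift_path {r : IndecModA R → IndecModA R → Prop} (hr : ∀ x y, r x y → TransGen Pr x y)
    (hs : ∀ x y (hx : Cy m x) (hy : Cy m y), r x y → TransGen arrV (vx x hx) (vx y hy)) {x y : IndecModA R}
    (h : TransGen r x y) : ∀ (hx : Cy m x) (hy : Cy m y), TransGen arrV (vx x hx) (vx y hy) := by
  have hp : ∀ {a b}, TransGen r a b → TransGen Pr a b := by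
    intro a b h
    induction h with
    | single h => exact hr _ _ h
    | tail _ h ih => exact ih.trans (hr _ _ h)
  induction h with
  | single h => exact fun hx hy => hs _ _ hx hy h
  | tail h1 h2 ih =>
    intro hx hy
    have hz := hx.conv hy (hp h1) (hr _ _ h2)
    exact (ih hx hz).trans (hs _ _ hz hy h2)

theorem conn_V (hm : fx m) (v w : VC m) : TransGen arrV v w := by
  rw [← vx_rep v, ← vx_rep w]
  refine lift_path (r := Pr) (fun _ _ h => .single h) ?_ ((rep_cy v).tr (rep_cy w)) _ _
  intro x y hx hy hxy
  obtain ⟨f, hf0, hfb⟩ := hxy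
  have := arr_path' x.2 y.2 ((inRad_iff_nbij x.2 y.2).2 hfb) (hm.2 x y hx hy f hf0 hfb)
  refine lift_path (r := fun x y => Arr x.1 y.1) (fun _ _ h => .single (Arr.pr h)) ?_ this _ _
  intro a b ha hb h
  exact .single (h.iso (iso_symm (rep_vx a ha)) (iso_symm (rep_vx b hb)))

/-- the ends of an almost split sequence -/
def sl (s : AlmostSplitSeq R) : IndecModA R := ⟨s.l, s.l_indec⟩
def sr (s : AlmostSplitSeq R) : IndecModA R := ⟨s.r, s.r_indec⟩
def dn {X : ModA R} (d : Dec X) (j : d.ι) : IndecModA R := ⟨d.N j, d.indec j⟩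

theorem pr_l (s : AlmostSplitSeq R) (d : Dec s.m) (j : d.ι) : Pr (sl s) (dn d j) := Arr.pr (x := sl s) (y := dn d j) (s_arr_l s d j)
theorem pr_r (s : AlmostSplitSeq R) (d : Dec s.m) (j : d.ι) : Pr (dn d j) (sr s) := Arr.pr (x := dn d j) (y := sr s) (s_arr_r s d j)

theorem s_prec (s : AlmostSplitSeq R) : TransGen Pr (sl s) (sr s) := by
  obtain ⟨d⟩ := Dec.nonempty s.m
  have : Nonempty d.ι := by
    by_contra h
    rw [not_nonempty_iff] at h
    have := s_ln s d
    rw [Finset.sum_of_isEmpty] at this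
    have hnt : Nontrivial s.r.M := s.r_indec.1
    have := ln_pos (R := R) (M := s.r.M)
    omega
  obtain ⟨j⟩ := this
  exact .tail (.single (pr_l s d j)) (pr_r s d j)

theorem mesh_cy {s : AlmostSplitSeq R} (hl : Cy m (sl s)) (hr : Cy m (sr s)) (d : Dec s.m) (j : d.ι) : Cy m (dn d j) :=
  hl.conv hr (.single (pr_l s d j)) (.single (pr_r s d j))

/-- the left and right boundary -/
def LC (m : IndecModA R) : Set (VC m) := {v | ∀ s : AlmostSplitSeq R, s.r.Iso (rep v).1 → ¬ Cy m (sl s)}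
def RRC (m : IndecModA R) : Set (VC m) := {v | ∀ s : AlmostSplitSeq R, s.l.Iso (rep v).1 → ¬ Cy m (sr s)}

theorem hom_l_zero {s : AlmostSplitSeq R} {x : IndecModA R} (hx : Cy m x) (hr : Cy m (sr s)) (hl : ¬ Cy m (sl s))
    (h : Hm x.1 s.l) : h = 0 := by
  by_contra h0
  apply hl
  by_cases hb : Function.Bijective h
  · exact hx.iso (x' := sl s) (iso_of_bij hb)
  · exact hx.conv hr (.single ⟨h, h0, hb⟩) (s_prec s)

theorem hom_r_zero {s : AlmostSplitSeq R} {x : IndecModA R} (hx : Cy m x) (hl : Cy m (sl s)) (hr : ¬ Cy m (sr s))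
    (h : Hm s.r x.1) : h = 0 := by
  by_contra h0
  apply hr
  by_cases hb : Function.Bijective h
  · exact hx.iso (x' := sr s) (iso_symm (iso_of_bij hb))
  · exact hl.conv hx (s_prec s) (.single ⟨h, h0, hb⟩)

theorem fin_of_cover {ι : Type*} [Finite ι] (x : ι → IndecModA R) (S : Set (VC m)) (h : ∀ v ∈ S, ∃ j, (x j).1.Iso (rep v).1) :
    S.Finite := by
  have : S ⊆ Subtype.val ⁻¹' (Set.range fun j => ARVertex.mk (x j)) := by
    intro v hv
    obtain ⟨j, hj⟩ := h v hv
    exact ⟨j, (mk_eq.2 hj).trans (Quotient.out_eq _)⟩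
  exact ((Set.finite_range _).preimage Subtype.val_injective.injOn).subset this

end
end CF
end

section
namespace CF
set_option linter.unusedSectionVars false
set_option linter.unusedVariables false
noncomputable section
open Relation

variable {K R R' : Type u} [CommRing K] [IsArtinianRing K] [Ring R] [Ring R'] [Algebra K R] [Algebra K R']
  [Module.Finite K R] [Module.Finite K R']
variable {m : IndecModA R}

theorem rigid_fin (dR : Dec (regM K R)) (S : Set (VC m)) (s : S → AlmostSplitSeq R)
    (hne : ∀ i j, (s i).r.Iso (s j).r → i = j) (h0 : ∀ i j (h : Hm (s i).r (s j).l), h = 0) : S.Finite := by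
  by_contra hinf
  obtain ⟨T, hTS, hT, hc⟩ := Set.Infinite.exists_subset_ncard_eq hinf (Fintype.card dR.ι + 1)
  have : Fintype T := hT.fintype
  have := tau_rigid (K := K) dR (ι := T) (fun i => s ⟨i.1, hTS i.2⟩) (fun i j h => by
    have := hne _ _ h
    exact Subtype.ext (congrArg (fun z : S => z.1) this)) (fun i j h => h0 _ _ h)
  rw [← Nat.card_eq_fintype_card (α := T)] at this
  have e : Nat.card T = T.ncard := rfl
  omega

theorem LC_fin (t : Anti K R R') (m : IndecModA R) : (LC m).Finite := by
  obtain ⟨dR⟩ := Dec.nonempty (regM K R)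
  let S : Set (VC m) := {v | v ∈ LC m ∧ ¬ IsP K (rep v).1}
  have h1 : {v : VC m | IsP K (rep v).1}.Finite :=
    fin_of_cover (fun j => dn dR j) _ (fun v hv => P_fin dR (rep v).2 hv)
  have h2 : S.Finite := by
    have hs : ∀ v : S, ∃ s : AlmostSplitSeq R, s.r = (rep v.1).1 := fun v => exists_AR t (rep v.1).2 v.2.2
    choose s hs using hs
    have hs' : ∀ v : S, (s v).r.Iso (rep v.1).1 := fun v => hs v ▸ iso_refl _
    have hr : ∀ v : S, Cy m (sr (s v)) := fun v => (rep_cy v.1).iso (x' := sr (s v)) (iso_symm (hs' v))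
    refine rigid_fin dR S s ?_ ?_
    · intro i j h
      exact Subtype.ext (rep_inj (iso_trans (iso_symm (hs' i)) (iso_trans h (hs' j))))
    · intro i j h
      exact hom_l_zero (x := sr (s i)) (hr i) (hr j) (j.2.1 _ (hs' j)) h
  refine (h1.union h2).subset fun v hv => ?_
  by_cases h : IsP K (rep v).1
  · exact Or.inl h
  · exact Or.inr ⟨hv, h⟩

theorem RRC_fin (t : Anti K R R') (m : IndecModA R) : (RRC m).Finite := by
  obtain ⟨dR⟩ := Dec.nonempty (regM K R)
  obtain ⟨dR'⟩ := Dec.nonempty (regM K R')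
  let S : Set (VC m) := {v | v ∈ RRC m ∧ ¬ IsI t (rep v).1}
  have h1 : {v : VC m | IsI t (rep v).1}.Finite :=
    fin_of_cover (fun j => ⟨D t.symm (dR'.N j), D_indec (dR'.indec j)⟩) _ (fun v hv => I_fin t dR' (rep v).2 hv)
  have h2 : S.Finite := by
    have hs : ∀ v : S, ∃ s : AlmostSplitSeq R, s.l.Iso (rep v.1).1 := fun v => exists_AR' t (rep v.1).2 v.2.2
    choose s hs using hs
    have hl : ∀ v : S, Cy m (sl (s v)) := fun v => (rep_cy v.1).iso (x' := sl (s v)) (iso_symm (hs v))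
    refine rigid_fin dR S s ?_ ?_
    · intro i j h
      exact Subtype.ext (rep_inj (iso_trans (iso_symm (hs i)) (iso_trans ((s_uniq _ _).1 h) (hs j))))
    · intro i j h
      exact hom_r_zero (x := sl (s j)) (hl j) (hl i) (i.2.1 _ (hs i)) h
  refine (h1.union h2).subset fun v hv => ?_
  by_cases h : IsI t (rep v).1
  · exact Or.inl h
  · exact Or.inr ⟨hv, h⟩

variable (K) in
theorem hl_step_l (s : AlmostSplitSeq R) {x z : ModA R} (hx : x.IsIndec) (hz : z.IsIndec) (h : Arr x s.r)
    (h0 : ∀ c : Hm z s.l, c = 0) : hl K z x ≤ hl K z s.r ∧ (z.Iso s.r → hl K z x < hl K z s.r) := by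
  obtain ⟨d⟩ := Dec.nonempty s.m
  obtain ⟨j, hj⟩ := (s_arr_r_iff s d hx).1 h
  have h1 : hl K z x ≤ hl K z s.m := by
    rw [hl_sum_right K d, ← hl_iso_right K hj]
    exact Finset.single_le_sum (f := fun j => hl K z (d.N j)) (fun _ _ => Nat.zero_le _) (Finset.mem_univ j)
  have hinj : Function.Injective (postc K (X := z) s.g) := by
    rw [← LinearMap.ker_eq_bot, eq_bot_iff]
    intro k hk
    obtain ⟨c, hc⟩ := s_thru_f s k hk
    rw [Submodule.mem_bot, ← hc, h0 c, LinearMap.comp_zero]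
  have h2 : hl K z s.m ≤ hl K z s.r := ln_inj _ hinj
  refine ⟨h1.trans h2, fun e => lt_of_le_of_ne (h1.trans h2) fun heq => ?_⟩
  have hge : hl K z s.r ≤ hl K z s.m := heq ▸ h1
  obtain ⟨e⟩ := e
  obtain ⟨k, hk⟩ := (bij_of_inj_ln _ hinj hge).2 e.toLinearMap
  have hk : s.g ∘ₗ k = e.toLinearMap := hk
  have := inRad_comp_right (s_g_rad s) k
  rw [hk, inRad_iff_nbij hz s.r_indec] at this
  exact this e.bijective

variable (K) in
theorem hl_step_r (s : AlmostSplitSeq R) {x z : ModA R} (hx : x.IsIndec) (hz : z.IsIndec) (h : Arr s.l x)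
    (h0 : ∀ c : Hm s.r z, c = 0) : hl K x z ≤ hl K s.l z ∧ (z.Iso s.l → hl K x z < hl K s.l z) := by
  obtain ⟨d⟩ := Dec.nonempty s.m
  obtain ⟨j, hj⟩ := (s_arr_l_iff s d hx).1 h
  have h1 : hl K x z ≤ hl K s.m z := by
    rw [hl_sum_left K d, ← hl_iso_left K hj]
    exact Finset.single_le_sum (f := fun j => hl K (d.N j) z) (fun _ _ => Nat.zero_le _) (Finset.mem_univ j)
  have hinj : Function.Injective (prec K (Z := z) s.f) := by
    rw [← LinearMap.ker_eq_bot, eq_bot_iff]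
    intro k hk
    obtain ⟨c, hc⟩ := s_thru_g s k hk
    rw [Submodule.mem_bot, ← hc, h0 c, LinearMap.zero_comp]
  have h2 : hl K s.m z ≤ hl K s.l z := ln_inj _ hinj
  refine ⟨h1.trans h2, fun e => lt_of_le_of_ne (h1.trans h2) fun heq => ?_⟩
  have hge : hl K s.l z ≤ hl K s.m z := heq ▸ h1
  obtain ⟨e⟩ := e
  obtain ⟨k, hk⟩ := (bij_of_inj_ln _ hinj hge).2 e.symm.toLinearMap
  have hk : k ∘ₗ s.f = e.symm.toLinearMap := hk
  have := inRad_comp_left (s_f_rad s) k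
  rw [hk, inRad_iff_nbij s.l_indec hz] at this
  exact this e.symm.bijective

theorem pos_of_mul_eq {a b c d : ℕ} (h : a * b = c * d) (ha : 0 < a) (hb : 0 < b) : 0 < c := by
  rcases Nat.eq_zero_or_pos c with h0 | h0
  · subst h0
    have := Nat.mul_pos ha hb
    omega
  · exact h0

/-- an arrow `s'.r ⟶ s.r` yields an arrow from the translate -/
theorem arr_shift (K : Type u) {R : Type u} [CommRing K] [IsArtinianRing K] [Ring R] [Algebra K R] [Module.Finite K R] (s s' : AlmostSplitSeq R) (h : Arr s'.r s.r) : Arr s'.l s.l ∧ Arr s.l s'.r := by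
  classical
  obtain ⟨d⟩ := Dec.nonempty s.m
  obtain ⟨d'⟩ := Dec.nonempty s'.m
  obtain ⟨j, hj⟩ := (s_arr_r_iff s d s'.r_indec).1 h
  have h1 := cnt_lem K s s' d d'
  have h2 := pos_of_mul_eq h1 (Finset.card_pos.2 ⟨j, by simpa using hj⟩) (mu_pos K s'.r_indec)
  obtain ⟨i, hi⟩ := Finset.card_pos.1 h2
  have hi : (d'.N i).Iso s.l := by simpa using hi
  exact ⟨(s_arr_l s' d' i).iso (iso_refl _) hi, (s_arr_r s' d' i).iso hi (iso_refl _)⟩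

/-- an arrow `s'.l ⟶ s.l` yields arrows with the inverse translate -/
theorem arr_shift' (K : Type u) {R : Type u} [CommRing K] [IsArtinianRing K] [Ring R] [Algebra K R] [Module.Finite K R] (s s' : AlmostSplitSeq R) (h : Arr s'.l s.l) : Arr s.l s'.r ∧ Arr s'.r s.r := by
  classical
  obtain ⟨d⟩ := Dec.nonempty s.m
  obtain ⟨d'⟩ := Dec.nonempty s'.m
  obtain ⟨j, hj⟩ := (s_arr_l_iff s' d' s.l_indec).1 h
  have h1 := cnt_lem K s s' d d'
  have h2 := pos_of_mul_eq h1.symm (Finset.card_pos.2 ⟨j, by simpa using hj⟩) (mu_pos K s.l_indec)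
  obtain ⟨i, hi⟩ := Finset.card_pos.1 h2
  have hi : (d.N i).Iso s'.r := by simpa using hi
  exact ⟨(s_arr_l s d i).iso (iso_refl _) hi, (s_arr_r s d i).iso hi (iso_refl _)⟩

theorem Arr.tp {X Y : ModA R} (h : Arr X Y) (hX : X.IsIndec) (hY : Y.IsIndec) :
    TransGen Pr (⟨X, hX⟩ : IndecModA R) ⟨Y, hY⟩ := .single (Arr.pr (x := ⟨X, hX⟩) (y := ⟨Y, hY⟩) h)

theorem LC_empty (t : Anti K R R') (hm : fx m) (hP : ∀ v : VC m, ¬ IsP K (rep v).1) : LC m = ∅ := by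
  have hs : ∀ v : VC m, ∃ s : AlmostSplitSeq R, s.r = (rep v).1 := fun v => exists_AR t (rep v).2 (hP v)
  choose s hs using hs
  have hs' : ∀ v : VC m, (s v).r.Iso (rep v).1 := fun v => hs v ▸ iso_refl _
  have hr : ∀ v : VC m, Cy m (sr (s v)) := fun v => (rep_cy v).iso (x' := sr (s v)) (iso_symm (hs' v))
  have hstep : ∀ v w : VC m, arrV v w → v ∉ LC m → w ∉ LC m := by
    intro v w hvw hv hw
    apply hw (s w) (hs' w)
    have hv : ∃ s' : AlmostSplitSeq R, s'.r.Iso (rep v).1 ∧ Cy m (sl s') := by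
      by_contra hcon
      push Not at hcon
      exact hv hcon
    obtain ⟨s', h1, h2⟩ := hv
    have h3 : Arr s'.r (s w).r := Arr.iso hvw (iso_symm h1) (iso_symm (hs' w))
    obtain ⟨h4, h5⟩ := arr_shift K (s w) s' h3
    have h6 : Cy m (sr s') := (rep_cy v).iso (x' := sr s') (iso_symm h1)
    exact h2.conv h6 (h4.tp s'.l_indec (s w).l_indec) (h5.tp (s w).l_indec s'.r_indec)
  by_contra hne
  obtain ⟨v0, hv0⟩ := Set.nonempty_iff_ne_empty.2 hne
  have hall : ∀ v : VC m, v ∈ LC m := by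
    intro v
    by_contra hv
    have : ∀ w, TransGen arrV v w → w ∉ LC m := by
      intro w hw
      induction hw with
      | single h => exact hstep _ _ h hv
      | tail _ h ih => exact hstep _ _ h ih
    exact this v0 (conn_V hm v v0) hv0
  have hle : ∀ z v w : VC m, arrV v w → hl K (rep z).1 (rep v).1 ≤ hl K (rep z).1 (rep w).1 ∧
      (z = w → hl K (rep z).1 (rep v).1 < hl K (rep z).1 (rep w).1) := by
    intro z v w h
    have := hl_step_l K (s w) (rep v).2 (rep z).2 (Arr.iso h (iso_refl _) (iso_symm (hs' w)))
      (fun c => hom_l_zero (x := rep z) (rep_cy z) (hr w) (hall w _ (hs' w)) c)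
    rw [hl_iso_right K (hs' w)] at this
    refine ⟨this.1, fun e => this.2 ?_⟩
    rw [e]; exact iso_symm (hs' w)
  have hle2 : ∀ z v w : VC m, ReflTransGen arrV v w → hl K (rep z).1 (rep v).1 ≤ hl K (rep z).1 (rep w).1 := by
    intro z v w h
    induction h with
    | refl => exact le_rfl
    | tail _ h ih => exact ih.trans (hle z _ _ h).1
  obtain ⟨u, hu1, hu2⟩ := TransGen.tail'_iff.1 (conn_V hm v0 v0)
  have h1 := hle2 v0 v0 u hu1
  have h2 := (hle v0 u v0 hu2).2 rfl
  omega

theorem RRC_empty (t : Anti K R R') (hm : fx m) (hI : ∀ v : VC m, ¬ IsI t (rep v).1) : RRC m = ∅ := by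
  have hs : ∀ v : VC m, ∃ s : AlmostSplitSeq R, s.l.Iso (rep v).1 := fun v => exists_AR' t (rep v).2 (hI v)
  choose s hs' using hs
  have hl' : ∀ v : VC m, Cy m (sl (s v)) := fun v => (rep_cy v).iso (x' := sl (s v)) (iso_symm (hs' v))
  have hstep : ∀ v w : VC m, arrV v w → w ∉ RRC m → v ∉ RRC m := by
    intro v w hvw hw hv
    apply hv (s v) (hs' v)
    have hw : ∃ s' : AlmostSplitSeq R, s'.l.Iso (rep w).1 ∧ Cy m (sr s') := by
      by_contra hcon
      push Not at hcon
      exact hw hcon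
    obtain ⟨s', h1, h2⟩ := hw
    have h3 : Arr (s v).l s'.l := Arr.iso hvw (iso_symm (hs' v)) (iso_symm h1)
    obtain ⟨h4, h5⟩ := arr_shift' K s' (s v) h3
    have h6 : Cy m (sl s') := (rep_cy w).iso (x' := sl s') (iso_symm h1)
    exact h6.conv h2 (h4.tp s'.l_indec (s v).r_indec) (h5.tp (s v).r_indec s'.r_indec)
  by_contra hne
  obtain ⟨v0, hv0⟩ := Set.nonempty_iff_ne_empty.2 hne
  have hall : ∀ v : VC m, v ∈ RRC m := by
    intro w
    by_contra hw
    have : ∀ v, TransGen arrV v w → v ∉ RRC m := by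
      intro v hv
      induction hv using TransGen.head_induction_on with
      | single h => exact hstep _ _ h hw
      | head h _ ih => exact hstep _ _ h ih
    exact this v0 (conn_V hm v0 w) hv0
  have hle : ∀ z v w : VC m, arrV v w → hl K (rep w).1 (rep z).1 ≤ hl K (rep v).1 (rep z).1 ∧
      (z = v → hl K (rep w).1 (rep z).1 < hl K (rep v).1 (rep z).1) := by
    intro z v w h
    have := hl_step_r K (s v) (rep w).2 (rep z).2 (Arr.iso h (iso_symm (hs' v)) (iso_refl _))
      (fun c => hom_r_zero (x := rep z) (rep_cy z) (hl' v) (hall v _ (hs' v)) c)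
    rw [hl_iso_left K (hs' v)] at this
    refine ⟨this.1, fun e => this.2 ?_⟩
    rw [e]; exact iso_symm (hs' v)
  have hle2 : ∀ z v w : VC m, ReflTransGen arrV v w → hl K (rep w).1 (rep z).1 ≤ hl K (rep v).1 (rep z).1 := by
    intro z v w h
    induction h with
    | refl => exact le_rfl
    | tail _ h ih => exact (hle z _ _ h).1.trans ih
  obtain ⟨u, hu1, hu2⟩ := TransGen.head'_iff.1 (conn_V hm v0 v0)
  have h1 := hle2 v0 u v0 hu2
  have h2 := (hle v0 v0 u hu1).2 rfl
  omega

theorem unb_V (K : Type u) {R : Type u} [CommRing K] [IsArtinianRing K] [Ring R] [Algebra K R] [Module.Finite K R] {m : IndecModA R} (hL : LC m = ∅) (v0 : VC m) (N : ℕ) : ∃ v : VC m, N < ln R (rep v).1.M := by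
  by_contra hcon
  push Not at hcon
  let P : ModA R → Prop := fun X => ∃ h : X.IsIndec, Cy m ⟨X, h⟩
  have hPb : ∀ X, P X → X.IsIndec ∧ ln R X.M ≤ N := by
    rintro X ⟨h, hc⟩
    refine ⟨h, ?_⟩
    obtain ⟨e⟩ := rep_vx ⟨X, h⟩ hc
    rw [← ln_equiv e]
    exact hcon _
  have hnt : Nontrivial (rep v0).1.M := (rep v0).2.1
  obtain ⟨x0, hx0⟩ := exists_ne (0 : (rep v0).1.M)
  have key : ∀ n, ∃ (X : ModA R) (c : Hm X (rep v0).1) (u : Hm (regM K R) X), P X ∧ RC P n X (rep v0).1 c ∧ c ∘ₗ u ≠ 0 := by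
    intro n
    induction n with
    | zero =>
      refine ⟨(rep v0).1, LinearMap.id, LinearMap.toSpanSingleton R (rep v0).1.M x0, ⟨(rep v0).2, rep_cy v0⟩, RC.nil _ ⟨(rep v0).2, rep_cy v0⟩, ?_⟩
      intro h
      have := LinearMap.congr_fun h (1 : R)
      simp only [LinearMap.id_comp] at this
      apply hx0
      rw [← one_smul R x0]
      exact this
    | succ n ih =>
      obtain ⟨X, c, u, ⟨hX, hXc⟩, hc, hne⟩ := ih
      have hv : vx ⟨X, hX⟩ hXc ∉ LC m := by rw [hL]; exact Set.notMem_empty _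
      have : ∃ s : AlmostSplitSeq R, s.r.Iso (rep (vx ⟨X, hX⟩ hXc)).1 ∧ Cy m (sl s) := by
        by_contra hcon
        push Not at hcon
        exact hv hcon
      obtain ⟨s, h1, h2⟩ := this
      have h3 : s.r.Iso X := iso_trans h1 (rep_vx ⟨X, hX⟩ hXc)
      have h4 : Cy m (sr s) := hXc.iso (x' := sr s) (iso_symm h3)
      obtain ⟨e⟩ := h3
      obtain ⟨d⟩ := Dec.nonempty s.m
      obtain ⟨y, hy⟩ := s.surj (e.symm (u (1 : R)))
      let h' : Hm (regM K R) s.m := LinearMap.toSpanSingleton R s.m.M y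
      have hu : (e.toLinearMap ∘ₗ s.g) ∘ₗ h' = u := by
        refine LinearMap.ext_ring ?_
        show e (s.g ((1 : R) • y)) = u (1 : R)
        rw [one_smul, hy, LinearEquiv.apply_symm_apply]
      have hne' : ∃ j, c ∘ₗ (((e.toLinearMap ∘ₗ s.g) ∘ₗ d.inc j) ∘ₗ d.prj j ∘ₗ h') ≠ 0 := by
        by_contra hall
        push Not at hall
        apply hne
        rw [← hu, d.mid_sum (e.toLinearMap ∘ₗ s.g) h']
        refine LinearMap.ext fun z => ?_
        rw [LinearMap.comp_apply, LinearMap.sum_apply, map_sum]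
        exact Finset.sum_eq_zero fun j _ => LinearMap.congr_fun (hall j) z
      obtain ⟨j, hj⟩ := hne'
      have hPN : P (d.N j) := ⟨d.indec j, mesh_cy h2 h4 d j⟩
      refine ⟨d.N j, c ∘ₗ ((e.toLinearMap ∘ₗ s.g) ∘ₗ d.inc j), d.prj j ∘ₗ h', hPN, RC.cons hPN _ ?_ _ hc, hj⟩
      rw [← inRad_iff_nbij (d.indec j) hX]
      exact inRad_comp_right (inRad_comp_left (s_g_rad s) e.toLinearMap) _
  obtain ⟨X, c, u, _, hc, hne⟩ := key (2^N - 1)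
  apply hne
  rw [hc.zero N hPb, LinearMap.zero_comp]

end
end CF
end

section
namespace CF
set_option linter.unusedSectionVars false
set_option linter.unusedVariables false
noncomputable section
open Relation

section choices
variable {R : Type u} [Ring R] {m : IndecModA R}

theorem ex_seq (v : VC m) (h : v ∉ LC m) : ∃ (s : AlmostSplitSeq R) (d : Dec s.m), s.r.Iso (rep v).1 ∧ Cy m (sl s) ∧
    ((∃ (s' : AlmostSplitSeq R) (d' : Dec s'.m), s'.r.Iso (rep v).1 ∧ 3 ≤ Fintype.card d'.ι) → 3 ≤ Fintype.card d.ι) := by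
  have h1 : ∃ s : AlmostSplitSeq R, s.r.Iso (rep v).1 ∧ Cy m (sl s) := by
    by_contra hcon
    push Not at hcon
    exact h hcon
  obtain ⟨s, hs, hl⟩ := h1
  by_cases hb : ∃ (s' : AlmostSplitSeq R) (d' : Dec s'.m), s'.r.Iso (rep v).1 ∧ 3 ≤ Fintype.card d'.ι
  · obtain ⟨s', d', h1, h2⟩ := hb
    exact ⟨s', d', h1, hl.iso (x' := sl s') ((s_uniq s s').1 (iso_trans hs (iso_symm h1))), fun _ => h2⟩
  · obtain ⟨d⟩ := Dec.nonempty s.m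
    exact ⟨s, d, hs, hl, fun h => absurd h hb⟩

theorem ex_seq' (v : VC m) (h : v ∉ RRC m) : ∃ s : AlmostSplitSeq R, s.l.Iso (rep v).1 ∧ Cy m (sr s) := by
  by_contra hcon
  push Not at hcon
  exact h hcon

def Sq (v : VC m) (h : v ∉ LC m) : AlmostSplitSeq R := (ex_seq v h).choose
def Dq (v : VC m) (h : v ∉ LC m) : Dec (Sq v h).m := (ex_seq v h).choose_spec.choose
theorem Sq_r (v : VC m) (h : v ∉ LC m) : (Sq v h).r.Iso (rep v).1 := (ex_seq v h).choose_spec.choose_spec.1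
theorem Sq_l (v : VC m) (h : v ∉ LC m) : Cy m (sl (Sq v h)) := (ex_seq v h).choose_spec.choose_spec.2.1
theorem Sq_big (v : VC m) (h : v ∉ LC m) (s' : AlmostSplitSeq R) (d' : Dec s'.m) (h1 : s'.r.Iso (rep v).1)
    (h2 : 3 ≤ Fintype.card d'.ι) : 3 ≤ Fintype.card (Dq v h).ι :=
  (ex_seq v h).choose_spec.choose_spec.2.2 ⟨s', d', h1, h2⟩
theorem Sq_rc (v : VC m) (h : v ∉ LC m) : Cy m (sr (Sq v h)) := (rep_cy v).iso (x' := sr (Sq v h)) (iso_symm (Sq_r v h))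

def Sq' (v : VC m) (h : v ∉ RRC m) : AlmostSplitSeq R := (ex_seq' v h).choose
theorem Sq'_l (v : VC m) (h : v ∉ RRC m) : (Sq' v h).l.Iso (rep v).1 := (ex_seq' v h).choose_spec.1
theorem Sq'_r (v : VC m) (h : v ∉ RRC m) : Cy m (sr (Sq' v h)) := (ex_seq' v h).choose_spec.2

open Classical in
def tV (v : VC m) : VC m := if h : v ∉ LC m then vx (sl (Sq v h)) (Sq_l v h) else v
open Classical in
def sV (v : VC m) : VC m := if h : v ∉ RRC m then vx (sr (Sq' v h)) (Sq'_r v h) else v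
def meV (v : VC m) (h : v ∉ LC m) (j : (Dq v h).ι) : VC m :=
  vx (dn (Dq v h) j) (mesh_cy (Sq_l v h) (Sq_rc v h) (Dq v h) j)
open Classical in
def meshV (v : VC m) : Multiset (VC m) := if h : v ∉ LC m then Finset.univ.val.map (meV v h) else 0

theorem tV_eq (v : VC m) (h : v ∉ LC m) : tV v = vx (sl (Sq v h)) (Sq_l v h) := dif_pos h
theorem sV_eq (v : VC m) (h : v ∉ RRC m) : sV v = vx (sr (Sq' v h)) (Sq'_r v h) := dif_pos h
theorem meshV_eq (v : VC m) (h : v ∉ LC m) : meshV v = Finset.univ.val.map (meV v h) := dif_pos h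

theorem tV_iso (v : VC m) (h : v ∉ LC m) : (rep (tV v)).1.Iso (Sq v h).l := by
  rw [tV_eq v h]; exact rep_vx _ _
theorem sV_iso (v : VC m) (h : v ∉ RRC m) : (rep (sV v)).1.Iso (Sq' v h).r := by
  rw [sV_eq v h]; exact rep_vx _ _

theorem mem_meshV (v : VC m) (h : v ∉ LC m) (e : VC m) : e ∈ meshV v ↔ ∃ j, ((Dq v h).N j).Iso (rep e).1 := by
  rw [meshV_eq v h]
  simp only [Multiset.mem_map, Finset.mem_val, Finset.mem_univ, true_and]
  exact exists_congr fun j => vx_eq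

theorem tV_mem (v : VC m) (h : v ∉ LC m) : tV v ∉ RRC m := fun hr =>
  hr (Sq v h) (iso_symm (tV_iso v h)) (Sq_rc v h)
theorem sV_mem (v : VC m) (h : v ∉ RRC m) : sV v ∉ LC m := fun hr =>
  hr (Sq' v h) (iso_symm (sV_iso v h)) ((rep_cy v).iso (x' := sl (Sq' v h)) (iso_symm (Sq'_l v h)))
theorem sV_tV (v : VC m) (h : v ∉ LC m) : sV (tV v) = v := by
  rw [sV_eq _ (tV_mem v h), vx_eq]
  refine iso_trans ?_ (Sq_r v h)
  exact (s_uniq _ _).2 (iso_trans (Sq'_l _ (tV_mem v h)) (tV_iso v h))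
theorem tV_sV (v : VC m) (h : v ∉ RRC m) : tV (sV v) = v := by
  rw [tV_eq _ (sV_mem v h), vx_eq]
  refine iso_trans ?_ (Sq'_l v h)
  exact (s_uniq _ _).1 (iso_trans (Sq_r _ (sV_mem v h)) (sV_iso v h))

def lenV (v : VC m) : ℕ := ln R (rep v).1.M

theorem ln_iso {X Y : ModA R} (h : X.Iso Y) : ln R X.M = ln R Y.M := by
  obtain ⟨e⟩ := h
  exact ln_equiv e

end choices

variable {K R R' : Type u} [CommRing K] [IsArtinianRing K] [Ring R] [Ring R'] [Algebra K R] [Algebra K R']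
  [Module.Finite K R] [Module.Finite K R']
variable {m : IndecModA R}

def QV (t : Anti K R R') (hm : fx m) : TQ (VC m) where
  L := LC m
  R := RRC m
  hL := LC_fin t m
  hR := RRC_fin t m
  t := tV
  s := sV
  t_mem := tV_mem
  s_t := sV_tV
  s_mem := sV_mem
  t_s := tV_sV
  mesh := meshV
  arr := arrV
  len := lenV
  len_pos := by
    intro v
    have : Nontrivial (rep v).1.M := (rep v).2.1
    exact ln_pos
  arr_mesh := by
    intro v h e
    rw [mem_meshV v h, ← s_arr_r_iff (Sq v h) (Dq v h) (rep e).2]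
    exact ⟨fun a => a.iso (iso_refl _) (iso_symm (Sq_r v h)), fun a => a.iso (iso_refl _) (Sq_r v h)⟩
  arr_mesh' := by
    intro v h e
    rw [mem_meshV v h, ← s_arr_l_iff (Sq v h) (Dq v h) (rep e).2]
    exact ⟨fun a => a.iso (tV_iso v h) (iso_refl _), fun a => a.iso (iso_symm (tV_iso v h)) (iso_refl _)⟩
  len_mesh := by
    intro v h
    rw [meshV_eq v h, Multiset.map_map]
    have e := s_ln (Sq v h) (Dq v h)
    rw [ln_iso (Sq_r v h), ← ln_iso (tV_iso v h)] at e
    refine e.trans ?_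
    refine Finset.sum_congr rfl fun j _ => ?_
    exact (ln_iso (rep_vx (m := m) (dn (Dq v h) j) (mesh_cy (Sq_l v h) (Sq_rc v h) (Dq v h) j))).symm
  pred_fin := by
    intro v
    obtain ⟨E, g, hg⟩ := exists_RAS t (rep v).2
    obtain ⟨d⟩ := Dec.nonempty E
    exact fin_of_cover (fun j => dn d j) _ fun e he => ras_arr hg d (rep e).2 he
  succ_fin := by
    intro v
    obtain ⟨E, g, hg⟩ := exists_LAS t (rep v).2
    obtain ⟨d⟩ := Dec.nonempty E
    exact fin_of_cover (fun j => dn d j) _ fun e he => las_arr hg d (rep e).2 he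
  conn := conn_V hm

def QVal (t : Anti K R R') (hm : fx m) : (QV t hm).Val where
  μ := fun v => mu K (rep v).1
  pos := fun v => mu_pos K (rep v).2
  mono := by
    intro v h
    have := mu_mono K (Sq v h)
    rw [mu_iso K (Sq_r v h), ← mu_iso K (tV_iso v h)] at this
    exact this
  cnt := by
    intro _ x e hx he
    classical
    have key := cnt_lem K (Sq x hx) (Sq e he) (Dq x hx) (Dq e he)
    rw [mu_iso K (Sq_r e he), ← mu_iso K (tV_iso x hx)] at key
    have h1 : Multiset.count e (meshV x) = (Finset.univ.filter fun j => ((Dq x hx).N j).Iso (Sq e he).r).card := by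
      rw [meshV_eq x hx, Multiset.count_map, ← Finset.filter_val, Finset.card_val]
      congr 1
      ext j
      simp only [Finset.mem_filter, Finset.mem_univ, true_and]
      rw [eq_comm]
      refine vx_eq.trans ⟨fun a => iso_trans a (iso_symm (Sq_r e he)), fun a => iso_trans a (Sq_r e he)⟩
    have h2 : Multiset.count (tV x) (meshV e) = (Finset.univ.filter fun j => ((Dq e he).N j).Iso (Sq x hx).l).card := by
      rw [meshV_eq e he, Multiset.count_map, ← Finset.filter_val, Finset.card_val]
      congr 1
      ext j
      simp only [Finset.mem_filter, Finset.mem_univ, true_and]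
      rw [eq_comm]
      refine vx_eq.trans ⟨fun a => iso_trans a (tV_iso x hx), fun a => iso_trans a (iso_symm (tV_iso x hx))⟩
    show Multiset.count e (meshV x) * mu K (rep e).1 = Multiset.count (tV x) (meshV e) * mu K (rep (tV x)).1
    rw [h1, h2]
    exact key
  unb := by
    intro hL _ N
    exact unb_V K hL (vx m ⟨hm.1, hm.1⟩) N

/-- the exceptional vertices in the component of `m` -/
def BB (m : IndecModA R) : Set (ARVertex R) := {v | ∃ x, ARVertex.mk x = v ∧ Cy m x ∧ ¬ AlphaLe2 x.1}

theorem bad_or {t : Anti K R R'} {hm : fx m} {x : IndecModA R} (hx : Cy m x) (ha : ¬ AlphaLe2 x.1) :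
    vx x hx ∈ LC m ∨ (QV t hm).bad (vx x hx) := by
  by_cases hL : vx x hx ∈ LC m
  · exact Or.inl hL
  · right
    refine ⟨hL, ?_⟩
    unfold AlphaLe2 at ha
    push Not at ha
    obtain ⟨s, hs, k, N, h1, h2, h3, hk⟩ := ha
    obtain ⟨d, hd⟩ := Dec.ofSub k N h1 h2 h3
    have := Sq_big (vx x hx) hL s d (iso_trans hs (iso_symm (rep_vx x hx))) (by omega)
    show 3 ≤ (meshV (vx x hx)).card
    rw [meshV_eq _ hL, Multiset.card_map]
    exact this

theorem BB_fin (t : Anti K R R') (hm : fx m) : (BB m).Finite := by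
  have h1 := (TQ.main (QVal t hm)).1
  have h2 := LC_fin t m
  refine ((h2.union h1).image Subtype.val).subset ?_
  rintro _ ⟨x, rfl, hx, ha⟩
  exact ⟨vx x hx, bad_or hx ha, rfl⟩

theorem BB_empty (t : Anti K R R') (hm : fx m) (hP : ∀ x, Cy m x → ¬ IsP K x.1) (hI : ∀ x, Cy m x → ¬ IsI t x.1)
    {x : IndecModA R} (hx : Cy m x) : AlphaLe2 x.1 := by
  by_contra ha
  have hL : LC m = ∅ := LC_empty t hm fun v => hP _ (rep_cy v)
  have hR : RRC m = ∅ := RRC_empty t hm fun v => hI _ (rep_cy v)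
  rcases bad_or (t := t) (hm := hm) hx ha with h | h
  · rw [hL] at h; exact h
  · exact (TQ.main (QVal t hm)).2 hL hR _ h

theorem main_F (t : Anti K R R') : ∃ F : Set (ARVertex R), F.Finite ∧ ∀ X : IndecModA R,
    IsCycleFiniteModule X.1 → ARVertex.mk X ∉ F → AlphaLe2 X.1 := by
  classical
  obtain ⟨dR⟩ := Dec.nonempty (regM K R)
  obtain ⟨dR'⟩ := Dec.nonempty (regM K R')
  let x : dR.ι ⊕ dR'.ι → IndecModA R := Sum.elim (fun j => dn dR j)
    (fun j => ⟨D t.symm (dR'.N j), D_indec (dR'.indec j)⟩)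
  refine ⟨⋃ j, {v | fx (x j) ∧ v ∈ BB (x j)}, Set.finite_iUnion fun j => ?_, ?_⟩
  · by_cases h : fx (x j)
    · exact (BB_fin t h).subset fun v hv => hv.2
    · exact Set.finite_empty.subset fun v hv => absurd hv.1 h
  · intro X hX hF
    have hm := fx_of hX
    have hXX : Cy X X := ⟨hm.1, hm.1⟩
    by_contra ha
    have hj : ∀ j, ¬ Cy X (x j) := by
      intro j hj
      obtain ⟨h1, h2⟩ := hm.move hj
      exact hF (Set.mem_iUnion.2 ⟨j, h1, X, rfl, h2, ha⟩)
    refine ha (BB_empty t hm ?_ ?_ hXX)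
    · intro y hy hp
      obtain ⟨j, hj'⟩ := P_fin dR y.2 hp
      exact hj (Sum.inl j) (hy.iso (x' := x (Sum.inl j)) (iso_symm hj'))
    · intro y hy hp
      obtain ⟨j, hj'⟩ := I_fin t dR' y.2 hp
      exact hj (Sum.inr j) (hy.iso (x' := x (Sum.inr j)) (iso_symm hj'))

/-- the canonical anti-isomorphism between the opposite algebra and the algebra -/
def opAnti (K A : Type u) [CommRing K] [Ring A] [Algebra K A] : Anti K Aᵐᵒᵖ A where
  a := (MulOpposite.opAddEquiv (α := A)).symm.toAddMonoidHom
  b := (MulOpposite.opAddEquiv (α := A)).toAddMonoidHom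
  ab := fun _ => rfl
  ba := fun _ => rfl
  a_mul := fun _ _ => rfl
  b_mul := fun _ _ => rfl
  a_K := fun _ => rfl
  b_K := fun _ => rfl

theorem final (K A : Type u) [CommRing K] [IsArtinianRing K] [Ring A] [Algebra K A] [Module.Finite K A] :
    ∃ F : Set (ARVertex Aᵐᵒᵖ), F.Finite ∧ ∀ X : IndecModA Aᵐᵒᵖ,
    IsCycleFiniteModule X.1 → ARVertex.mk X ∉ F → AlphaLe2 X.1 := by
  have : Module.Finite K Aᵐᵒᵖ := Module.Finite.equiv (MulOpposite.opLinearEquiv K (M := A))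
  exact main_F (opAnti K A)

end
end CF
end

/-- **Theorem 7.** Let `A` be a basic indecomposable artin algebra. Then, for all but
finitely many isomorphism classes of nonprojective cycle-finite modules `M` in `ind A`,
one has `α(M) ≤ 2`, i.e. the middle term of the almost split sequence ending at `M` has
at most two indecomposable direct summands. -/
theorem cycle_finite_modules_alpha_le_two
    (K A : Type u) [CommRing K] [IsArtinianRing K] [Ring A] [Algebra K A]
    [Module.Finite K A] (hbasic : IsBasicAlgebra A) (hconn : IsConnectedAlgebra A) :
    ∃ F : Set (ARVertex Aᵐᵒᵖ), F.Finite ∧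
      ∀ X : IndecModA Aᵐᵒᵖ, IsCycleFiniteModule X.1 → ¬Module.Projective Aᵐᵒᵖ X.1.M →
        ARVertex.mk X ∉ F → AlphaLe2 X.1 := by
  obtain ⟨F, hF, h⟩ := CF.final K A
  exact ⟨F, hF, fun X hX _ hn => h X hX hn⟩
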